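/- Let ab be an edge of an even-hole-free graph G, let (J,M) be optimal for ab, and let Z be the set of vertices adjacent to both a and b. If F is a small subgraph and neither a nor b has a neighbour in V(F), then X(F) is local. -/

import Mathlib

open SimpleGraph

namespace EHF

variable {V : Type*} {W : Type*} {U : Type*}

/-- The closed neighbourhood `N[a]` of a vertex `a`. -/
def closedNbhd (G : SimpleGraph V) (a : V) : Set V := insert a (G.neighborSet a)

/-- A hole: an induced cycle of length at least four. -/
def IsHole (G : SimpleGraph V) {v : V} (c : G.Walk v v) : Prop :=
  c.IsCycle ∧ 4 ≤ c.length ∧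
    ∀ x y : V, x ∈ c.support → y ∈ c.support → G.Adj x y → s(x, y) ∈ c.edges

/-- A graph is even-hole-free if it has no hole with an even number of vertices. -/
def EvenHoleFree (G : SimpleGraph V) : Prop :=
  ∀ (v : V) (c : G.Walk v v), IsHole G c → ¬ Even c.length

/-- A vertex is bisimplicial if its neighbourhood is the union of two cliques. -/
def Bisimplicial (G : SimpleGraph V) (v : V) : Prop :=
  ∃ K₁ K₂ : Set V, G.IsClique K₁ ∧ G.IsClique K₂ ∧ G.neighborSet v = K₁ ∪ K₂

/-- `F` induces a connected subgraph of `G`. -/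
def ConnectedSubset (G : SimpleGraph V) (F : Set V) : Prop :=
  F.Nonempty ∧ ∀ x ∈ F, ∀ y ∈ F, ∃ p : G.Walk x y, ∀ z ∈ p.support, z ∈ F

/-- `F` is the vertex set of a connected component of `G` minus the vertex set `S`. -/
def IsComponentOf (G : SimpleGraph V) (S F : Set V) : Prop :=
  ConnectedSubset G F ∧ Disjoint F S ∧
    ∀ x ∈ F, ∀ y : V, y ∉ S → G.Adj x y → y ∈ F

/-- The set of vertices of `S` having a neighbour in `F`. -/
def Att (G : SimpleGraph V) (S F : Set V) : Set V :=
  {v ∈ S | ∃ x ∈ F, G.Adj v x}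

/-- A cutset: the rest of the graph is the union of two nonempty sets that are
anticomplete to each other. -/
def IsCutset (G : SimpleGraph V) (C : Set V) : Prop :=
  ∃ X Y : Set V, X.Nonempty ∧ Y.Nonempty ∧ Disjoint X Y ∧ X ∪ Y = Cᶜ ∧
    ∀ x ∈ X, ∀ y ∈ Y, ¬ G.Adj x y

/-- `G` has a full star cutset with centre `v`. -/
def FullStarCutset (G : SimpleGraph V) (v : V) : Prop :=
  IsCutset G (closedNbhd G v)

/-- A walk is induced if every edge of `G` between vertices of the walk is an
edge of the walk. -/
def InducedWalk (G : SimpleGraph V) {x y : V} (P : G.Walk x y) : Prop :=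
  ∀ u v : V, u ∈ P.support → v ∈ P.support → G.Adj u v → s(u, v) ∈ P.edges

/-- A theta with ends `u,w` and constituent paths `P₁,P₂,P₃`, as an induced
subgraph of `G`. -/
def IsThetaIn (G : SimpleGraph V) (u w : V) (P₁ P₂ P₃ : G.Walk u w) : Prop :=
  u ≠ w ∧ P₁.IsPath ∧ P₂.IsPath ∧ P₃.IsPath ∧
  2 ≤ P₁.length ∧ 2 ≤ P₂.length ∧ 2 ≤ P₃.length ∧
  (∀ v : V, v ∈ P₁.support → v ∈ P₂.support → v = u ∨ v = w) ∧
  (∀ v : V, v ∈ P₁.support → v ∈ P₃.support → v = u ∨ v = w) ∧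
  (∀ v : V, v ∈ P₂.support → v ∈ P₃.support → v = u ∨ v = w) ∧
  (∀ x y : V, (x ∈ P₁.support ∨ x ∈ P₂.support ∨ x ∈ P₃.support) →
    (y ∈ P₁.support ∨ y ∈ P₂.support ∨ y ∈ P₃.support) → G.Adj x y →
    s(x, y) ∈ P₁.edges ∨ s(x, y) ∈ P₂.edges ∨ s(x, y) ∈ P₃.edges)

/-- A near-prism with bases `{a₁,a₂,a₃}`, `{b₁,b₂,b₃}` and constituent paths
`R₁,R₂,R₃`, as an induced subgraph of `G`. -/
def IsNearPrismIn (G : SimpleGraph V) (a₁ a₂ a₃ b₁ b₂ b₃ : V)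
    (R₁ : G.Walk a₁ b₁) (R₂ : G.Walk a₂ b₂) (R₃ : G.Walk a₃ b₃) : Prop :=
  G.Adj a₁ a₂ ∧ G.Adj a₁ a₃ ∧ G.Adj a₂ a₃ ∧
  G.Adj b₁ b₂ ∧ G.Adj b₁ b₃ ∧ G.Adj b₂ b₃ ∧
  (({a₁, a₂, a₃} : Set V) ∩ ({b₁, b₂, b₃} : Set V) = ({a₃} : Set V) ∩ ({b₃} : Set V)) ∧
  R₁.IsPath ∧ R₂.IsPath ∧ R₃.IsPath ∧
  (∀ v : V, v ∈ R₁.support → v ∉ R₂.support) ∧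
  (∀ v : V, v ∈ R₁.support → v ∉ R₃.support) ∧
  (∀ v : V, v ∈ R₂.support → v ∉ R₃.support) ∧
  (∀ p q : V, (p ∈ R₁.support ∨ p ∈ R₂.support ∨ p ∈ R₃.support) →
    (q ∈ R₁.support ∨ q ∈ R₂.support ∨ q ∈ R₃.support) → G.Adj p q →
    s(p, q) ∈ R₁.edges ∨ s(p, q) ∈ R₂.edges ∨ s(p, q) ∈ R₃.edges ∨
    s(p, q) = s(a₁, a₂) ∨ s(p, q) = s(a₁, a₃) ∨ s(p, q) = s(a₂, a₃) ∨
    s(p, q) = s(b₁, b₂) ∨ s(p, q) = s(b₁, b₃) ∨ s(p, q) = s(b₂, b₃))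

/-- An extended near-prism contained in `G`, with cross-edge `xy` where
`x` lies in the interior of `R₁` and `y` in the interior of `R₂`. -/
def IsExtNearPrismIn (G : SimpleGraph V) (a₁ a₂ a₃ b₁ b₂ b₃ : V)
    (R₁ : G.Walk a₁ b₁) (R₂ : G.Walk a₂ b₂) (R₃ : G.Walk a₃ b₃) (x y : V) : Prop :=
  G.Adj a₁ a₂ ∧ G.Adj a₁ a₃ ∧ G.Adj a₂ a₃ ∧
  G.Adj b₁ b₂ ∧ G.Adj b₁ b₃ ∧ G.Adj b₂ b₃ ∧
  (({a₁, a₂, a₃} : Set V) ∩ ({b₁, b₂, b₃} : Set V) = ({a₃} : Set V) ∩ ({b₃} : Set V)) ∧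
  R₁.IsPath ∧ R₂.IsPath ∧ R₃.IsPath ∧
  (∀ v : V, v ∈ R₁.support → v ∉ R₂.support) ∧
  (∀ v : V, v ∈ R₁.support → v ∉ R₃.support) ∧
  (∀ v : V, v ∈ R₂.support → v ∉ R₃.support) ∧
  x ∈ R₁.support ∧ x ≠ a₁ ∧ x ≠ b₁ ∧
  y ∈ R₂.support ∧ y ≠ a₂ ∧ y ≠ b₂ ∧
  G.Adj x y ∧
  (∀ p q : V, (p ∈ R₁.support ∨ p ∈ R₂.support ∨ p ∈ R₃.support) →
    (q ∈ R₁.support ∨ q ∈ R₂.support ∨ q ∈ R₃.support) → G.Adj p q →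
    s(p, q) ∈ R₁.edges ∨ s(p, q) ∈ R₂.edges ∨ s(p, q) ∈ R₃.edges ∨
    s(p, q) = s(a₁, a₂) ∨ s(p, q) = s(a₁, a₃) ∨ s(p, q) = s(a₂, a₃) ∨
    s(p, q) = s(b₁, b₂) ∨ s(p, q) = s(b₁, b₃) ∨ s(p, q) = s(b₂, b₃) ∨
    s(p, q) = s(x, y))

/-- There is an extended near-prism contained in `G` such that `a` is an end of
its cross-edge. -/
def ExtNearPrismCrossEnd (G : SimpleGraph V) (a : V) : Prop :=
  ∃ (a₁ a₂ a₃ b₁ b₂ b₃ : V) (R₁ : G.Walk a₁ b₁) (R₂ : G.Walk a₂ b₂)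
    (R₃ : G.Walk a₃ b₃) (y : V),
    IsExtNearPrismIn G a₁ a₂ a₃ b₁ b₂ b₃ R₁ R₂ R₃ a y ∨
    IsExtNearPrismIn G a₁ a₂ a₃ b₁ b₂ b₃ R₁ R₂ R₃ y a

/-- `G` contains an even wheel (as an induced subgraph). -/
def HasEvenWheel (G : SimpleGraph V) : Prop :=
  ∃ (u : V) (c : G.Walk u u) (v : V), IsHole G c ∧ v ∉ c.support ∧
    3 ≤ {x : V | x ∈ c.support ∧ G.Adj v x}.ncard ∧
    ({x : V | x ∈ c.support ∧ G.Adj v x}.ncard = 3 →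
      ∀ x y : V, x ∈ c.support → y ∈ c.support → G.Adj v x → G.Adj v y → ¬ G.Adj x y) ∧
    Even {x : V | x ∈ c.support ∧ G.Adj v x}.ncard

/-- A pyramid with apex `a`, base `{b₁,b₂,b₃}` and constituent paths
`R₁,R₂,R₃`, as an induced subgraph of `G`. -/
def IsPyramidIn (G : SimpleGraph V) (a b₁ b₂ b₃ : V)
    (R₁ : G.Walk a b₁) (R₂ : G.Walk a b₂) (R₃ : G.Walk a b₃) : Prop :=
  G.Adj b₁ b₂ ∧ G.Adj b₁ b₃ ∧ G.Adj b₂ b₃ ∧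
  a ≠ b₁ ∧ a ≠ b₂ ∧ a ≠ b₃ ∧
  R₁.IsPath ∧ R₂.IsPath ∧ R₃.IsPath ∧
  (∀ v : V, v ∈ R₁.support → v ∈ R₂.support → v = a) ∧
  (∀ v : V, v ∈ R₁.support → v ∈ R₃.support → v = a) ∧
  (∀ v : V, v ∈ R₂.support → v ∈ R₃.support → v = a) ∧
  ((2 ≤ R₁.length ∧ 2 ≤ R₂.length) ∨ (2 ≤ R₁.length ∧ 2 ≤ R₃.length) ∨
    (2 ≤ R₂.length ∧ 2 ≤ R₃.length)) ∧
  (∀ p q : V, (p ∈ R₁.support ∨ p ∈ R₂.support ∨ p ∈ R₃.support) →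
    (q ∈ R₁.support ∨ q ∈ R₂.support ∨ q ∈ R₃.support) → G.Adj p q →
    s(p, q) ∈ R₁.edges ∨ s(p, q) ∈ R₂.edges ∨ s(p, q) ∈ R₃.edges ∨
    s(p, q) = s(b₁, b₂) ∨ s(p, q) = s(b₁, b₃) ∨ s(p, q) = s(b₂, b₃))

/-- A vertex `a` is splendid: `V(G)\N[a]` is connected, every neighbour of `a`
has a neighbour in `V(G)\N[a]`, and there is no short pyramid with apex `a`. -/
def Splendid (G : SimpleGraph V) (a : V) : Prop :=
  ConnectedSubset G ((closedNbhd G a)ᶜ) ∧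
  (∀ v : V, G.Adj a v → ∃ w : V, w ∉ closedNbhd G a ∧ G.Adj v w) ∧
  ¬ ∃ (b₁ b₂ b₃ : V) (R₁ : G.Walk a b₁) (R₂ : G.Walk a b₂) (R₃ : G.Walk a b₃),
      IsPyramidIn G a b₁ b₂ b₃ R₁ R₂ R₃ ∧
      (R₁.length = 1 ∨ R₂.length = 1 ∨ R₃.length = 1)

/-- A rung of the strip `(A,B,C)`. -/
def IsRung (G : SimpleGraph V) (A B C : Set V) {x y : V} (P : G.Walk x y) : Prop :=
  P.IsPath ∧ x ∈ A ∧ y ∈ B ∧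
  (∀ v ∈ P.support, v ≠ x → v ≠ y → v ∈ C) ∧
  (x ≠ y → x ∉ B ∧ y ∉ A) ∧
  InducedWalk G P

/-- A strip `(A,B,C)`: `A,B` nonempty and disjoint from `C`, and every vertex of
`A∪B∪C` lies on a rung. -/
def IsStrip (G : SimpleGraph V) (A B C : Set V) : Prop :=
  A.Nonempty ∧ B.Nonempty ∧ Disjoint A C ∧ Disjoint B C ∧
  ∀ v ∈ A ∪ B ∪ C, ∃ (x y : V) (P : G.Walk x y), IsRung G A B C P ∧ v ∈ P.support

/-- A `J`-strip system in `G`. -/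
structure StripSystem (G : SimpleGraph V) (J : SimpleGraph W) where
  ME : W → W → Set V
  MV : W → Set V
  me_symm : ∀ u v : W, ME u v = ME v u
  me_disj : ∀ u v w x : W, J.Adj u v → J.Adj w x → s(u, v) ≠ s(w, x) →
    Disjoint (ME u v) (ME w x)
  mv_sub : ∀ u : W, MV u ⊆ ⋃ (v : W), ⋃ (_ : J.Adj u v), ME u v
  strip : ∀ u v : W, J.Adj u v →
    IsStrip G (ME u v ∩ MV u) (ME u v ∩ MV v) (ME u v \ (MV u ∪ MV v))
  far : ∀ u v w x : W, J.Adj u v → J.Adj w x → u ≠ w → u ≠ x → v ≠ w → v ≠ x →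
    ∀ p ∈ ME u v, ∀ q ∈ ME w x, ¬ G.Adj p q
  near : ∀ u v w : W, J.Adj u v → J.Adj u w → v ≠ w →
    ∀ p ∈ ME u v, ∀ q ∈ ME u w, (G.Adj p q ↔ p ∈ MV u ∧ q ∈ MV u)

/-- `V(M)`: the union of the sets `M_e` over the edges of `J`. -/
def VM {G : SimpleGraph V} {J : SimpleGraph W} (S : StripSystem G J) : Set V :=
  ⋃ (u : W), ⋃ (v : W), ⋃ (_ : J.Adj u v), S.ME u v

/-- A leaf of a graph: a vertex of degree exactly one. -/
def IsLeaf (J : SimpleGraph W) (u : W) : Prop := (J.neighborSet u).ncard = 1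

/-- `ab` is a cross-edge for the strip system `S` with partition `(α,β)` of the
leaves of `J`. -/
def IsCrossEdge {G : SimpleGraph V} {J : SimpleGraph W} (S : StripSystem G J)
    (a b : V) (α β : Set W) : Prop :=
  G.Adj a b ∧
  α ∪ β = {u : W | IsLeaf J u} ∧ Disjoint α β ∧
  (∀ u : W, (J.neighborSet u).ncard ≠ 2) ∧
  3 ≤ Nat.card W ∧
  (∀ u u₁ u₂ : W, u₁ ∈ α → u₂ ∈ α → J.Adj u u₁ → J.Adj u u₂ → u₁ = u₂) ∧
  (∀ u u₁ u₂ : W, u₁ ∈ β → u₂ ∈ β → J.Adj u u₁ → J.Adj u u₂ → u₁ = u₂) ∧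
  (∀ u v : W, J.Adj u v → a ∉ S.ME u v ∧ b ∉ S.ME u v) ∧
  (∀ x ∈ VM S, (G.Adj a x ↔ ∃ u ∈ α, x ∈ S.MV u)) ∧
  (∀ x ∈ VM S, (G.Adj b x ↔ ∃ u ∈ β, x ∈ S.MV u))

/-- A local subset of `V(M)∪{a,b}`. -/
def IsLocal {G : SimpleGraph V} {J : SimpleGraph W} (S : StripSystem G J)
    (a b : V) (α β : Set W) (X : Set V) : Prop :=
  (∃ u v : W, J.Adj u v ∧ X ⊆ S.ME u v) ∨
  (∃ u : W, X ⊆ S.MV u) ∨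
  (a ∈ X ∧ b ∉ X ∧ ∃ u ∈ α, X \ {a} ⊆ S.MV u) ∨
  (b ∈ X ∧ a ∉ X ∧ ∃ u ∈ β, X \ {b} ⊆ S.MV u)

/-- A branch-vertex of a tree: a vertex of degree different from two. -/
def BranchVertex (T : SimpleGraph U) (u : U) : Prop := (T.neighborSet u).ncard ≠ 2

/-- `u` and `v` are distinct branch-vertices joined by a branch of `T`. -/
def JoinedByBranch (T : SimpleGraph U) (u v : U) : Prop :=
  u ≠ v ∧ BranchVertex T u ∧ BranchVertex T v ∧
    ∃ p : T.Walk u v, p.IsPath ∧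
      ∀ w ∈ p.support, w ≠ u → w ≠ v → (T.neighborSet w).ncard = 2

/-- The shape of a tree `T`: the graph on its branch-vertices, two being
adjacent when joined by a branch. -/
def Shape (T : SimpleGraph U) : SimpleGraph {u : U // BranchVertex T u} :=
  SimpleGraph.fromRel (fun u v => JoinedByBranch T u.1 v.1)

/-- `y` is reachable from `x` in `T` by a walk avoiding `v`. -/
def ReachAvoiding (T : SimpleGraph U) (v x y : U) : Prop :=
  ∃ p : T.Walk x y, v ∉ p.support

/-- The component of `x` in `T` minus `v` contains no vertex of `A`. -/
def MissesSet (T : SimpleGraph U) (v : U) (A : Set U) (x : U) : Prop :=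
  ∀ z : U, ReachAvoiding T v x z → z ∉ A

/-- `G` contains an induced extended tree line-graph `H(T)` with cross-edge
`ab`, via the injection `φ` of the edges of `T` into `V(G)`, where `(A',B')`
is the bipartition of the tree `T`. -/
def ExtTreeLineGraphIn (G : SimpleGraph V) (T : SimpleGraph U)
    (A' B' : Set U) (a b : V) (φ : Sym2 U → V) : Prop :=
  T.IsTree ∧
  A' ∪ B' = Set.univ ∧ Disjoint A' B' ∧
  (∀ u v : U, T.Adj u v → (u ∈ A' ↔ v ∈ B')) ∧
  3 ≤ {u : U | IsLeaf T u}.ncard ∧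
  (∀ v x y : U, x ≠ v → y ≠ v → MissesSet T v A' x → MissesSet T v A' y →
    ReachAvoiding T v x y) ∧
  (∀ v x y : U, x ≠ v → y ≠ v → MissesSet T v B' x → MissesSet T v B' y →
    ReachAvoiding T v x y) ∧
  G.Adj a b ∧
  Set.InjOn φ T.edgeSet ∧
  (∀ e ∈ T.edgeSet, φ e ≠ a ∧ φ e ≠ b) ∧
  (∀ e ∈ T.edgeSet, ∀ f ∈ T.edgeSet, e ≠ f →
    (G.Adj (φ e) (φ f) ↔ ∃ u : U, u ∈ e ∧ u ∈ f)) ∧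
  (∀ e ∈ T.edgeSet, (G.Adj a (φ e) ↔ ∃ u : U, u ∈ e ∧ IsLeaf T u ∧ u ∈ A')) ∧
  (∀ e ∈ T.edgeSet, (G.Adj b (φ e) ↔ ∃ u : U, u ∈ e ∧ IsLeaf T u ∧ u ∈ B'))

/-- `(J, M)` is optimal for the edge `ab`: `G` contains an induced extended tree
line-graph with cross-edge `ab`; among all such, the shape `J` has as many edges
as possible; and the `J`-strip system `S` has cross-edge `ab` with partition
`(α,β)` and `V(M)` maximal. -/
def OptimalFor {G : SimpleGraph V} {J : SimpleGraph W} (S : StripSystem G J)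
    (a b : V) (α β : Set W) : Prop :=
  (∃ (n : ℕ) (T : SimpleGraph (Fin n)) (A' B' : Set (Fin n)) (φ : Sym2 (Fin n) → V),
      ExtTreeLineGraphIn G T A' B' a b φ ∧ Nonempty (J ≃g Shape T)) ∧
  (∀ (n : ℕ) (T : SimpleGraph (Fin n)) (A' B' : Set (Fin n)) (φ : Sym2 (Fin n) → V),
      ExtTreeLineGraphIn G T A' B' a b φ →
      (Shape T).edgeSet.ncard ≤ J.edgeSet.ncard) ∧
  IsCrossEdge S a b α β ∧
  (∀ (S' : StripSystem G J) (α' β' : Set W), IsCrossEdge S' a b α' β' →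
      VM S ⊆ VM S' → VM S' = VM S)

/-- There is a path from `y` to `VMset \ N[a]` containing no neighbours of `a`
except `y`. -/
def ExternalFrom (G : SimpleGraph V) (VMset : Set V) (a y : V) : Prop :=
  ∃ (z : V) (P : G.Walk y z), P.IsPath ∧ z ∈ VMset ∧ z ∉ closedNbhd G a ∧
    ∀ v ∈ P.support, G.Adj a v → v = y

/-- A major vertex: a common neighbour of `a,b` that is both `a`-external and
`b`-external. -/
def MajorVertex {G : SimpleGraph V} {J : SimpleGraph W} (S : StripSystem G J)
    (a b : V) (y : V) : Prop :=
  G.Adj a y ∧ G.Adj b y ∧ ExternalFrom G (VM S) a y ∧ ExternalFrom G (VM S) b y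

/-- The vertex set of a pyramid strip system. -/
def PSSVerts (a : V) {k : ℕ} (A B C : Fin k → Set V) : Set V :=
  insert a (⋃ i, A i ∪ B i ∪ C i)

/-- A pyramid strip system with apex `a` and proper strips `(A i, B i, C i)`. -/
def IsPyramidStripSystem (G : SimpleGraph V) (a : V) {k : ℕ}
    (A B C : Fin k → Set V) : Prop :=
  3 ≤ k ∧
  (∀ i, IsStrip G (A i) (B i) (C i)) ∧
  (∀ i, Disjoint (A i) (B i)) ∧
  (∀ i j, i ≠ j → Disjoint (A i ∪ B i ∪ C i) (A j ∪ B j ∪ C j)) ∧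
  (∀ i j, i ≠ j → ∀ p ∈ A i ∪ B i ∪ C i, ∀ q ∈ A j ∪ B j ∪ C j,
      (G.Adj p q ↔ p ∈ B i ∧ q ∈ B j)) ∧
  (∀ i, a ∉ A i ∪ B i ∪ C i) ∧
  (∀ i, ∀ p ∈ A i ∪ B i ∪ C i, (G.Adj a p ↔ p ∈ A i))

/-- `D i`: the union of the vertex sets of all components `F` of
`G \ (V(𝒮) ∪ N[a])` having a neighbour in `A i ∪ C i`. -/
def PSSD (G : SimpleGraph V) (a : V) {k : ℕ} (A B C : Fin k → Set V)
    (i : Fin k) : Set V :=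
  ⋃₀ {F : Set V | IsComponentOf G (PSSVerts a A B C ∪ closedNbhd G a) F ∧
      ∃ v ∈ A i ∪ C i, ∃ x ∈ F, G.Adj v x}

def TypeAlpha (G : SimpleGraph V) {k : ℕ} (A B C : Fin k → Set V) (v : V) : Prop :=
  ∀ i : Fin k, (∃ p ∈ B i ∪ C i, G.Adj v p) ∨ ∀ p ∈ A i, G.Adj v p

def TypeAlpha' (G : SimpleGraph V) (a : V) {k : ℕ} (A B C : Fin k → Set V)
    (v : V) : Prop :=
  ∃ i : Fin k, (∃ x ∈ PSSD G a A B C i, G.Adj v x) ∧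
    (∀ p ∈ B i ∪ C i, ¬ G.Adj v p) ∧
    ∀ j : Fin k, j ≠ i →
      (∀ p ∈ A j, G.Adj v p) ∧ ∀ p ∈ B j ∪ C j ∪ PSSD G a A B C j, ¬ G.Adj v p

def TypeBeta (G : SimpleGraph V) {k : ℕ} (A B C : Fin k → Set V) (v : V) : Prop :=
  ∃ i : Fin k, (∀ p ∈ A i ∪ B i ∪ C i, ¬ G.Adj v p) ∧
    ∀ j : Fin k, j ≠ i → ∃ p ∈ B j ∪ C j, G.Adj v p

def TypeGamma (G : SimpleGraph V) (a : V) {k : ℕ} (A B C : Fin k → Set V)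
    (v : V) : Prop :=
  ∃ (i : Fin k) (q : V) (Q : G.Walk v q), Q.IsPath ∧ InducedWalk G Q ∧
    (∀ w ∈ Q.support, w ≠ v → w ∉ PSSVerts a A B C ∪ closedNbhd G a) ∧
    (∃ p ∈ ⋃ j, B j, G.Adj q p) ∧
    ((∀ p ∈ (⋃ j, B j) \ B i, G.Adj q p) ∨ ∀ p ∈ (⋃ j, B j) \ B i, ¬ G.Adj q p) ∧
    (∀ j : Fin k, j ≠ i → ∀ p ∈ A j, G.Adj v p) ∧
    (∀ j : Fin k, ∀ p ∈ B j ∪ C j ∪ PSSD G a A B C j, ¬ G.Adj v p) ∧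
    ∀ w ∈ Q.support, w ≠ v → ∀ p ∈ PSSVerts a A B C, G.Adj w p →
      w = q ∧ p ∈ ⋃ j, B j

/-- A backdoor for `z`, relative to the strip `(A,B,C)` and the set `D`. -/
def Backdoor (G : SimpleGraph V) (A B C D : Set V) (z : V) : Prop :=
  ∃ (b' : V) (R : G.Walk z b'), R.IsPath ∧ InducedWalk G R ∧
    (∀ w ∈ R.support, w ≠ z → w ≠ b' → ∀ p ∈ (A ∪ B ∪ C) ∪ D, ¬ G.Adj w p) ∧
    (∀ p ∈ B, G.Adj b' p) ∧ ∀ p ∈ A ∪ C ∪ D, ¬ G.Adj b' p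

/-- The list `l` is the sequence of vertices of an induced path of `G`. -/
def InducedList (G : SimpleGraph V) : List V → Prop
  | [] => True
  | x :: l => x ∉ l ∧ (∀ y ∈ l, G.Adj x y ↔ l.head? = some y) ∧ InducedList G l

theorem inducedList_append {G : SimpleGraph V} (l₁ l₂ : List V) :
    InducedList G (l₁ ++ l₂) ↔ InducedList G l₁ ∧ InducedList G l₂ ∧
      ∀ x ∈ l₁, ∀ y ∈ l₂, x ≠ y ∧
        (G.Adj x y ↔ l₁.getLast? = some x ∧ l₂.head? = some y) := by
  induction l₁ with
  | nil => simp [InducedList]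
  | cons x l ih =>
    rcases l with _ | ⟨z, l⟩
    · simp only [List.cons_append, List.nil_append, InducedList]
      constructor
      · rintro ⟨h1, h2, h3⟩
        refine ⟨by simp, h3, ?_⟩
        intro x' hx' y hy
        simp only [List.mem_singleton] at hx'
        subst hx'
        exact ⟨fun h => h1 (h ▸ hy), by simpa using h2 y hy⟩
      · rintro ⟨-, h2, h3⟩
        refine ⟨fun h => (h3 x (by simp) x h).1 rfl, fun y hy => ?_, h2⟩
        simpa using (h3 x (by simp) y hy).2
    · rw [List.cons_append, InducedList, ih, InducedList]
      constructor
      · rintro ⟨h1, h2, h3, h4, h5⟩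
        refine ⟨⟨fun h => h1 (by simp at h ⊢; tauto), fun y hy => ?_, h3⟩, h4, ?_⟩
        · rw [h2 y (by simp at hy ⊢; tauto)]; simp
        · intro x' hx' y hy
          rcases List.mem_cons.1 hx' with rfl | hx''
          · refine ⟨fun h => h1 (by simp [h, hy]), ?_⟩
            rw [h2 y (by simp [hy])]
            simp only [List.cons_append, List.head?_cons, List.getLast?_cons_cons]
            constructor
            · intro h
              exact absurd (by simpa using h) (h5 z (by simp) y hy).1
            · rintro ⟨h, -⟩
              exact absurd (List.mem_append_left _ (List.mem_of_getLast? h)) h1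
          · simpa using h5 x' hx'' y hy
      · rintro ⟨⟨h1, h2, h3⟩, h4, h5⟩
        refine ⟨?_, ?_, h3, h4, ?_⟩
        · intro h
          rcases List.mem_append.1 h with h | h
          · exact h1 h
          · exact (h5 x (by simp) x h).1 rfl
        · intro y hy
          rcases List.mem_append.1 hy with h | h
          · rw [h2 y h]; simp
          · rw [(h5 x (by simp) y h).2]
            simp only [List.cons_append, List.head?_cons, List.getLast?_cons_cons]
            constructor
            · rintro ⟨h, -⟩
              exact absurd (List.mem_of_getLast? h) h1
            · intro e
              exact absurd (by simpa using e) (h5 z (by simp) y h).1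
        · intro x' hx' y hy
          simpa using h5 x' (List.mem_cons_of_mem _ hx') y hy

theorem InducedList.reverse {G : SimpleGraph V} {l : List V} (h : InducedList G l) :
    InducedList G l.reverse := by
  induction l with
  | nil => simp [InducedList]
  | cons x l ih =>
    rw [List.reverse_cons, inducedList_append]
    refine ⟨ih h.2.2, by simp [InducedList], ?_⟩
    intro y hy z hz
    simp only [List.mem_singleton] at hz
    subst hz
    rw [List.mem_reverse] at hy
    refine ⟨fun e => h.1 (e ▸ hy), ?_⟩
    rw [G.adj_comm, h.2.1 y hy]
    simp

theorem InducedList.eq_singleton {G : SimpleGraph V} {l : List V} (h : InducedList G l)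
    {f : V} (h₁ : l.head? = some f) (h₂ : l.getLast? = some f) : l = [f] := by
  rcases l with _ | ⟨x, _ | ⟨y, l⟩⟩
  · simp at h₁
  · simpa using h₁
  · simp only [List.head?_cons, Option.some.injEq] at h₁
    rw [List.getLast?_cons_cons] at h₂
    exact absurd (h₁ ▸ List.mem_of_getLast? h₂) h.1

/-- An induced walk that is a path has an induced list as support. -/
theorem inducedList_support {G : SimpleGraph V} {x y : V} (P : G.Walk x y)
    (hP : P.IsPath) (hI : InducedWalk G P) : InducedList G P.support := by
  induction P with
  | nil => simp [InducedList]
  | @cons u v w h p ih =>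
    rw [Walk.cons_isPath_iff] at hP
    rw [Walk.support_cons, InducedList]
    refine ⟨hP.2, ?_, ih hP.1 ?_⟩
    · intro z hz
      rw [List.head?_eq_some_head p.support_ne_nil, Walk.head_support]
      constructor
      · intro hadj
        have := hI u z (by simp) (by simp [hz]) hadj
        rw [Walk.edges_cons, List.mem_cons] at this
        rcases this with h' | h'
        · rw [Sym2.eq_iff] at h'
          rcases h' with ⟨-, h'⟩ | ⟨h', -⟩
          · rw [h']
          · exact absurd (h' ▸ p.start_mem_support) hP.2
        · exact absurd (p.fst_mem_support_of_mem_edges h') hP.2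
      · intro e
        simp only [Option.some.injEq] at e
        exact e ▸ h
    · intro s t hs ht hadj
      have := hI s t (by simp [hs]) (by simp [ht]) hadj
      rw [Walk.edges_cons, List.mem_cons] at this
      rcases this with h' | h'
      · rw [Sym2.eq_iff] at h'
        rcases h' with ⟨h', -⟩ | ⟨-, h'⟩
        · exact absurd (h' ▸ hs) hP.2
        · exact absurd (h' ▸ ht) hP.2
      · exact h'

/-- An induced list is the support of an induced walk. -/
theorem InducedList.exists_walk {G : SimpleGraph V} {l : List V} (h : InducedList G l)
    {x y : V} (hx : l.head? = some x) (hy : l.getLast? = some y) :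
    ∃ P : G.Walk x y, P.IsPath ∧ InducedWalk G P ∧ P.support = l := by
  induction l generalizing x with
  | nil => simp at hx
  | cons z l ih =>
    simp only [List.head?_cons, Option.some.injEq] at hx
    subst hx
    rcases l with _ | ⟨w, l⟩
    · simp only [List.getLast?_singleton, Option.some.injEq] at hy
      subst hy
      refine ⟨Walk.nil, by simp, ?_, by simp⟩
      intro u v hu hv huv
      simp only [Walk.support_nil, List.mem_singleton] at hu hv
      subst hu; subst hv
      exact absurd huv (G.loopless.irrefl _)
    · obtain ⟨P, hP, hI, hs⟩ := ih h.2.2 (x := w) (by simp) (by simpa using hy)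
      have hzw : G.Adj z w := (h.2.1 w (by simp)).2 (by simp)
      refine ⟨Walk.cons hzw P, ?_, ?_, by simp [hs]⟩
      · rw [Walk.cons_isPath_iff, hs]; exact ⟨hP, h.1⟩
      · have key : ∀ v ∈ P.support, G.Adj z v → v = w := by
          intro v hv hzv
          have := (h.2.1 v (hs ▸ hv)).1 hzv
          simpa using this.symm
        intro u v hu hv huv
        rw [Walk.support_cons, List.mem_cons] at hu hv
        rw [Walk.edges_cons, List.mem_cons]
        rcases hu with rfl | hu <;> rcases hv with rfl | hv
        · exact absurd huv (G.loopless.irrefl _)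
        · left; rw [key v hv huv]
        · left; rw [key u hu huv.symm, Sym2.eq_swap]
        · right; exact hI u v hu hv huv

/-- In an even-hole-free graph, a vertex closing an induced path to a hole gives an
odd cycle. -/
theorem EvenHoleFree.odd_cycle {G : SimpleGraph V} (hG : EvenHoleFree G) {x : V}
    {l : List V} (hl : InducedList G l) (hx : x ∉ l) (h3 : 3 ≤ l.length)
    (hadj : ∀ y ∈ l, G.Adj x y ↔ l.head? = some y ∨ l.getLast? = some y) :
    (l.length + 1) % 2 = 1 := by
  have hne : l ≠ [] := by rintro rfl; simp at h3
  obtain ⟨P, hP, hI, hs⟩ := hl.exists_walk (List.head?_eq_some_head hne)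
    (List.getLast?_eq_some_getLast hne)
  have h₁ : G.Adj x (l.head hne) :=
    (hadj _ (List.head_mem hne)).2 (Or.inl (List.head?_eq_some_head hne))
  have h₂ : G.Adj (l.getLast hne) x :=
    ((hadj _ (List.getLast_mem hne)).2 (Or.inr (List.getLast?_eq_some_getLast hne))).symm
  have hlen : P.length + 1 = l.length := by
    rw [← Walk.length_support]; exact congrArg List.length hs
  have hhl : l.head hne ≠ l.getLast hne := by
    intro e
    have := hl.eq_singleton (List.head?_eq_some_head hne)
      (e ▸ List.getLast?_eq_some_getLast hne)
    rw [this] at h3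
    simp at h3
  have hc : IsHole G (Walk.cons h₁ (P.concat h₂)) := by
    refine ⟨?_, ?_, ?_⟩
    · rw [Walk.cons_isCycle_iff]
      refine ⟨(Walk.concat_isPath_iff h₂).2 ⟨hP, by rw [hs]; exact hx⟩, ?_⟩
      rw [Walk.edges_concat]
      intro h
      simp only [List.concat_eq_append, List.mem_append, List.mem_singleton] at h
      rcases h with h | h
      · exact hx (hs ▸ P.fst_mem_support_of_mem_edges h)
      · rw [Sym2.eq_iff] at h
        rcases h with ⟨h, -⟩ | ⟨-, h⟩
        · exact hx (h ▸ List.getLast_mem hne)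
        · exact hhl h
    · simp only [Walk.length_cons, Walk.length_concat]; omega
    · have key : ∀ v ∈ l, G.Adj x v →
          s(x, v) ∈ (Walk.cons h₁ (P.concat h₂)).edges := by
        intro v hv hxv
        rw [Walk.edges_cons, Walk.edges_concat]
        simp only [List.concat_eq_append, List.mem_append, List.mem_cons]
        rcases (hadj v hv).1 hxv with h | h
        · left
          rw [List.head?_eq_some_head hne] at h
          rw [Option.some.inj h]
        · right; right; left
          rw [List.getLast?_eq_some_getLast hne] at h
          rw [Option.some.inj h, Sym2.eq_swap]
      have hsup : ∀ v, v ∈ (Walk.cons h₁ (P.concat h₂)).support → v = x ∨ v ∈ l := by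
        intro v hv
        simp only [Walk.support_cons, Walk.support_concat,
          List.mem_cons, List.mem_append, hs] at hv
        simpa using (by tauto : v = x ∨ v ∈ l)
      intro u v hu hv huv
      rcases hsup u hu with rfl | hu <;> rcases hsup v hv with rfl | hv
      · exact absurd huv (G.loopless.irrefl _)
      · exact key v hv huv
      · rw [Sym2.eq_swap]; exact key u ‹_› huv.symm
      · rw [Walk.edges_cons, Walk.edges_concat]
        simp only [List.concat_eq_append, List.mem_append, List.mem_cons]
        right; left
        exact hI u v (by rw [hs]; assumption) (by rw [hs]; assumption) huv
  have := hG _ _ hc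
  simp only [Walk.length_cons, Walk.length_concat, Nat.not_even_iff_odd] at this
  rw [Nat.odd_iff] at this
  omega

/-- Two induced paths with corresponding ends joined form an odd cycle. -/
theorem EvenHoleFree.odd_glue {G : SimpleGraph V} (hG : EvenHoleFree G)
    {l₁ l₂ : List V} (h₁ : InducedList G l₁) (h₂ : InducedList G l₂)
    (hne : l₁ ≠ []) (hlen : 2 ≤ l₂.length) (h4 : 4 ≤ l₁.length + l₂.length)
    (hadj : ∀ x ∈ l₁, ∀ y ∈ l₂, x ≠ y ∧ (G.Adj x y ↔
      (l₁.head? = some x ∧ l₂.head? = some y) ∨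
      (l₁.getLast? = some x ∧ l₂.getLast? = some y))) :
    (l₁.length + l₂.length) % 2 = 1 := by
  rcases l₁ with _ | ⟨x, l⟩
  · exact absurd rfl hne
  have hne₂ : l₂ ≠ [] := by rintro rfl; simp at hlen
  have hx₂ : x ∉ l₂ := fun h => (hadj x (by simp) x h).1 rfl
  rcases eq_or_ne l [] with rfl | hl
  · have := hG.odd_cycle h₂ hx₂ (by simp at h4; omega) (fun y hy => by
      simpa using (hadj x (by simp) y hy).2)
    simp; omega
  · have hxl : l.getLast? ≠ some x := fun h => h₁.1 (List.mem_of_getLast? h)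
    have hlast : (x :: l).getLast? = l.getLast? := by
      rcases l with _ | ⟨z, l⟩
      · exact absurd rfl hl
      · simp
    have := hG.odd_cycle (x := x) (l := l₂ ++ l.reverse) ?_ ?_ ?_ ?_
    · simp at this ⊢; omega
    · rw [inducedList_append]
      refine ⟨h₂, h₁.2.2.reverse, fun y hy z hz => ?_⟩
      rw [List.mem_reverse] at hz
      have := hadj z (List.mem_cons_of_mem _ hz) y hy
      refine ⟨this.1.symm, ?_⟩
      rw [G.adj_comm, this.2, hlast, List.head?_reverse]
      have hxz : x ≠ z := fun e => h₁.1 (e ▸ hz)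
      simp [hxz]; tauto
    · simp [hx₂, h₁.1]
    · have : 0 < l.length := List.length_pos_iff.2 hl
      simp at h4 ⊢; omega
    · intro y hy
      have e₁ : (l₂ ++ l.reverse).head? = l₂.head? := by
        rw [List.head?_append, List.head?_eq_some_head hne₂]; simp
      have e₂ : (l₂ ++ l.reverse).getLast? = l.head? := by
        rw [List.getLast?_append, List.getLast?_reverse, List.head?_eq_some_head hl]; simp
      rw [e₁, e₂]
      rcases List.mem_append.1 hy with hy | hy
      · have h := (hadj x (by simp) y hy).2
        rw [hlast] at h
        have : l.head? ≠ some y := fun e =>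
          (hadj y (List.mem_cons_of_mem _ (List.mem_of_head? e)) y hy).1 rfl
        simp [h, hxl, this]
      · rw [List.mem_reverse] at hy
        have : l₂.head? ≠ some y := fun e =>
          (hadj y (List.mem_cons_of_mem _ hy) y (List.mem_of_head? e)).1 rfl
        simp [h₁.2.1 y hy, this]

/-- An induced path whose two ends attach to the ends of the edge `ab` in the pattern
given by `c₁, c₂` (`0` standing for `a` and `1` for `b`) has prescribed parity. -/
theorem EvenHoleFree.odd_through_edge {G : SimpleGraph V} (hG : EvenHoleFree G) {a b : V}
    (hab : G.Adj a b) {l : List V} (hl : InducedList G l) (hlen : 2 ≤ l.length)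
    (ha : a ∉ l) (hb : b ∉ l) {c₁ c₂ : ℕ} (hc₁ : c₁ < 2) (hc₂ : c₂ < 2)
    (hadja : ∀ q ∈ l, G.Adj a q ↔
      (c₁ = 0 ∧ l.head? = some q) ∨ (c₂ = 0 ∧ l.getLast? = some q))
    (hadjb : ∀ q ∈ l, G.Adj b q ↔
      (c₁ = 1 ∧ l.head? = some q) ∨ (c₂ = 1 ∧ l.getLast? = some q)) :
    (l.length + 1 + c₁ + c₂) % 2 = 1 := by
  have hna : ∀ q ∈ l, a ≠ q := fun q hq e => ha (e ▸ hq)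
  have hnb : ∀ q ∈ l, b ≠ q := fun q hq e => hb (e ▸ hq)
  have hne := hab.ne
  have hne' := hab.ne'
  have single : ∀ x, (∀ q ∈ l, x ≠ q ∧ (G.Adj x q ↔ l.head? = some q ∨ l.getLast? = some q)) →
      (l.length + 1) % 2 = 1 := by
    intro x hx
    by_cases h3 : l.length = 2
    · rw [h3]
    · exact hG.odd_cycle hl (fun h => (hx x h).1 rfl) (by omega) (fun y hy => (hx y hy).2)
  have double : ∀ x y, G.Adj x y → (∀ q ∈ l, x ≠ q ∧ (G.Adj x q ↔ l.head? = some q)) →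
      (∀ q ∈ l, y ≠ q ∧ (G.Adj y q ↔ l.getLast? = some q)) → l.length % 2 = 1 := by
    intro x y hxy hx hy
    have := hG.odd_glue (l₁ := [x, y]) (l₂ := l) ?_ hl (by simp) hlen (by simp; omega) ?_
    · simp at this; omega
    · simp [InducedList, hxy, hxy.ne]
    · intro z hz q hq
      simp only [List.mem_cons, List.not_mem_nil, or_false] at hz
      rcases hz with rfl | rfl
      · simp [hx q hq, hxy.ne']
      · simp [hy q hq, hxy.ne]
  interval_cases c₁ <;> interval_cases c₂
  · exact single a (fun q hq => ⟨hna q hq, by simpa using hadja q hq⟩)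
  · have := double a b hab (fun q hq => ⟨hna q hq, by simpa using hadja q hq⟩)
      (fun q hq => ⟨hnb q hq, by simpa using hadjb q hq⟩)
    omega
  · have := double b a hab.symm (fun q hq => ⟨hnb q hq, by simpa using hadjb q hq⟩)
      (fun q hq => ⟨hna q hq, by simpa using hadja q hq⟩)
    omega
  · have := single b (fun q hq => ⟨hnb q hq, by simpa using hadjb q hq⟩)
    omega

/-- The component of `J \ v` containing `w`. -/
def Branch (J : SimpleGraph W) (v w : W) : Set W :=
  {z | ∃ p : J.Walk w z, v ∉ p.support}

section Branch

variable {J : SimpleGraph W} {u v w w' z z' : W}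

theorem self_mem_branch (h : J.Adj v w) : w ∈ Branch J v w :=
  ⟨Walk.nil, by simpa using h.ne⟩

theorem not_mem_branch : v ∉ Branch J v w := fun ⟨p, hp⟩ => hp p.end_mem_support

theorem mem_branch_of_adj (hz : z ∈ Branch J v w) (h : J.Adj z z') (hne : z' ≠ v) :
    z' ∈ Branch J v w := by
  obtain ⟨p, hp⟩ := hz
  refine ⟨p.concat h, ?_⟩
  rw [Walk.support_concat]
  simp [hp, hne.symm]

theorem eq_of_mem_branch (hJ : J.IsAcyclic) (h : J.Adj v w) (h' : J.Adj v w')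
    (hz : z ∈ Branch J v w) (hz' : z ∈ Branch J v w') : w = w' := by
  classical
  by_contra hne
  obtain ⟨p, hp⟩ := hz
  obtain ⟨q, hq⟩ := hz'
  have hr : v ∉ (p.append q.reverse).support := by
    rw [Walk.mem_support_append_iff, Walk.support_reverse, List.mem_reverse]
    tauto
  have h2 : (Walk.cons h.symm (Walk.cons h' Walk.nil)).IsPath := by
    simp [Walk.cons_isPath_iff, h.ne', h'.ne, hne]
  have := (hJ.subsingleton_path _ _).elim (p.append q.reverse).toPath ⟨_, h2⟩
  apply hr
  apply Walk.support_toPath_subset_support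
  rw [this]
  simp

theorem not_mem_branch_swap (hJ : J.IsAcyclic) (h : J.Adj u v)
    (hz : z ∈ Branch J u v) : z ∉ Branch J v u := by
  classical
  rintro ⟨q, hq⟩
  obtain ⟨p, hp⟩ := hz
  have h2 : (Walk.cons h.symm q.toPath.1).IsPath :=
    (Walk.cons_isPath_iff _ _).2
      ⟨q.toPath.2, fun hv => hq (Walk.support_toPath_subset_support _ hv)⟩
  have := (hJ.subsingleton_path _ _).elim p.toPath ⟨_, h2⟩
  apply hp
  apply Walk.support_toPath_subset_support
  rw [this]
  simp

theorem branch_subset (hJ : J.IsAcyclic) (h : J.Adj v w) (h' : J.Adj w w') (hne : w' ≠ v) :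
    Branch J w w' ⊆ Branch J v w := by
  classical
  rintro z ⟨p, hp⟩
  have hv : v ∉ p.support := fun hv => hne <| eq_of_mem_branch hJ h' h.symm
    ⟨p.takeUntil v hv, fun hw => hp (p.support_takeUntil_subset_support hv hw)⟩
    (self_mem_branch h.symm)
  exact ⟨Walk.cons h' p, by simp [h.ne, hv]⟩

theorem branch_ncard_lt [Finite W] (hJ : J.IsAcyclic) (h : J.Adj v w) (h' : J.Adj w w')
    (hne : w' ≠ v) : (Branch J w w').ncard < (Branch J v w).ncard :=
  Set.ncard_lt_ncard ((branch_subset hJ h h' hne).ssubset_of_mem_notMem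
    (self_mem_branch h) not_mem_branch) (Set.toFinite _)

theorem exists_mem_branch (hJ : J.Connected) (hne : z ≠ v) :
    ∃ w, J.Adj v w ∧ z ∈ Branch J v w := by
  classical
  obtain ⟨p, hp⟩ := (hJ v z).exists_isPath
  cases p with
  | nil => exact absurd rfl hne
  | cons h p => exact ⟨_, h, p, ((Walk.cons_isPath_iff _ _).1 hp).2⟩

end Branch

section Side

variable {G : SimpleGraph V} {J : SimpleGraph W} {S : StripSystem G J}
  {u v w w' x x' y y' : W} {p q : V}

/-- The part of a strip system lying in the direction of `w` as seen from `v`. -/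
def Side (S : StripSystem G J) (v w : W) : Set V :=
  {p | ∃ x y, J.Adj x y ∧ x ∈ Branch J v w ∧ p ∈ S.ME x y}

theorem mem_VM : p ∈ VM S ↔ ∃ x y, J.Adj x y ∧ p ∈ S.ME x y := by
  simp [VM]

theorem edge_eq_of_mem_ME (h : J.Adj x y) (h' : J.Adj x' y') (hp : p ∈ S.ME x y)
    (hp' : p ∈ S.ME x' y') : s(x, y) = s(x', y') := by
  by_contra hne
  exact Set.disjoint_left.1 (S.me_disj _ _ _ _ h h' hne) hp hp'

theorem exists_mem_ME_of_mem_MV (hp : p ∈ S.MV u) : ∃ v, J.Adj u v ∧ p ∈ S.ME u v := by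
  simpa using S.mv_sub u hp

theorem mem_VM_of_mem_MV (hp : p ∈ S.MV u) : p ∈ VM S := by
  obtain ⟨v, h, hp⟩ := exists_mem_ME_of_mem_MV hp
  exact mem_VM.2 ⟨_, _, h, hp⟩

theorem eq_or_eq_of_mem_MV (h : J.Adj x y) (hp : p ∈ S.ME x y) (hu : p ∈ S.MV u) :
    u = x ∨ u = y := by
  obtain ⟨v, h', hp'⟩ := exists_mem_ME_of_mem_MV hu
  have := edge_eq_of_mem_ME h h' hp hp'
  rw [Sym2.eq_iff] at this
  grind

theorem ME_subset_side (h : J.Adj v w) : S.ME v w ⊆ Side S v w :=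
  fun _ hp => ⟨w, v, h.symm, self_mem_branch h, S.me_symm v w ▸ hp⟩

theorem side_subset_VM : Side S v w ⊆ VM S :=
  fun _ ⟨x, y, h, _, hp⟩ => mem_VM.2 ⟨x, y, h, hp⟩

theorem eq_or_mem_branch_of_mem_side (hp : p ∈ Side S v w) (h : J.Adj x y)
    (hxy : p ∈ S.ME x y) : x = v ∨ x ∈ Branch J v w := by
  obtain ⟨x', y', h', hx', hp'⟩ := hp
  have := edge_eq_of_mem_ME h h' hxy hp'
  rw [Sym2.eq_iff] at this
  rcases this with ⟨rfl, rfl⟩ | ⟨rfl, rfl⟩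
  · exact Or.inr hx'
  · by_cases hv : x = v
    · exact Or.inl hv
    · exact Or.inr (mem_branch_of_adj hx' h' hv)

theorem eq_or_mem_branch_of_mem_MV (hp : p ∈ Side S v w) (hu : p ∈ S.MV u) :
    u = v ∨ u ∈ Branch J v w := by
  obtain ⟨x, h, hx⟩ := exists_mem_ME_of_mem_MV hu
  exact eq_or_mem_branch_of_mem_side hp h hx

theorem mem_ME_of_mem_side (hJ : J.IsAcyclic) (h : J.Adj v w) (hp : p ∈ Side S v w)
    (h' : J.Adj v x) (hx : p ∈ S.ME v x) : p ∈ S.ME v w := by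
  have := eq_or_mem_branch_of_mem_side hp h'.symm (S.me_symm v x ▸ hx)
  rcases this with e | hb
  · exact absurd e h'.ne'
  · rwa [eq_of_mem_branch hJ h h' hb (self_mem_branch h')]

theorem mem_ME_of_mem_side_of_mem_MV (hJ : J.IsAcyclic) (h : J.Adj v w)
    (hp : p ∈ Side S v w) (hv : p ∈ S.MV v) : p ∈ S.ME v w := by
  obtain ⟨x, h', hx⟩ := exists_mem_ME_of_mem_MV hv
  exact mem_ME_of_mem_side hJ h hp h' hx

theorem not_mem_side (hJ : J.IsAcyclic) (h : J.Adj v w) (h' : J.Adj v w') (hne : w ≠ w')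
    (hp : p ∈ Side S v w) : p ∉ Side S v w' := by
  intro hp'
  obtain ⟨x, y, hxy, hx, hpx⟩ := hp
  rcases eq_or_mem_branch_of_mem_side hp' hxy hpx with e | hb
  · exact not_mem_branch (e ▸ hx)
  · exact hne (eq_of_mem_branch hJ h h' hx hb)

/-- Vertices on different sides of `v` are adjacent only if both belong to `M_v`. -/
theorem side_cross (hJ : J.IsAcyclic) (h : J.Adj v w) (h' : J.Adj v w') (hne : w ≠ w')
    (hp : p ∈ Side S v w) (hq : q ∈ Side S v w') :
    p ≠ q ∧ (G.Adj p q ↔ p ∈ S.MV v ∧ q ∈ S.MV v) := by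
  refine ⟨fun e => not_mem_side hJ h h' hne hp (e ▸ hq), ?_, ?_⟩
  · intro hadj
    obtain ⟨x, y, hxy, hx, hpx⟩ := id hp
    obtain ⟨x', y', hxy', hx', hqx⟩ := id hq
    have hxv : x ≠ v := fun e => not_mem_branch (e ▸ hx)
    have hxv' : x' ≠ v := fun e => not_mem_branch (e ▸ hx')
    have hdis : ∀ z, z ∈ Branch J v w → z ∉ Branch J v w' :=
      fun z hz hz' => hne (eq_of_mem_branch hJ h h' hz hz')
    have hxx' : x ≠ x' := fun e => hdis x hx (e ▸ hx')
    have hy : y = v ∨ y ∈ Branch J v w := by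
      by_cases e : y = v
      · exact Or.inl e
      · exact Or.inr (mem_branch_of_adj hx hxy e)
    have hy' : y' = v ∨ y' ∈ Branch J v w' := by
      by_cases e : y' = v
      · exact Or.inl e
      · exact Or.inr (mem_branch_of_adj hx' hxy' e)
    have hxy'' : x ≠ y' := by
      rintro rfl
      rcases hy' with e | e
      · exact hxv e
      · exact hdis _ hx e
    have hyx'' : y ≠ x' := by
      rintro rfl
      rcases hy with e | e
      · exact hxv' e
      · exact hdis _ e hx'
    by_cases hyy : y = y'
    · have hyv : y = v := by
        rcases hy with e | e
        · exact e
        · rcases hy' with e' | e'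
          · rw [hyy, e']
          · exact absurd (hyy ▸ e') (hdis _ e)
      subst hyv
      subst hyy
      exact (S.near y x x' hxy.symm hxy'.symm hxx' p (S.me_symm _ _ ▸ hpx) q
        (S.me_symm _ _ ▸ hqx)).1 hadj
    · exact absurd hadj (S.far _ _ _ _ hxy hxy' hxx' hxy'' hyx'' hyy p hpx q hqx)
  · rintro ⟨h1, h2⟩
    exact (S.near v w w' h h' hne p (mem_ME_of_mem_side_of_mem_MV hJ h hp h1) q
      (mem_ME_of_mem_side_of_mem_MV hJ h' hq h2)).2 ⟨h1, h2⟩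

theorem side_subset_side (hJ : J.IsAcyclic) (h : J.Adj v w) (h' : J.Adj w w')
    (hne : w' ≠ v) : Side S w w' ⊆ Side S v w :=
  fun _ ⟨x, y, hxy, hx, hp⟩ => ⟨x, y, hxy, branch_subset hJ h h' hne hx, hp⟩

theorem exists_mem_side (hJ : J.Connected) (hp : p ∈ VM S) (v : W) :
    ∃ w, J.Adj v w ∧ p ∈ Side S v w := by
  obtain ⟨x, y, hxy, hpx⟩ := mem_VM.1 hp
  by_cases hx : x = v
  · subst hx
    exact ⟨y, hxy, ME_subset_side hxy hpx⟩
  · obtain ⟨w, hw, hb⟩ := exists_mem_branch hJ hx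
    exact ⟨w, hw, x, y, hxy, hb, hpx⟩

theorem mem_ME_of_mem_side_swap (hJ : J.IsAcyclic) (h : J.Adj u v) (hp : p ∈ Side S u v)
    (hp' : p ∈ Side S v u) : p ∈ S.ME u v := by
  obtain ⟨x, y, hxy, hx, hpx⟩ := hp
  rcases eq_or_mem_branch_of_mem_side hp' hxy hpx with e | hb
  · subst e
    have : y = u := by
      by_contra hy
      have hb := mem_branch_of_adj hx hxy hy
      rcases eq_or_mem_branch_of_mem_side hp' hxy.symm (S.me_symm _ _ ▸ hpx) with e | hb'
      · exact hxy.ne' e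
      · exact not_mem_branch_swap hJ h hb hb'
    subst this
    exact S.me_symm _ _ ▸ hpx
  · exact absurd hb (not_mem_branch_swap hJ h hx)

theorem mem_side_cases (hJ : J.IsTree) (h : J.Adj v w) (hp : p ∈ Side S v w) :
    p ∈ S.ME v w ∨ ∃ w', J.Adj w w' ∧ w' ≠ v ∧ p ∈ Side S w w' := by
  obtain ⟨w', hw', hp'⟩ := exists_mem_side hJ.connected (side_subset_VM hp) w
  by_cases e : w' = v
  · subst e
    exact Or.inl (mem_ME_of_mem_side_swap hJ.isAcyclic h hp hp')
  · exact Or.inr ⟨w', hw', e, hp'⟩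

/-- Two vertices belong to a common strip or to a common set `M_u`. -/
def LocalPair (S : StripSystem G J) (p q : V) : Prop :=
  (∃ u v, J.Adj u v ∧ p ∈ S.ME u v ∧ q ∈ S.ME u v) ∨ ∃ u, p ∈ S.MV u ∧ q ∈ S.MV u

theorem LocalPair.symm (h : LocalPair S p q) : LocalPair S q p := by
  rcases h with ⟨u, v, h, hp, hq⟩ | ⟨u, hp, hq⟩
  · exact Or.inl ⟨u, v, h, hq, hp⟩
  · exact Or.inr ⟨u, hq, hp⟩

theorem not_localPair_of_side (hJ : J.IsAcyclic) (h : J.Adj v w) (h' : J.Adj v w')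
    (hne : w ≠ w') (hp : p ∈ Side S v w) (hq : q ∈ Side S v w')
    (hv : p ∈ S.MV v → q ∉ S.MV v) : ¬ LocalPair S p q := by
  have hdis : ∀ z, z ∈ Branch J v w → z ∉ Branch J v w' :=
    fun z hz hz' => hne (eq_of_mem_branch hJ h h' hz hz')
  have key : ∀ z, (z = v ∨ z ∈ Branch J v w) → (z = v ∨ z ∈ Branch J v w') → z = v := by
    rintro z (e | h1) (e' | h2)
    · exact e
    · exact e
    · exact e'
    · exact absurd h2 (hdis z h1)
  rintro (⟨x, y, hxy, hp', hq'⟩ | ⟨u, hp', hq'⟩)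
  · have h1 := key x (eq_or_mem_branch_of_mem_side hp hxy hp')
      (eq_or_mem_branch_of_mem_side hq hxy hq')
    have h2 := key y (eq_or_mem_branch_of_mem_side hp hxy.symm (S.me_symm _ _ ▸ hp'))
      (eq_or_mem_branch_of_mem_side hq hxy.symm (S.me_symm _ _ ▸ hq'))
    exact hxy.ne (h1.trans h2.symm)
  · have := key u (eq_or_mem_branch_of_mem_MV hp hp') (eq_or_mem_branch_of_mem_MV hq hq')
    subst this
    exact hv hp' hq'

/-- A set of vertices all of whose pairs are local is local. -/
theorem exists_not_localPair (hJ : J.IsTree) {X : Set V} (hX : X ⊆ VM S)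
    (hne : ∀ u v, J.Adj u v → ¬ X ⊆ S.ME u v) (hnv : ∀ u, ¬ X ⊆ S.MV u) :
    ∃ p ∈ X, ∃ q ∈ X, ¬ LocalPair S p q := by
  by_contra! hall
  have hXne : X.Nonempty := by
    by_contra! h
    obtain ⟨u⟩ := hJ.connected.nonempty
    exact hnv u (h ▸ Set.empty_subset _)
  obtain ⟨p, hp⟩ := hXne
  obtain ⟨u, v, huv, hpu⟩ := mem_VM.1 (hX hp)
  obtain ⟨q, hq, hqn⟩ := Set.not_subset.1 (hne u v huv)
  obtain ⟨c, hpc, hqc⟩ : ∃ c, p ∈ S.MV c ∧ q ∈ S.MV c := by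
    rcases hall p hp q hq with ⟨x, y, hxy, h1, h2⟩ | h
    · have := edge_eq_of_mem_ME huv hxy hpu h1
      rw [Sym2.eq_iff] at this
      rcases this with ⟨rfl, rfl⟩ | ⟨rfl, rfl⟩
      · exact absurd h2 hqn
      · exact absurd (S.me_symm _ _ ▸ h2) hqn
    · exact h
  obtain ⟨w, hw, hpw⟩ := exists_mem_ME_of_mem_MV hpc
  obtain ⟨w', hw', hqw⟩ := exists_mem_ME_of_mem_MV hqc
  have hww : w ≠ w' := by
    rintro rfl
    have := edge_eq_of_mem_ME huv hw hpu hpw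
    rw [Sym2.eq_iff] at this
    rcases this with ⟨rfl, rfl⟩ | ⟨rfl, rfl⟩
    · exact hqn hqw
    · exact hqn (S.me_symm _ _ ▸ hqw)
  apply hnv c
  intro r hr
  obtain ⟨t, ht, hrt⟩ := exists_mem_side hJ.connected (hX hr) c
  by_contra hrc
  by_cases htw : t = w
  · subst htw
    exact not_localPair_of_side hJ.isAcyclic ht hw' hww hrt (ME_subset_side hw' hqw)
      (fun h => absurd h hrc) (hall r hr q hq)
  · exact not_localPair_of_side hJ.isAcyclic ht hw htw hrt (ME_subset_side hw hpw)
      (fun h => absurd h hrc) (hall r hr p hp)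

end Side


section Exit

variable {G : SimpleGraph V} {J : SimpleGraph W} {S : StripSystem G J} {a b : V}
  {α β : Set W} {u v w w' : W} {p q : V}

theorem IsCrossEdge.adj_left_iff (hC : IsCrossEdge S a b α β) (h : J.Adj v w)
    (hp : p ∈ S.ME v w) :
    G.Adj a p ↔ (v ∈ α ∧ p ∈ S.MV v) ∨ (w ∈ α ∧ p ∈ S.MV w) := by
  obtain ⟨-, -, -, -, -, -, -, -, ha, -⟩ := hC
  rw [ha p (mem_VM.2 ⟨v, w, h, hp⟩)]
  constructor
  · rintro ⟨u, hu, hpu⟩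
    rcases eq_or_eq_of_mem_MV h hp hpu with rfl | rfl
    · exact Or.inl ⟨hu, hpu⟩
    · exact Or.inr ⟨hu, hpu⟩
  · rintro (⟨hu, hpu⟩ | ⟨hu, hpu⟩)
    · exact ⟨_, hu, hpu⟩
    · exact ⟨_, hu, hpu⟩

theorem IsCrossEdge.swap (hC : IsCrossEdge S a b α β) : IsCrossEdge S b a β α := by
  obtain ⟨h1, h2, h3, h4, h5, h6, h7, h8, h9, h10⟩ := hC
  exact ⟨h1.symm, by rw [Set.union_comm, h2], h3.symm, h4, h5, h7, h6,
    fun u v h => (h8 u v h).symm, h10, h9⟩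

theorem IsCrossEdge.leaf_iff (hC : IsCrossEdge S a b α β) : IsLeaf J u ↔ u ∈ α ∨ u ∈ β := by
  have := Set.ext_iff.1 hC.2.1 u
  simpa using this.symm

theorem IsCrossEdge.not_mem_VM (hC : IsCrossEdge S a b α β) : a ∉ VM S ∧ b ∉ VM S := by
  simp only [mem_VM]
  constructor
  · rintro ⟨x, y, h, hp⟩
    exact (hC.2.2.2.2.2.2.2.1 x y h).1 hp
  · rintro ⟨x, y, h, hp⟩
    exact (hC.2.2.2.2.2.2.2.1 x y h).2 hp

/-- A rung of a strip, as a list of vertices. -/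
structure IsRungList (S : StripSystem G J) (v w : W) (R : List V) : Prop where
  induced : InducedList G R
  ne : R ≠ []
  mem : ∀ q ∈ R, q ∈ S.ME v w
  head : ∀ q ∈ R, q ∈ S.MV v ↔ R.head? = some q
  last : ∀ q ∈ R, q ∈ S.MV w ↔ R.getLast? = some q

theorem exists_rungList (h : J.Adj v w) (hp : p ∈ S.ME v w) :
    ∃ R, IsRungList S v w R ∧ p ∈ R := by
  classical
  obtain ⟨-, -, -, -, hs⟩ := S.strip v w h
  obtain ⟨x, y, P, ⟨hP, hx, hy, hin, hxy, hI⟩, hpP⟩ := hs p (by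
    by_cases h1 : p ∈ S.MV v
    · exact Or.inl (Or.inl ⟨hp, h1⟩)
    · by_cases h2 : p ∈ S.MV w
      · exact Or.inl (Or.inr ⟨hp, h2⟩)
      · exact Or.inr ⟨hp, by simp [h1, h2]⟩)
  have hhead : P.support.head? = some x := by
    rw [List.head?_eq_some_head (by simp)]; simp
  have hlast : P.support.getLast? = some y := by
    rw [List.getLast?_eq_some_getLast (by simp)]; simp
  refine ⟨P.support, ⟨inducedList_support P hP hI, by simp, ?_, ?_, ?_⟩, hpP⟩
  · intro q hq
    by_cases h1 : q = x
    · exact h1 ▸ hx.1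
    · by_cases h2 : q = y
      · exact h2 ▸ hy.1
      · exact (hin q hq h1 h2).1
  · intro q hq
    rw [hhead, Option.some.injEq]
    refine ⟨fun hv => ?_, fun e => e ▸ hx.2⟩
    by_contra h1
    by_cases h2 : q = y
    · subst h2
      exact (hxy h1).2 ⟨hy.1, hv⟩
    · exact (hin q hq (Ne.symm h1) h2).2 (Or.inl hv)
  · intro q hq
    rw [hlast, Option.some.injEq]
    refine ⟨fun hv => ?_, fun e => e ▸ hy.2⟩
    by_contra h1
    by_cases h2 : q = x
    · subst h2
      exact (hxy (Ne.symm h1)).1 ⟨hx.1, hv⟩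
    · exact (hin q hq h2 (Ne.symm h1)).2 (Or.inr hv)

/-- An induced path from `M_v` through the side of `w`, whose last vertex only is adjacent
to `a` (if `c = 0`) or to `b` (if `c = 1`). -/
structure IsExit (S : StripSystem G J) (a b : V) (v w : W) (Q : List V) (c : ℕ) : Prop where
  lt : c < 2
  induced : InducedList G Q
  ne : Q ≠ []
  side : ∀ q ∈ Q, q ∈ Side S v w
  head : ∀ q ∈ Q, q ∈ S.MV v ↔ Q.head? = some q
  adj_left : ∀ q ∈ Q, G.Adj a q ↔ c = 0 ∧ Q.getLast? = some q
  adj_right : ∀ q ∈ Q, G.Adj b q ↔ c = 1 ∧ Q.getLast? = some q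

theorem not_isLeaf_of_ne (h : J.Adj v w) (h' : J.Adj v w') (hne : w ≠ w') : ¬ IsLeaf J v := by
  intro hl
  obtain ⟨x, hx⟩ := Set.ncard_eq_one.1 hl
  have h1 : w ∈ J.neighborSet v := h
  have h2 : w' ∈ J.neighborSet v := h'
  rw [hx] at h1 h2
  exact hne (h1.trans h2.symm)

theorem exists_adj_ne [Finite W] (hv : ¬ IsLeaf J v) (h : J.Adj v w) :
    ∃ w', J.Adj v w' ∧ w' ≠ w := by
  by_contra! hall
  apply hv
  rw [IsLeaf, Set.ncard_eq_one]
  exact ⟨w, Set.ext fun x => ⟨fun hx => hall x hx, fun hx => by rw [hx]; exact h⟩⟩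

theorem exists_adj_ne_ne [Finite W] (hv : (J.neighborSet v).ncard ≠ 2) (h : J.Adj v w)
    (h' : J.Adj v w') (hne : w ≠ w') : ∃ x, J.Adj v x ∧ x ≠ w ∧ x ≠ w' := by
  by_contra! hall
  apply hv
  rw [Set.ncard_eq_two]
  refine ⟨w, w', hne, Set.ext fun x => ⟨fun hx => ?_, ?_⟩⟩
  · by_cases e : x = w
    · exact Or.inl e
    · exact Or.inr (hall x hx e)
  · rintro (rfl | rfl)
    · exact h
    · exact h'

theorem exists_mem_ME_inter (h : J.Adj v w) : ∃ p, p ∈ S.ME v w ∧ p ∈ S.MV v :=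
  (S.strip v w h).1

theorem exists_mem_side_inter (h : J.Adj v w) : ∃ p, p ∈ Side S v w ∧ p ∈ S.MV v := by
  obtain ⟨p, hp, hv⟩ := exists_mem_ME_inter (S := S) h
  exact ⟨p, ME_subset_side h hp, hv⟩

theorem exists_exit_of_leaf (hC : IsCrossEdge S a b α β) (h : J.Adj v w) (hv : ¬ IsLeaf J v)
    (hw : w ∈ α) (hp : p ∈ S.ME v w) : ∃ Q, IsExit S a b v w Q 0 ∧ p ∈ Q := by
  obtain ⟨R, hR, hpR⟩ := exists_rungList h hp
  have hvα : v ∉ α := fun h => hv (hC.leaf_iff.2 (Or.inl h))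
  have hvβ : v ∉ β := fun h => hv (hC.leaf_iff.2 (Or.inr h))
  have hwβ : w ∉ β := Set.disjoint_left.1 hC.2.2.1 hw
  refine ⟨R, ⟨by norm_num, hR.induced, hR.ne, fun q hq => ME_subset_side h (hR.mem q hq),
    hR.head, ?_, ?_⟩, hpR⟩
  · intro q hq
    rw [hC.adj_left_iff h (hR.mem q hq), hR.last q hq]
    simp [hvα, hw]
  · intro q hq
    rw [hC.swap.adj_left_iff h (hR.mem q hq)]
    simp [hvβ, hwβ]

theorem IsExit.swap {Q : List V} (h : IsExit S a b v w Q 0) : IsExit S b a v w Q 1 :=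
  ⟨by norm_num, h.induced, h.ne, h.side, h.head,
    fun q hq => by simpa using h.adj_right q hq, fun q hq => by simpa using h.adj_left q hq⟩

theorem IsRungList.append_exit (hJ : J.IsAcyclic) (hC : IsCrossEdge S a b α β) (h : J.Adj v w)
    (hv : ¬ IsLeaf J v) (hw' : J.Adj w w') (hne : w' ≠ v) {R Q : List V} {c : ℕ}
    (hR : IsRungList S v w R) (hQ : IsExit S a b w w' Q c) : IsExit S a b v w (R ++ Q) c := by
  have hw : ¬ IsLeaf J w := not_isLeaf_of_ne h.symm hw' hne.symm
  have hRs : ∀ q ∈ R, q ∈ Side S w v := fun q hq =>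
    ME_subset_side h.symm (S.me_symm v w ▸ hR.mem q hq)
  have hQv : ∀ q ∈ Q, q ∉ S.MV v := by
    intro q hq hqv
    rcases eq_or_mem_branch_of_mem_MV (hQ.side q hq) hqv with e | hb
    · exact h.ne e
    · exact hne (eq_of_mem_branch hJ hw' h.symm hb (self_mem_branch h.symm))
  have hvα : v ∉ α := fun h => hv (hC.leaf_iff.2 (Or.inl h))
  have hvβ : v ∉ β := fun h => hv (hC.leaf_iff.2 (Or.inr h))
  have hwα : w ∉ α := fun h => hw (hC.leaf_iff.2 (Or.inl h))
  have hwβ : w ∉ β := fun h => hw (hC.leaf_iff.2 (Or.inr h))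
  have hdis : ∀ x ∈ R, ∀ y ∈ Q, x ≠ y ∧
      (G.Adj x y ↔ R.getLast? = some x ∧ Q.head? = some y) := by
    intro x hx y hy
    rw [← hR.last x hx, ← hQ.head y hy]
    exact side_cross hJ h.symm hw' hne.symm (hRs x hx) (hQ.side y hy)
  have hlast : (R ++ Q).getLast? = Q.getLast? := by
    rw [List.getLast?_append_of_ne_nil _ hQ.ne]
  have hhead : (R ++ Q).head? = R.head? := by
    rw [List.head?_append_of_ne_nil _ hR.ne]
  have hRl : ∀ x ∈ R, Q.getLast? ≠ some x := fun x hx e =>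
    (hdis x hx x (List.mem_of_getLast? e)).1 rfl
  refine ⟨hQ.lt, (inducedList_append _ _).2 ⟨hR.induced, hQ.induced, hdis⟩,
    by simp [hR.ne], ?_, ?_, ?_, ?_⟩
  · intro q hq
    rcases List.mem_append.1 hq with hq | hq
    · exact ME_subset_side h (hR.mem q hq)
    · exact side_subset_side hJ h hw' hne (hQ.side q hq)
  · intro q hq
    rw [hhead]
    rcases List.mem_append.1 hq with hq | hq
    · exact hR.head q hq
    · simp only [hQv q hq, false_iff]
      exact fun e => (hdis q (List.mem_of_head? e) q hq).1 rfl
  · intro q hq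
    rw [hlast]
    rcases List.mem_append.1 hq with hq | hq
    · rw [hC.adj_left_iff h (hR.mem q hq)]
      simp [hvα, hwα, hRl q hq]
    · exact hQ.adj_left q hq
  · intro q hq
    rw [hlast]
    rcases List.mem_append.1 hq with hq | hq
    · rw [hC.swap.adj_left_iff h (hR.mem q hq)]
      simp [hvβ, hwβ, hRl q hq]
    · exact hQ.adj_right q hq

theorem exists_exit [Finite W] (hJ : J.IsTree) (hC : IsCrossEdge S a b α β) (h : J.Adj v w)
    (hv : ¬ IsLeaf J v) (hp : p ∈ Side S v w) : ∃ Q c, IsExit S a b v w Q c ∧ p ∈ Q := by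
  induction hn : (Branch J v w).ncard using Nat.strong_induction_on generalizing v w p with
  | _ n ih =>
  by_cases hw : IsLeaf J w
  · have hpM : p ∈ S.ME v w := by
      rcases mem_side_cases hJ h hp with h1 | ⟨w', hw', hne, -⟩
      · exact h1
      · exact absurd hw (not_isLeaf_of_ne h.symm hw' hne.symm)
    rcases hC.leaf_iff.1 hw with h1 | h1
    · obtain ⟨Q, hQ, hpQ⟩ := exists_exit_of_leaf hC h hv h1 hpM
      exact ⟨Q, 0, hQ, hpQ⟩
    · obtain ⟨Q, hQ, hpQ⟩ := exists_exit_of_leaf hC.swap h hv h1 hpM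
      exact ⟨Q, 1, hQ.swap, hpQ⟩
  · rcases mem_side_cases hJ h hp with h1 | ⟨w', hw', hne, h1⟩
    · obtain ⟨w', hw', hne⟩ := exists_adj_ne hw h.symm
      obtain ⟨R, hR, hpR⟩ := exists_rungList h h1
      obtain ⟨z, hz, -⟩ := exists_mem_side_inter (S := S) hw'
      obtain ⟨Q, c, hQ, -⟩ := ih _ (hn ▸ branch_ncard_lt hJ.isAcyclic h hw' hne) hw' hw hz rfl
      exact ⟨R ++ Q, c, hR.append_exit hJ.isAcyclic hC h hv hw' hne hQ, by simp [hpR]⟩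
    · obtain ⟨z, hz, -⟩ := exists_mem_ME_inter (S := S) h
      obtain ⟨R, hR, -⟩ := exists_rungList h hz
      obtain ⟨Q, c, hQ, hpQ⟩ :=
        ih _ (hn ▸ branch_ncard_lt hJ.isAcyclic h hw' hne) hw' hw h1 rfl
      exact ⟨R ++ Q, c, hR.append_exit hJ.isAcyclic hC h hv hw' hne hQ, by simp [hpQ]⟩

theorem IsCrossEdge.exists_adj_right [Finite W] (hC : IsCrossEdge S a b α β)
    (hv : ¬ IsLeaf J v) (h : J.Adj v w) : ∃ w', J.Adj v w' ∧ w' ≠ w ∧ w' ∉ α := by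
  obtain ⟨w₁, h₁, hne₁⟩ := exists_adj_ne hv h
  by_cases hα : w₁ ∈ α
  · obtain ⟨w₂, h₂, hne₂, hne⟩ := exists_adj_ne_ne (hC.2.2.2.1 v) h h₁ hne₁.symm
    exact ⟨w₂, h₂, hne₂, fun h => hne (hC.2.2.2.2.2.1 v w₂ w₁ h hα h₂ h₁)⟩
  · exact ⟨w₁, h₁, hne₁, hα⟩

/-- Unless `w ∈ α`, there is an exit through any given vertex of `M_{vw}` ending at a
neighbour of `b`. -/
theorem exists_exit_right [Finite W] (hJ : J.IsAcyclic) (hC : IsCrossEdge S a b α β)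
    (h : J.Adj v w) (hv : ¬ IsLeaf J v) (hw : w ∉ α) (hp : p ∈ S.ME v w) :
    ∃ Q, IsExit S a b v w Q 1 ∧ p ∈ Q := by
  induction hn : (Branch J v w).ncard using Nat.strong_induction_on generalizing v w p with
  | _ n ih =>
  by_cases hl : IsLeaf J w
  · obtain ⟨Q, hQ, hpQ⟩ :=
      exists_exit_of_leaf hC.swap h hv ((hC.leaf_iff.1 hl).resolve_left hw) hp
    exact ⟨Q, hQ.swap, hpQ⟩
  · obtain ⟨w', hw', hne, hα⟩ := hC.exists_adj_right hl h.symm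
    obtain ⟨R, hR, hpR⟩ := exists_rungList h hp
    obtain ⟨z, hz, -⟩ := exists_mem_ME_inter (S := S) hw'
    obtain ⟨Q, hQ, -⟩ := ih _ (hn ▸ branch_ncard_lt hJ h hw' hne) hw' hl hα hz rfl
    exact ⟨R ++ Q, hR.append_exit hJ hC h hv hw' hne hQ, by simp [hpR]⟩

/-- The directed edge `tt'` of `J` is reached from `vw` by walking forward. -/
inductive Beyond (J : SimpleGraph W) : W → W → W → W → Prop
  | refl {v w : W} (h : J.Adj v w) : Beyond J v w v w
  | step {v w w' t t' : W} (h : J.Adj v w) (h' : J.Adj w w') (hne : w' ≠ v)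
      (hb : Beyond J w w' t t') : Beyond J v w t t'

variable {t t' : W}

theorem Beyond.adj (h : Beyond J v w t t') : J.Adj v w ∧ J.Adj t t' := by
  induction h with
  | refl h => exact ⟨h, h⟩
  | step h _ _ _ ih => exact ⟨h, ih.2⟩

theorem Beyond.side_subset (hJ : J.IsAcyclic) (h : Beyond J v w t t') :
    Side S t t' ⊆ Side S v w := by
  induction h with
  | refl h => exact subset_rfl
  | step h h' hne _ ih => exact ih.trans (side_subset_side hJ h h' hne)

theorem not_mem_MV_of_mem_side (hJ : J.IsAcyclic) (h : J.Adj v w) (h' : J.Adj w w')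
    (hne : w' ≠ v) (hp : p ∈ Side S w w') : p ∉ S.MV v := by
  intro hpv
  rcases eq_or_mem_branch_of_mem_MV hp hpv with e | hb
  · exact h.ne e
  · exact hne (eq_of_mem_branch hJ h' h.symm hb (self_mem_branch h.symm))

theorem Beyond.eq_or (hJ : J.IsAcyclic) (S : StripSystem G J) (h : Beyond J v w t t') :
    (t = v ∧ t' = w) ∨ (t ≠ v ∧ ∀ p ∈ Side S t t', p ∉ S.MV v) := by
  cases h with
  | refl h => exact Or.inl ⟨rfl, rfl⟩
  | step h h' hne hb =>
    have hall : ∀ p ∈ Side S t t', p ∉ S.MV v := fun p hp =>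
      not_mem_MV_of_mem_side hJ h h' hne (hb.side_subset hJ hp)
    refine Or.inr ⟨?_, hall⟩
    rintro rfl
    obtain ⟨p, hp, hpt⟩ := exists_mem_side_inter (S := S) hb.adj.2
    exact hall p hp hpt

theorem exists_beyond [Finite W] (hJ : J.IsTree) (h : J.Adj v w) (hp : p ∈ Side S v w) :
    ∃ t t', Beyond J v w t t' ∧ p ∈ S.ME t t' := by
  induction hn : (Branch J v w).ncard using Nat.strong_induction_on generalizing v w with
  | _ n ih =>
  rcases mem_side_cases hJ h hp with h1 | ⟨w', hw', hne, h1⟩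
  · exact ⟨v, w, Beyond.refl h, h1⟩
  · obtain ⟨t, t', hb, hpt⟩ := ih _ (hn ▸ branch_ncard_lt hJ.isAcyclic h hw' hne) hw' h1 rfl
    exact ⟨t, t', Beyond.step h hw' hne hb, hpt⟩

theorem Beyond.exists_back (hJ : J.IsAcyclic) (S : StripSystem G J) (h : Beyond J v w t t')
    (ht : t ≠ v) :
    ∃ s, J.Adj t s ∧ s ≠ t' ∧ ∀ x, J.Adj t x → x ≠ s → Beyond J v w t x := by
  induction h with
  | refl h => exact absurd rfl ht
  | @step v w w' t t' h h' hne hb ih =>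
    by_cases e : t = w
    · subst e
      rcases hb.eq_or hJ S with ⟨-, rfl⟩ | h2
      · exact ⟨v, h.symm, hne.symm, fun x hx hxv => Beyond.step h hx hxv (Beyond.refl hx)⟩
      · exact absurd rfl h2.1
    · obtain ⟨s, hs, hst, hall⟩ := ih e
      exact ⟨s, hs, hst, fun x hx hxs => Beyond.step h h' hne (hall x hx hxs)⟩

theorem Beyond.not_isLeaf (hJ : J.IsAcyclic) (S : StripSystem G J) (h : Beyond J v w t t')
    (hv : ¬ IsLeaf J v) : ¬ IsLeaf J t := by
  by_cases e : t = v
  · exact e ▸ hv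
  · obtain ⟨s, hs, hne, -⟩ := h.exists_back hJ S e
    exact not_isLeaf_of_ne hs h.adj.2 hne

theorem Beyond.exists_exit (hJ : J.IsAcyclic) (hC : IsCrossEdge S a b α β)
    (h : Beyond J v w t t') (hv : ¬ IsLeaf J v) {E : List V} {c : ℕ}
    (hE : IsExit S a b t t' E c) : ∃ l, IsExit S a b v w (l ++ E) c := by
  induction h with
  | refl h => exact ⟨[], by simpa using hE⟩
  | step h h' hne hb ih =>
    obtain ⟨l, hl⟩ := ih (not_isLeaf_of_ne h.symm h' hne.symm) hE
    obtain ⟨z, hz, -⟩ := exists_mem_ME_inter (S := S) h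
    obtain ⟨R, hR, -⟩ := exists_rungList h hz
    exact ⟨R ++ l, by simpa using hR.append_exit hJ hC h hv h' hne hl⟩

end Exit

section Tail

variable {G : SimpleGraph V} {a b : V}

/-- An induced path avoiding `a` and `b`, whose last vertex only is adjacent to `a`
(if `c = 0`) or to `b` (if `c = 1`). -/
structure IsTail (G : SimpleGraph V) (a b : V) (T : List V) (c : ℕ) : Prop where
  lt : c < 2
  induced : InducedList G T
  ne : T ≠ []
  adj_left : ∀ q ∈ T, q ≠ a ∧ (G.Adj a q ↔ c = 0 ∧ T.getLast? = some q)
  adj_right : ∀ q ∈ T, q ≠ b ∧ (G.Adj b q ↔ c = 1 ∧ T.getLast? = some q)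

theorem IsTail.append {l T : List V} {c : ℕ} (hT : IsTail G a b T c) (hl : InducedList G l)
    (hla : ∀ q ∈ l, q ≠ a ∧ ¬ G.Adj a q) (hlb : ∀ q ∈ l, q ≠ b ∧ ¬ G.Adj b q)
    (hcross : ∀ x ∈ l, ∀ y ∈ T, x ≠ y ∧
      (G.Adj x y ↔ l.getLast? = some x ∧ T.head? = some y)) :
    IsTail G a b (l ++ T) c := by
  have hlast : (l ++ T).getLast? = T.getLast? := List.getLast?_append_of_ne_nil _ hT.ne
  have hl' : ∀ x ∈ l, T.getLast? ≠ some x := fun x hx e =>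
    (hcross x hx x (List.mem_of_getLast? e)).1 rfl
  refine ⟨hT.lt, (inducedList_append _ _).2 ⟨hl, hT.induced, hcross⟩, by simp [hT.ne], ?_, ?_⟩
  · intro q hq
    rw [hlast]
    rcases List.mem_append.1 hq with hq | hq
    · simp [hla q hq, hl' q hq]
    · exact hT.adj_left q hq
  · intro q hq
    rw [hlast]
    rcases List.mem_append.1 hq with hq | hq
    · simp [hlb q hq, hl' q hq]
    · exact hT.adj_right q hq

theorem IsTail.suffix {l T : List V} {c : ℕ} (h : IsTail G a b (l ++ T) c) (hT : T ≠ []) :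
    IsTail G a b T c := by
  have hlast : (l ++ T).getLast? = T.getLast? := List.getLast?_append_of_ne_nil _ hT
  obtain ⟨h1, h2, h3, h4, h5⟩ := h
  rw [hlast] at h4 h5
  exact ⟨h1, ((inducedList_append _ _).1 h2).2.1, hT,
    fun q hq => h4 q (List.mem_append_right _ hq), fun q hq => h5 q (List.mem_append_right _ hq)⟩

theorem IsTail.init_part {l T : List V} {c : ℕ} (h : IsTail G a b (l ++ T) c) (hT : T ≠ []) :
    InducedList G l ∧ (∀ q ∈ l, q ≠ a ∧ ¬ G.Adj a q) ∧ ∀ q ∈ l, q ≠ b ∧ ¬ G.Adj b q := by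
  have hlast : (l ++ T).getLast? = T.getLast? := List.getLast?_append_of_ne_nil _ hT
  obtain ⟨-, h2, h3, h4, h5⟩ := h
  rw [hlast] at h4 h5
  obtain ⟨h2, -, hd⟩ := (inducedList_append _ _).1 h2
  have hl' : ∀ x ∈ l, T.getLast? ≠ some x := fun x hx e =>
    (hd x hx x (List.mem_of_getLast? e)).1 rfl
  refine ⟨h2, fun q hq => ?_, fun q hq => ?_⟩
  · have := h4 q (List.mem_append_left _ hq)
    simpa [hl' q hq] using this
  · have := h5 q (List.mem_append_left _ hq)
    simpa [hl' q hq] using this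

theorem EvenHoleFree.odd_tails (hG : EvenHoleFree G) (hab : G.Adj a b) {T₁ T₂ : List V}
    {c₁ c₂ : ℕ} (h₁ : IsTail G a b T₁ c₁) (h₂ : IsTail G a b T₂ c₂)
    (hcross : ∀ x ∈ T₁, ∀ y ∈ T₂, x ≠ y ∧
      (G.Adj x y ↔ T₁.head? = some x ∧ T₂.head? = some y)) :
    (T₁.length + T₂.length + 1 + c₁ + c₂) % 2 = 1 := by
  have hl : InducedList G (T₁.reverse ++ T₂) := by
    rw [inducedList_append]
    refine ⟨h₁.induced.reverse, h₂.induced, fun x hx y hy => ?_⟩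
    rw [List.getLast?_reverse]
    exact hcross x (List.mem_reverse.1 hx) y hy
  have hhead : (T₁.reverse ++ T₂).head? = T₁.getLast? := by
    rw [List.head?_append_of_ne_nil _ (by simpa using h₁.ne), List.head?_reverse]
  have hlast : (T₁.reverse ++ T₂).getLast? = T₂.getLast? :=
    List.getLast?_append_of_ne_nil _ h₂.ne
  have e1 : ∀ q ∈ T₁, T₂.getLast? ≠ some q := fun q hq e =>
    (hcross q hq q (List.mem_of_getLast? e)).1 rfl
  have e2 : ∀ q ∈ T₂, T₁.getLast? ≠ some q := fun q hq e =>
    (hcross q (List.mem_of_getLast? e) q hq).1 rfl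
  have n1 := List.length_pos_iff.2 h₁.ne
  have n2 := List.length_pos_iff.2 h₂.ne
  have hlen : (T₁.reverse ++ T₂).length = T₁.length + T₂.length := by simp
  rw [← hlen]
  refine hG.odd_through_edge hab hl (by omega) ?_ ?_ h₁.lt h₂.lt ?_ ?_
  · intro h
    rcases List.mem_append.1 h with h | h
    · exact (h₁.adj_left a (List.mem_reverse.1 h)).1 rfl
    · exact (h₂.adj_left a h).1 rfl
  · intro h
    rcases List.mem_append.1 h with h | h
    · exact (h₁.adj_right b (List.mem_reverse.1 h)).1 rfl
    · exact (h₂.adj_right b h).1 rfl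
  · intro q hq
    rw [hhead, hlast]
    rcases List.mem_append.1 hq with h | h
    · have h := List.mem_reverse.1 h
      rw [(h₁.adj_left q h).2]
      simp [e1 q h]
    · rw [(h₂.adj_left q h).2]
      simp [e2 q h]
  · intro q hq
    rw [hhead, hlast]
    rcases List.mem_append.1 hq with h | h
    · have h := List.mem_reverse.1 h
      rw [(h₁.adj_right q h).2]
      simp [e1 q h]
    · rw [(h₂.adj_right q h).2]
      simp [e2 q h]

theorem exists_first {P : V → Prop} {l : List V} {x : V} (hx : x ∈ l) (hP : P x) :
    ∃ l₁ y l₂, l = l₁ ++ y :: l₂ ∧ P y ∧ ∀ z ∈ l₁, ¬ P z := by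
  induction l with
  | nil => simp at hx
  | cons z l ih =>
    by_cases hz : P z
    · exact ⟨[], z, l, rfl, hz, by simp⟩
    · rcases List.mem_cons.1 hx with rfl | hx
      · exact absurd hP hz
      · obtain ⟨l₁, y, l₂, rfl, hy, h⟩ := ih hx
        exact ⟨z :: l₁, y, l₂, rfl, hy, by simpa [hz] using h⟩

theorem exists_last {P : V → Prop} {l : List V} {x : V} (hx : x ∈ l) (hP : P x) :
    ∃ l₁ y l₂, l = l₁ ++ y :: l₂ ∧ P y ∧ ∀ z ∈ l₂, ¬ P z := by
  obtain ⟨l₁, y, l₂, h, hy, hl⟩ := exists_first (List.mem_reverse.2 hx) hP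
  refine ⟨l₂.reverse, y, l₁.reverse, ?_, hy, by simpa using hl⟩
  rw [← List.reverse_reverse l, h]
  simp

end Tail

section Link

variable {G : SimpleGraph V} {J : SimpleGraph W} {S : StripSystem G J} {a b : V}
  {α β : Set W} {v w w' : W} {x y : V} {L : List V}

theorem IsExit.isTail {Q : List V} {c : ℕ} (hC : IsCrossEdge S a b α β)
    (h : IsExit S a b v w Q c) : IsTail G a b Q c :=
  ⟨h.lt, h.induced, h.ne,
    fun q hq => ⟨fun e => hC.not_mem_VM.1 (e ▸ side_subset_VM (h.side q hq)), h.adj_left q hq⟩,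
    fun q hq => ⟨fun e => hC.not_mem_VM.2 (e ▸ side_subset_VM (h.side q hq)), h.adj_right q hq⟩⟩

/-- `x` has a neighbour in the list `L`. -/
def Touches (G : SimpleGraph V) (L : List V) (x : V) : Prop := ∃ f ∈ L, G.Adj x f

/-- The first vertex of `L` is the unique neighbour of `x` in `L`. -/
def AttHead (G : SimpleGraph V) (L : List V) (x : V) : Prop :=
  ∀ f ∈ L, G.Adj x f ↔ L.head? = some f

/-- An induced path disjoint from the strip system and from the neighbourhoods of `a` and
`b`, of which vertices forming a nonlocal pair see opposite ends. -/
structure IsLink (S : StripSystem G J) (a b : V) (L : List V) : Prop where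
  ne : L ≠ []
  induced : InducedList G L
  not_mem : ∀ f ∈ L, f ∉ VM S
  adj_left : ∀ f ∈ L, f ≠ a ∧ ¬ G.Adj a f
  adj_right : ∀ f ∈ L, f ≠ b ∧ ¬ G.Adj b f
  pair : ∀ x ∈ VM S, ∀ y ∈ VM S, ¬ LocalPair S x y → ∀ f ∈ L, ∀ f' ∈ L, G.Adj x f →
    G.Adj y f' → (L.head? = some f ∧ L.getLast? = some f') ∨
      (L.getLast? = some f ∧ L.head? = some f')

theorem touches_reverse : Touches G L.reverse x ↔ Touches G L x := by simp [Touches]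

theorem IsLink.reverse (h : IsLink S a b L) : IsLink S a b L.reverse := by
  refine ⟨by simpa using h.ne, h.induced.reverse, by simpa using h.not_mem,
    by simpa using h.adj_left, by simpa using h.adj_right, ?_⟩
  intro x hx y hy hn f hf f' hf' hxf hyf
  rw [List.head?_reverse, List.getLast?_reverse]
  exact (h.pair x hx y hy hn f (by simpa using hf) f' (by simpa using hf') hxf hyf).symm

theorem AttHead.touches (h : AttHead G L x) (hL : L ≠ []) : Touches G L x :=
  ⟨L.head hL, List.head_mem hL, (h _ (List.head_mem hL)).2 (List.head?_eq_some_head hL)⟩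

theorem IsLink.attHead_or (h : IsLink S a b L) (hx : x ∈ VM S) (hy : y ∈ VM S)
    (hn : ¬ LocalPair S x y) (hxt : Touches G L x) (hyt : Touches G L y) :
    (AttHead G L x ∧ AttHead G L.reverse y) ∨ (AttHead G L.reverse x ∧ AttHead G L y) := by
  have key : ∀ L : List V, IsLink S a b L → ∀ f₀ ∈ L, ∀ g₀ ∈ L, G.Adj x f₀ → G.Adj y g₀ →
      L.head? = some f₀ → L.getLast? = some g₀ → AttHead G L x ∧ AttHead G L.reverse y := by
    intro L h f₀ hf₀ g₀ hg₀ hx₀ hy₀ e₁ e₂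
    constructor
    · intro f hf
      constructor
      · intro hxf
        rcases h.pair x hx y hy hn f hf g₀ hg₀ hxf hy₀ with h' | ⟨h1, h2⟩
        · exact h'.1
        · rw [h2, ← e₂, h1]
      · intro hf
        rw [e₁] at hf
        simp only [Option.some.injEq] at hf
        exact hf ▸ hx₀
    · intro g hg
      rw [List.head?_reverse]
      rw [List.mem_reverse] at hg
      constructor
      · intro hyg
        rcases h.pair x hx y hy hn f₀ hf₀ g hg hx₀ hyg with h' | ⟨h1, h2⟩
        · exact h'.2
        · rw [h1, ← h2, e₁]
      · intro hg
        rw [e₂] at hg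
        simp only [Option.some.injEq] at hg
        exact hg ▸ hy₀
  obtain ⟨f, hf, hxf⟩ := hxt
  obtain ⟨g, hg, hyg⟩ := hyt
  rcases h.pair x hx y hy hn f hf g hg hxf hyg with ⟨h1, h2⟩ | ⟨h1, h2⟩
  · exact Or.inl (key L h f hf g hg hxf hyg h1 h2)
  · have := key L.reverse h.reverse f (by simpa using hf) g (by simpa using hg) hxf hyg
      (by simpa using h1) (by simpa using h2)
    rw [List.reverse_reverse] at this
    exact Or.inr this

theorem IsLink.length_eq_one (h : IsLink S a b L) (h₁ : AttHead G L x)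
    (h₂ : AttHead G L.reverse x) : ∃ f, L = [f] := by
  obtain ⟨f, hf, hxf⟩ := h₁.touches h.ne
  refine ⟨f, h.induced.eq_singleton ((h₁ f hf).1 hxf) ?_⟩
  simpa using (h₂ f (by simpa using hf)).1 hxf

theorem IsLink.attHead (h : IsLink S a b L) (hx : x ∈ VM S) (hy : y ∈ VM S)
    (hn : ¬ LocalPair S x y) (hxt : Touches G L x) (hyt : AttHead G L.reverse y) :
    AttHead G L x := by
  rcases h.attHead_or hx hy hn hxt
    (touches_reverse.1 (hyt.touches (by simpa using h.ne))) with h' | h'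
  · exact h'.1
  · obtain ⟨f, rfl⟩ := h.length_eq_one h'.2 hyt
    simpa using h'.1

theorem AttHead.adj_iff (h : AttHead G L x) {T : List V} (hT : ∀ z ∈ T, ¬ Touches G L z)
    (hx : x ∉ T) : ∀ p ∈ x :: T, ∀ f ∈ L,
      G.Adj p f ↔ (x :: T).head? = some p ∧ L.head? = some f := by
  intro p hp f hf
  rcases List.mem_cons.1 hp with rfl | hp
  · simpa using h f hf
  · simp only [List.head?_cons, Option.some.injEq]
    refine ⟨fun hadj => absurd ⟨f, hf, hadj⟩ (hT p hp), ?_⟩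
    rintro ⟨rfl, -⟩
    exact absurd hp hx

/-- Two anticomplete tails joined by a link. -/
theorem IsLink.odd (hG : EvenHoleFree G) (hab : G.Adj a b) (h : IsLink S a b L)
    {T₁ T₂ : List V} {c₁ c₂ : ℕ} (h₁ : IsTail G a b T₁ c₁) (h₂ : IsTail G a b T₂ c₂)
    (hV₁ : ∀ p ∈ T₁, p ∈ VM S) (hV₂ : ∀ p ∈ T₂, p ∈ VM S)
    (hcross : ∀ p ∈ T₁, ∀ q ∈ T₂, p ≠ q ∧ ¬ G.Adj p q)
    (hT₁ : ∀ p ∈ T₁, ∀ f ∈ L, G.Adj p f ↔ T₁.head? = some p ∧ L.head? = some f)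
    (hT₂ : ∀ p ∈ T₂, ∀ f ∈ L, G.Adj p f ↔ T₂.head? = some p ∧ L.getLast? = some f) :
    (L.length + T₁.length + T₂.length + 1 + c₁ + c₂) % 2 = 1 := by
  have h3 : IsTail G a b (L ++ T₂) c₂ := by
    refine h₂.append h.induced h.adj_left h.adj_right fun f hf p hp => ⟨?_, ?_⟩
    · rintro rfl
      exact h.not_mem f hf (hV₂ f hp)
    · rw [G.adj_comm, hT₂ p hp f hf, and_comm]
  have hhead : (L ++ T₂).head? = L.head? := List.head?_append_of_ne_nil _ h.ne
  have := hG.odd_tails hab h₁ h3 (fun p hp q hq => by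
    rw [hhead]
    rcases List.mem_append.1 hq with hq | hq
    · refine ⟨?_, hT₁ p hp q hq⟩
      rintro rfl
      exact h.not_mem p hq (hV₁ p hp)
    · refine ⟨(hcross p hp q hq).1, fun hadj => absurd hadj (hcross p hp q hq).2, ?_⟩
      rintro ⟨-, h'⟩
      exact absurd (hV₂ q hq) (h.not_mem q (List.mem_of_head? h')))
  simp only [List.length_append] at this
  omega

end Link

section Parity

variable {G : SimpleGraph V} {J : SimpleGraph W} {S : StripSystem G J} {a b : V}
  {α β : Set W} {v w w' w₁ w₂ w₃ : W} {x y z : V} {L Q₁ Q₂ Q₃ l r s t : List V} {c₁ c₂ c₃ : ℕ}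

theorem IsExit.cross (hJ : J.IsAcyclic) (hw₁ : J.Adj v w₁) (hw₂ : J.Adj v w₂) (hne : w₁ ≠ w₂)
    (h₁ : IsExit S a b v w₁ Q₁ c₁) (h₂ : IsExit S a b v w₂ Q₂ c₂) :
    ∀ x ∈ Q₁, ∀ y ∈ Q₂, x ≠ y ∧ (G.Adj x y ↔ Q₁.head? = some x ∧ Q₂.head? = some y) := by
  intro x hx y hy
  rw [← h₁.head x hx, ← h₂.head y hy]
  exact side_cross hJ hw₁ hw₂ hne (h₁.side x hx) (h₂.side y hy)

theorem IsExit.odd (hG : EvenHoleFree G) (hJ : J.IsAcyclic) (hC : IsCrossEdge S a b α β)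
    (hw₁ : J.Adj v w₁) (hw₂ : J.Adj v w₂) (hne : w₁ ≠ w₂)
    (h₁ : IsExit S a b v w₁ Q₁ c₁) (h₂ : IsExit S a b v w₂ Q₂ c₂) :
    (Q₁.length + Q₂.length + 1 + c₁ + c₂) % 2 = 1 :=
  hG.odd_tails hC.1 (h₁.isTail hC) (h₂.isTail hC) (h₁.cross hJ hw₁ hw₂ hne h₂)

theorem IsExit.suffix_not_mem (h : IsExit S a b v w (l ++ x :: r) c₁) (hl : l ≠ []) :
    ∀ p ∈ x :: r, p ∉ S.MV v := by
  intro p hp hv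
  have := (h.head p (List.mem_append_right _ hp)).1 hv
  rw [List.head?_append_of_ne_nil _ hl] at this
  exact (((inducedList_append _ _).1 h.induced).2.2 p (List.mem_of_head? this) p hp).1 rfl

theorem IsExit.exists_last (h : IsExit S a b v w Q₁ c₁) (hx : x ∈ Q₁) (ht : Touches G L x)
    (hv : x ∉ S.MV v) : ∃ l y r, Q₁ = l ++ y :: r ∧ Touches G L y ∧
      (∀ z ∈ r, ¬ Touches G L z) ∧ ∀ p ∈ y :: r, p ∉ S.MV v := by
  obtain ⟨l, y, r, rfl, hy, hr⟩ := EHF.exists_last (P := Touches G L) hx ht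
  refine ⟨l, y, r, rfl, hy, hr, h.suffix_not_mem ?_⟩
  rintro rfl
  rcases List.mem_cons.1 hx with rfl | hx
  · exact hv ((h.head x (by simp)).2 (by simp))
  · exact hr x hx ht

theorem InducedList.not_mem_right (h : InducedList G (l ++ x :: r)) : x ∉ r :=
  ((inducedList_append _ _).1 h).2.1.1

/-- Two exits whose last vertices touching the link see its opposite ends. -/
theorem IsLink.even_suffix_suffix (hG : EvenHoleFree G) (hJ : J.IsAcyclic)
    (hC : IsCrossEdge S a b α β) (hL : IsLink S a b L)
    (hw₁ : J.Adj v w₁) (hw₂ : J.Adj v w₂) (hne : w₁ ≠ w₂)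
    (h₁ : IsExit S a b v w₁ (l ++ x :: r) c₁) (h₂ : IsExit S a b v w₂ (s ++ y :: t) c₂)
    (hr : ∀ z ∈ r, ¬ Touches G L z) (ht : ∀ z ∈ t, ¬ Touches G L z)
    (hv : ∀ p ∈ x :: r, ∀ q ∈ y :: t, p ∈ S.MV v → q ∉ S.MV v)
    (hx : AttHead G L x) (hy : AttHead G L.reverse y) :
    (L.length + l.length + s.length) % 2 = 0 := by
  have e1 := h₁.odd hG hJ hC hw₁ hw₂ hne h₂
  have e2 := hL.odd hG hC.1 ((h₁.isTail hC).suffix (by simp)) ((h₂.isTail hC).suffix (by simp))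
    (fun p hp => side_subset_VM (h₁.side p (List.mem_append_right _ hp)))
    (fun p hp => side_subset_VM (h₂.side p (List.mem_append_right _ hp)))
    (fun p hp q hq => by
      have := side_cross hJ hw₁ hw₂ hne (h₁.side p (List.mem_append_right _ hp))
        (h₂.side q (List.mem_append_right _ hq))
      exact ⟨this.1, fun h => hv p hp q hq (this.2.1 h).1 (this.2.1 h).2⟩)
    (hx.adj_iff hr h₁.induced.not_mem_right)
    (fun p hp f hf => by
      have := hy.adj_iff (by simpa only [touches_reverse] using ht) h₂.induced.not_mem_right p hp
        f (by simpa using hf)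
      rwa [List.head?_reverse] at this)
  simp only [List.length_append, List.length_cons] at e1 e2
  omega

/-- Going back from the first vertex of an exit touching the link and leaving through a
third exit. -/
theorem IsLink.even_prefix_suffix (hG : EvenHoleFree G) (hJ : J.IsAcyclic)
    (hC : IsCrossEdge S a b α β) (hL : IsLink S a b L)
    (hw₁ : J.Adj v w₁) (hw₂ : J.Adj v w₂) (hw₃ : J.Adj v w₃)
    (h12 : w₁ ≠ w₂) (h13 : w₁ ≠ w₃) (h23 : w₂ ≠ w₃)
    (h₁ : IsExit S a b v w₁ (l ++ x :: r) c₁) (h₂ : IsExit S a b v w₂ (s ++ y :: t) c₂)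
    (h₃ : IsExit S a b v w₃ Q₃ c₃)
    (hl : ∀ z ∈ l, ¬ Touches G L z) (ht : ∀ z ∈ t, ¬ Touches G L z)
    (hQ₃ : ∀ z ∈ Q₃, ¬ Touches G L z)
    (hr : r ≠ [])
    (hv : ∀ p ∈ y :: t, p ∉ S.MV v)
    (hx : AttHead G L x) (hy : AttHead G L.reverse y) :
    (L.length + l.length + 1 + s.length) % 2 = 0 := by
  have e1 := h₂.odd hG hJ hC hw₂ hw₃ h23 h₃
  have hQ : IsExit S a b v w₁ ((l ++ [x]) ++ r) c₁ := by simpa using h₁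
  obtain ⟨p1, p2, p3⟩ := (hQ.isTail hC).init_part hr
  have hsub : ∀ q ∈ (l ++ [x]).reverse, q ∈ l ++ x :: r := by
    intro q hq
    rw [List.mem_reverse] at hq
    have := List.mem_append_left r hq
    simpa using this
  have htail := (h₃.isTail hC).append p1.reverse (fun q hq => p2 q (List.mem_reverse.1 hq))
    (fun q hq => p3 q (List.mem_reverse.1 hq)) (by
      intro p hp q hq
      have := h₁.cross hJ hw₁ hw₃ h13 h₃ p (hsub p hp) q hq
      rw [List.getLast?_reverse]
      have e : (l ++ [x]).head? = (l ++ x :: r).head? := by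
        cases l <;> simp
      rwa [e])
  have hxl : x ∉ l.reverse ++ Q₃ := by
    intro h
    rcases List.mem_append.1 h with h | h
    · exact hl x (List.mem_reverse.1 h) (hx.touches hL.ne)
    · exact hQ₃ x h (hx.touches hL.ne)
  have hform : (l ++ [x]).reverse ++ Q₃ = x :: (l.reverse ++ Q₃) := by simp
  have hside : ∀ p ∈ (l ++ [x]).reverse ++ Q₃, p ∈ Side S v w₁ ∨ p ∈ Side S v w₃ := by
    intro p hp
    rcases List.mem_append.1 hp with hp | hp
    · exact Or.inl (h₁.side p (hsub p hp))
    · exact Or.inr (h₃.side p hp)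
  have e2 := hL.odd hG hC.1 htail ((h₂.isTail hC).suffix (by simp))
    (fun p hp => (hside p hp).elim (fun h => side_subset_VM h) fun h => side_subset_VM h)
    (fun p hp => side_subset_VM (h₂.side p (List.mem_append_right _ hp)))
    (fun p hp q hq => by
      have h2 := h₂.side q (List.mem_append_right _ hq)
      rcases hside p hp with h | h
      · have := side_cross hJ hw₁ hw₂ h12 h h2
        exact ⟨this.1, fun h => hv q hq (this.2.1 h).2⟩
      · have := side_cross hJ hw₃ hw₂ h23.symm h h2
        exact ⟨this.1, fun h => hv q hq (this.2.1 h).2⟩)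
    (by
      rw [hform]
      refine hx.adj_iff (fun z hz => ?_) hxl
      rcases List.mem_append.1 hz with h | h
      · exact hl z (List.mem_reverse.1 h)
      · exact hQ₃ z h)
    (fun p hp f hf => by
      have := hy.adj_iff (by simpa only [touches_reverse] using ht) h₂.induced.not_mem_right p hp
        f (by simpa using hf)
      rwa [List.head?_reverse] at this)
  simp only [List.length_append, List.length_cons, List.length_reverse, List.length_nil] at e1 e2
  omega

/-- Closing up two exits through `M_v` and the link. -/
theorem IsLink.odd_of_prefixes (hG : EvenHoleFree G) (hJ : J.IsAcyclic)
    (hL : IsLink S a b L) (hw₁ : J.Adj v w₁) (hw₂ : J.Adj v w₂) (hne : w₁ ≠ w₂)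
    (h₁ : IsExit S a b v w₁ (l ++ x :: r) c₁) (h₂ : IsExit S a b v w₂ (s ++ y :: t) c₂)
    (hl : ∀ z ∈ l, ¬ Touches G L z) (hs : ∀ z ∈ s, ¬ Touches G L z)
    (hx : AttHead G L x) (hy : AttHead G L.reverse y)
    (hlen : 2 ≤ L.length + l.length + s.length) :
    (L.length + l.length + s.length) % 2 = 1 := by
  have hQ₁ : (l ++ [x]) ++ r = l ++ x :: r := by simp
  have hQ₂ : (s ++ [y]) ++ t = s ++ y :: t := by simp
  have i1 : InducedList G (l ++ [x]) := by
    have := h₁.induced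
    rw [← hQ₁] at this
    exact ((inducedList_append _ _).1 this).1
  have i2 : InducedList G (s ++ [y]) := by
    have := h₂.induced
    rw [← hQ₂] at this
    exact ((inducedList_append _ _).1 this).1
  have m1 : ∀ q ∈ l ++ [x], q ∈ l ++ x :: r := fun q hq => hQ₁ ▸ List.mem_append_left r hq
  have m2 : ∀ q ∈ s ++ [y], q ∈ s ++ y :: t := fun q hq => hQ₂ ▸ List.mem_append_left t hq
  have hd1 : (l ++ [x]).head? = (l ++ x :: r).head? := by cases l <;> simp
  have hd2 : (s ++ [y]).head? = (s ++ y :: t).head? := by cases s <;> simp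
  have hcr : ∀ p ∈ l ++ [x], ∀ q ∈ s ++ [y], p ≠ q ∧
      (G.Adj p q ↔ (l ++ [x]).head? = some p ∧ (s ++ [y]).head? = some q) := by
    intro p hp q hq
    rw [hd1, hd2]
    exact h₁.cross hJ hw₁ hw₂ hne h₂ p (m1 p hp) q (m2 q hq)
  have hI : InducedList G ((l ++ [x]).reverse ++ (s ++ [y])) := by
    rw [inducedList_append]
    refine ⟨i1.reverse, i2, fun p hp q hq => ?_⟩
    rw [List.getLast?_reverse]
    exact hcr p (List.mem_reverse.1 hp) q hq
  have hhead : ((l ++ [x]).reverse ++ (s ++ [y])).head? = some x := by simp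
  have hlast : ((l ++ [x]).reverse ++ (s ++ [y])).getLast? = some y := by
    rw [List.getLast?_append_of_ne_nil _ (by simp)]
    simp
  have hxs : x ∉ s ++ [y] := fun h => (hcr x (by simp) x h).1 rfl
  have hyl : y ∉ l ++ [x] := fun h => (hcr y h y (by simp)).1 rfl
  have hxl : x ∉ l := fun h => hl x h (hx.touches hL.ne)
  have hys : y ∉ s := fun h => hs y h
    (touches_reverse.1 (hy.touches (by simpa using hL.ne)))
  have := hG.odd_glue hL.induced hI hL.ne (by simp; omega) (by simp; omega) (by
    intro f hf p hp
    rw [hhead, hlast]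
    have hpV : p ∈ VM S := by
      rcases List.mem_append.1 hp with h | h
      · exact side_subset_VM (h₁.side p (m1 p (List.mem_reverse.1 h)))
      · exact side_subset_VM (h₂.side p (m2 p h))
    refine ⟨fun e => hL.not_mem f hf (e ▸ hpV), ?_⟩
    rw [G.adj_comm]
    simp only [Option.some.injEq]
    by_cases ex : x = p
    · subst ex
      rw [hx f hf]
      have : y ≠ x := fun e => hyl (e ▸ by simp)
      simp [this]
    · by_cases ey : y = p
      · subst ey
        have := hy f (by simpa using hf)
        rw [List.head?_reverse] at this
        rw [this]
        simp [ex]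
      · simp only [ex, ey, and_false, or_self, iff_false]
        intro hadj
        have hpn : Touches G L p := ⟨f, hf, hadj⟩
        simp only [List.mem_append, List.mem_reverse, List.mem_singleton] at hp
        rcases hp with (h | h) | (h | h)
        · exact hl p h hpn
        · exact ex h.symm
        · exact hs p h hpn
        · exact ey h.symm)
  simp only [List.length_append, List.length_cons, List.length_reverse, List.length_nil] at this
  omega

end Parity

section Deep

variable {G : SimpleGraph V} {J : SimpleGraph W} {S : StripSystem G J} {a b : V}
  {α β : Set W} {v w w₁ w₂ w₃ u t n d : W} {x y z : V}
  {L Q Q₁ Q₂ Q₃ l l₁ l₂ r r₁ r₂ : List V} {c c₁ c₂ c₃ : ℕ}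

/-- There are no touched vertices in three directions at `v`, if two of them avoid `M_v`. -/
theorem IsLink.not_three_sides [Finite W] (hG : EvenHoleFree G) (hJ : J.IsTree)
    (hC : IsCrossEdge S a b α β) (hL : IsLink S a b L)
    (hw₁ : J.Adj v w₁) (hw₂ : J.Adj v w₂) (hw₃ : J.Adj v w₃)
    (h12 : w₁ ≠ w₂) (h13 : w₁ ≠ w₃) (h23 : w₂ ≠ w₃)
    (hx : x ∈ Side S v w₁) (hxv : x ∉ S.MV v) (hxt : Touches G L x)
    (hy : y ∈ Side S v w₂) (hyv : y ∉ S.MV v) (hyt : Touches G L y)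
    (hz : z ∈ Side S v w₃) : ¬ Touches G L z := by
  intro hzt
  have hA := hJ.isAcyclic
  have hv := not_isLeaf_of_ne hw₁ hw₂ h12
  obtain ⟨Q₁, c₁, h₁, hx⟩ := exists_exit hJ hC hw₁ hv hx
  obtain ⟨Q₂, c₂, h₂, hy⟩ := exists_exit hJ hC hw₂ hv hy
  obtain ⟨Q₃, c₃, h₃, hz⟩ := exists_exit hJ hC hw₃ hv hz
  obtain ⟨l₁, x', r₁, rfl, hx't, hr₁, hv₁⟩ := h₁.exists_last hx hxt hxv
  obtain ⟨l₂, y', r₂, rfl, hy't, hr₂, hv₂⟩ := h₂.exists_last hy hyt hyv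
  obtain ⟨l₃, z', r₃, rfl, hz't, hr₃⟩ := EHF.exists_last (P := Touches G L) hz hzt
  have sx := h₁.side x' (by simp)
  have sy := h₂.side y' (by simp)
  have sz := h₃.side z' (by simp)
  have nxy := not_localPair_of_side hA hw₁ hw₂ h12 sx sy fun _ => hv₂ _ (by simp)
  have nxz := not_localPair_of_side hA hw₁ hw₃ h13 sx sz fun h => absurd h (hv₁ _ (by simp))
  have nyz := not_localPair_of_side hA hw₂ hw₃ h23 sy sz fun h => absurd h (hv₂ _ (by simp))
  have key : ∀ {w₁ w₂ : W} {x' y' : V} {l₁ r₁ l₂ r₂ : List V} {c₁ c₂ : ℕ},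
      J.Adj v w₁ → J.Adj v w₂ → w₁ ≠ w₂ → w₁ ≠ w₃ → w₂ ≠ w₃ →
      IsExit S a b v w₁ (l₁ ++ x' :: r₁) c₁ → IsExit S a b v w₂ (l₂ ++ y' :: r₂) c₂ →
      (∀ z ∈ r₁, ¬ Touches G L z) → (∀ z ∈ r₂, ¬ Touches G L z) →
      (∀ p ∈ x' :: r₁, p ∉ S.MV v) → (∀ p ∈ y' :: r₂, p ∉ S.MV v) →
      ¬ LocalPair S x' z' → ¬ LocalPair S y' z' →
      AttHead G L x' → AttHead G L.reverse y' → False := by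
    intro w₁ w₂ x' y' l₁ r₁ l₂ r₂ c₁ c₂ hw₁ hw₂ h12 h13 h23 h₁ h₂ hr₁ hr₂ hv₁ hv₂ nxz nyz ax ay
    have sx := side_subset_VM (h₁.side x' (by simp))
    have sy := side_subset_VM (h₂.side y' (by simp))
    have az := hL.attHead (side_subset_VM sz) sy (fun h => nyz h.symm) hz't ay
    have az' := hL.reverse.attHead (side_subset_VM sz) sx (fun h => nxz h.symm)
      (touches_reverse.2 hz't) (by rwa [List.reverse_reverse])
    obtain ⟨f, rfl⟩ := hL.length_eq_one az az'
    have e1 := hL.even_suffix_suffix hG hA hC hw₁ hw₂ h12 h₁ h₂ hr₁ hr₂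
      (fun p hp q hq h => absurd h (hv₁ p hp)) ax ay
    have e2 := hL.even_suffix_suffix hG hA hC hw₁ hw₃ h13 h₁ h₃ hr₁ hr₃
      (fun p hp q hq h => absurd h (hv₁ p hp)) ax az'
    have e3 := hL.even_suffix_suffix hG hA hC hw₃ hw₂ h23.symm h₃ h₂ hr₃ hr₂
      (fun p hp q hq _ => hv₂ q hq) az ay
    simp only [List.length_singleton] at e1 e2 e3
    omega
  rcases hL.attHead_or (side_subset_VM sx) (side_subset_VM sy) nxy hx't hy't with ⟨h, h'⟩ | ⟨h, h'⟩
  · exact key hw₁ hw₂ h12 h13 h23 h₁ h₂ hr₁ hr₂ hv₁ hv₂ nxz nyz h h'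
  · exact key hw₂ hw₁ h12.symm h23 h13 h₂ h₁ hr₂ hr₁ hv₂ hv₁ nyz nxz h' h

theorem IsLink.not_two_exits [Finite W] (hG : EvenHoleFree G) (hJ : J.IsTree)
    (hC : IsCrossEdge S a b α β) (hL : IsLink S a b L)
    (hw₁ : J.Adj v w₁) (hw₂ : J.Adj v w₂) (h12 : w₁ ≠ w₂)
    (h₁ : IsExit S a b v w₁ (l₁ ++ x :: r₁) c₁) (h₂ : IsExit S a b v w₂ (l₂ ++ y :: r₂) c₂)
    (hr₁ : r₁ ≠ []) (hr₂ : r₂ ≠ [])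
    (hl₁ : ∀ z ∈ l₁, ¬ Touches G L z) (hl₂ : ∀ z ∈ l₂, ¬ Touches G L z)
    (hxt : Touches G L x) (hyt : Touches G L y)
    (hx : ∃ p ∈ l₁ ++ x :: r₁, Touches G L p ∧ p ∉ S.MV v)
    (hy : ∃ p ∈ l₂ ++ y :: r₂, Touches G L p ∧ p ∉ S.MV v) : False := by
  have hA := hJ.isAcyclic
  have hv := not_isLeaf_of_ne hw₁ hw₂ h12
  obtain ⟨p, hp, hpt, hpv⟩ := hx
  obtain ⟨q, hq, hqt, hqv⟩ := hy
  obtain ⟨w₃, hw₃, h31, h32⟩ := exists_adj_ne_ne (hC.2.2.2.1 v) hw₁ hw₂ h12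
  have hun : ∀ z ∈ Side S v w₃, ¬ Touches G L z := fun z hz =>
    hL.not_three_sides hG hJ hC hw₁ hw₂ hw₃ h12 h31.symm h32.symm (h₁.side p hp) hpv hpt
      (h₂.side q hq) hqv hqt hz
  obtain ⟨p₃, hp₃, -⟩ := exists_mem_side_inter (S := S) hw₃
  obtain ⟨Q₃, c₃, h₃, -⟩ := exists_exit hJ hC hw₃ hv hp₃
  have hQ₃ : ∀ z ∈ Q₃, ¬ Touches G L z := fun z hz => hun z (h₃.side z hz)
  obtain ⟨m₁, x', s₁, e₁, hx't, hs₁, hv₁⟩ := h₁.exists_last hp hpt hpv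
  obtain ⟨m₂, y', s₂, e₂, hy't, hs₂, hv₂⟩ := h₂.exists_last hq hqt hqv
  have key : ∀ {w₁ w₂ : W} {x x' y y' : V} {l₁ r₁ m₁ s₁ l₂ r₂ m₂ s₂ : List V} {c₁ c₂ : ℕ},
      J.Adj v w₁ → J.Adj v w₂ → w₁ ≠ w₂ → w₁ ≠ w₃ → w₂ ≠ w₃ →
      IsExit S a b v w₁ (l₁ ++ x :: r₁) c₁ → IsExit S a b v w₂ (l₂ ++ y :: r₂) c₂ →
      r₁ ≠ [] → r₂ ≠ [] →
      (∀ z ∈ l₁, ¬ Touches G L z) → (∀ z ∈ l₂, ¬ Touches G L z) →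
      Touches G L x → Touches G L y →
      l₁ ++ x :: r₁ = m₁ ++ x' :: s₁ → l₂ ++ y :: r₂ = m₂ ++ y' :: s₂ →
      (∀ z ∈ s₁, ¬ Touches G L z) → (∀ z ∈ s₂, ¬ Touches G L z) →
      (∀ p ∈ x' :: s₁, p ∉ S.MV v) → (∀ p ∈ y' :: s₂, p ∉ S.MV v) →
      AttHead G L x' → AttHead G L.reverse y' → False := by
    intro w₁ w₂ x x' y y' l₁ r₁ m₁ s₁ l₂ r₂ m₂ s₂ c₁ c₂ hw₁ hw₂ h12 h13 h23 h₁ h₂ hr₁ hr₂ hl₁ hl₂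
      hxt hyt e₁ e₂ hs₁ hs₂ hv₁ hv₂ ax' ay'
    have h₁' := e₁ ▸ h₁
    have h₂' := e₂ ▸ h₂
    have sx := h₁.side x (by simp)
    have sy := h₂.side y (by simp)
    have sx' := h₁'.side x' (by simp)
    have sy' := h₂'.side y' (by simp)
    have ax := hL.attHead (side_subset_VM sx) (side_subset_VM sy')
      (not_localPair_of_side hA hw₁ hw₂ h12 sx sy' fun _ => hv₂ _ (by simp)) hxt ay'
    have ax'' : AttHead G L.reverse.reverse x' := by rwa [List.reverse_reverse]
    have ay := hL.reverse.attHead (side_subset_VM sy) (side_subset_VM sx')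
      (not_localPair_of_side hA hw₂ hw₁ h12.symm sy sx' fun _ => hv₁ _ (by simp))
      (touches_reverse.2 hyt) ax''
    have k1 := hL.even_suffix_suffix hG hA hC hw₁ hw₂ h12 h₁' h₂' hs₁ hs₂
      (fun p hp q hq h => absurd h (hv₁ p hp)) ax' ay'
    have k2 := hL.even_prefix_suffix hG hA hC hw₁ hw₂ hw₃ h12 h13 h23 h₁ h₂' h₃ hl₁ hs₂ hQ₃ hr₁
      hv₂ ax ay'
    have k3 := hL.reverse.even_prefix_suffix hG hA hC hw₂ hw₁ hw₃ h12.symm h23 h13 h₂ h₁' h₃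
      (fun z hz h => hl₂ z hz (touches_reverse.1 h)) (fun z hz h => hs₁ z hz (touches_reverse.1 h))
      (fun z hz h => hQ₃ z hz (touches_reverse.1 h)) hr₂ hv₁ ay ax''
    have k4 := hL.odd_of_prefixes hG hA hw₁ hw₂ h12 h₁ h₂ hl₁ hl₂ ax ay
    have := List.length_pos_iff.2 hL.ne
    simp only [List.length_reverse] at k3
    omega
  have h₁' := e₁ ▸ h₁
  have h₂' := e₂ ▸ h₂
  have sx' := h₁'.side x' (by simp)
  have sy' := h₂'.side y' (by simp)
  rcases hL.attHead_or (side_subset_VM sx') (side_subset_VM sy')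
    (not_localPair_of_side hA hw₁ hw₂ h12 sx' sy' fun _ => hv₂ _ (by simp)) hx't hy't
    with ⟨h, h'⟩ | ⟨h, h'⟩
  · exact key hw₁ hw₂ h12 h31.symm h32.symm h₁ h₂ hr₁ hr₂ hl₁ hl₂ hxt hyt e₁ e₂ hs₁ hs₂ hv₁ hv₂ h h'
  · exact key hw₂ hw₁ h12.symm h32.symm h31.symm h₂ h₁ hr₂ hr₁ hl₂ hl₁ hyt hxt e₂ e₁ hs₂ hs₁ hv₂ hv₁
      h' h

theorem IsLink.not_exit_exit_tail (hG : EvenHoleFree G) (hJ : J.IsAcyclic)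
    (hC : IsCrossEdge S a b α β) (hL : IsLink S a b L)
    (hu : J.Adj t u) (hd : J.Adj t d) (hw : J.Adj t w) (hud : u ≠ d) (huw : u ≠ w) (hdw : d ≠ w)
    (hR : IsExit S a b t u (l ++ [z]) 0) (hl : ∀ p ∈ l, ¬ Touches G L p) (hz : AttHead G L z)
    (hQ : IsExit S a b t w Q 1) (hQu : ∀ p ∈ Q, ¬ Touches G L p)
    (hT : IsTail G a b (y :: r) 1) (hTs : ∀ p ∈ y :: r, p ∈ Side S t d)
    (hTv : ∀ p ∈ y :: r, p ∉ S.MV t) (hr : ∀ p ∈ r, ¬ Touches G L p)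
    (hy : AttHead G L.reverse y) : False := by
  have hyr : y ∉ r := hT.induced.1
  have sR : ∀ p ∈ l ++ [z], ∀ q ∈ y :: r, p ≠ q ∧ ¬ G.Adj p q := fun p hp q hq => by
    have := side_cross hJ hu hd hud (hR.side p hp) (hTs q hq)
    exact ⟨this.1, fun h => hTv q hq (this.2.1 h).2⟩
  have sQ : ∀ p ∈ Q, ∀ q ∈ y :: r, p ≠ q ∧ ¬ G.Adj p q := fun p hp q hq => by
    have := side_cross hJ hw hd hdw.symm (hQ.side p hp) (hTs q hq)
    exact ⟨this.1, fun h => hTv q hq (this.2.1 h).2⟩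
  have sL : ∀ f ∈ L, ∀ q ∈ y :: r, f ≠ q ∧ (G.Adj f q ↔ L.getLast? = some f ∧
      (y :: r).head? = some q) := fun f hf q hq => by
    refine ⟨fun e => hL.not_mem f hf (e ▸ side_subset_VM (hTs q hq)), ?_⟩
    have := hy.adj_iff (by simpa only [touches_reverse] using hr) hyr q hq f (by simpa using hf)
    rw [List.head?_reverse] at this
    rw [G.adj_comm, this, and_comm]
  have hcr := hQ.cross hJ hw hu huw.symm hR
  have e1 := hR.odd hG hJ hC hu hw huw hQ
  have e2 := hL.odd hG hC.1 (T₁ := [z]) ((hR.isTail hC).suffix (by simp)) hT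
    (by simpa using side_subset_VM (hR.side z (by simp)))
    (fun p hp => side_subset_VM (hTs p hp)) (fun p hp => sR p (by simp_all))
    (hz.adj_iff (by simp) (by simp))
    (fun p hp f hf => by rw [G.adj_comm, (sL f hf p hp).2, and_comm])
  have i1 : InducedList G (Q.reverse ++ (l ++ [z])) := by
    refine (inducedList_append _ _).2 ⟨hQ.induced.reverse, hR.induced, fun p hp q hq => ?_⟩
    rw [List.getLast?_reverse]
    exact hcr p (by simpa using hp) q hq
  have i2 : InducedList G (L ++ y :: r) :=
    (inducedList_append _ _).2 ⟨hL.induced, hT.induced, sL⟩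
  have hVA : ∀ p ∈ Q.reverse ++ (l ++ [z]), p ∈ VM S := fun p hp => by
    rcases List.mem_append.1 hp with h | h
    · exact side_subset_VM (hQ.side p (List.mem_reverse.1 h))
    · exact side_subset_VM (hR.side p h)
  have i3 : InducedList G ((Q.reverse ++ (l ++ [z])) ++ (L ++ y :: r)) := by
    refine (inducedList_append _ _).2 ⟨i1, i2, fun p hp q hq => ?_⟩
    have e : (Q.reverse ++ (l ++ [z])).getLast? = some z := by
      rw [List.getLast?_append_of_ne_nil _ (by simp)]
      simp
    rw [e, List.head?_append_of_ne_nil _ hL.ne]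
    rcases List.mem_append.1 hq with h | h
    · refine ⟨fun e => hL.not_mem q h (e ▸ hVA p hp), ?_⟩
      by_cases hpz : z = p
      · subst hpz
        simpa using hz q h
      · have : ¬ G.Adj p q := fun hadj => by
          have ht : Touches G L p := ⟨q, h, hadj⟩
          simp only [List.mem_append, List.mem_reverse, List.mem_singleton] at hp
          rcases hp with h | h | h
          · exact hQu p h ht
          · exact hl p h ht
          · exact hpz h.symm
        simp [this, hpz]
    · have h1 : p ≠ q ∧ ¬ G.Adj p q := by
        rcases List.mem_append.1 hp with h' | h'
        · exact sQ p (List.mem_reverse.1 h') q h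
        · exact sR p h' q h
      refine ⟨h1.1, fun hadj => absurd hadj h1.2, fun h' => ?_⟩
      exact absurd (side_subset_VM (hTs q h)) (hL.not_mem q (List.mem_of_head? h'.2))
  have hhead : ((Q.reverse ++ (l ++ [z])) ++ (L ++ y :: r)).head? = Q.getLast? := by
    rw [List.append_assoc, List.head?_append_of_ne_nil _ (by simpa using hQ.ne), List.head?_reverse]
  have hlast : ((Q.reverse ++ (l ++ [z])) ++ (L ++ y :: r)).getLast? = (y :: r).getLast? := by
    rw [List.getLast?_append_of_ne_nil _ (by simp), List.getLast?_append_of_ne_nil _ (by simp)]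
  have hmem : ∀ q, q ∈ (Q.reverse ++ (l ++ [z])) ++ (L ++ y :: r) →
      q ∈ Q ∨ q ∈ l ++ [z] ∨ q ∈ L ∨ q ∈ y :: r := by
    intro q hq
    rcases List.mem_append.1 hq with h | h
    · rcases List.mem_append.1 h with h | h
      · exact Or.inl (List.mem_reverse.1 h)
      · exact Or.inr (Or.inl h)
    · exact Or.inr (Or.inr (List.mem_append.1 h))
  have hb : ∀ q ∈ (Q.reverse ++ (l ++ [z])) ++ (L ++ y :: r), q ≠ b ∧
      (G.Adj b q ↔ Q.getLast? = some q ∨ (y :: r).getLast? = some q) := by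
    intro q hq
    rcases hmem q hq with h | h | h | h
    · have := (hQ.isTail hC).adj_right q h
      have h' : (y :: r).getLast? ≠ some q := fun e =>
        (sQ q h q (List.mem_of_getLast? e)).1 rfl
      simpa [h'] using this
    · have := (hR.isTail hC).adj_right q h
      have h' : (y :: r).getLast? ≠ some q := fun e =>
        (sR q h q (List.mem_of_getLast? e)).1 rfl
      have h'' : Q.getLast? ≠ some q := fun e =>
        (hcr q (List.mem_of_getLast? e) q h).1 rfl
      simpa [h', h''] using this
    · have := hL.adj_right q h
      have h' : (y :: r).getLast? ≠ some q := fun e =>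
        (sL q h q (List.mem_of_getLast? e)).1 rfl
      have h'' : Q.getLast? ≠ some q := fun e =>
        hL.not_mem q h (side_subset_VM (hQ.side q (List.mem_of_getLast? e)))
      simpa [h', h''] using this
    · have := hT.adj_right q h
      have h'' : Q.getLast? ≠ some q := fun e =>
        (sQ q (List.mem_of_getLast? e) q h).1 rfl
      simpa [h''] using this
  have e3 := hG.odd_cycle (x := b) i3 (fun h => (hb b h).1 rfl) (by
      have := List.length_pos_iff.2 hL.ne
      simp only [List.length_append, List.length_cons]
      omega) (fun q hq => by rw [hhead, hlast]; exact (hb q hq).2)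
  simp only [List.length_append, List.length_cons, List.length_nil, List.length_reverse] at e1 e2 e3
  omega

/-- From a touched vertex, one can escape to `b` through a tail touching the link only at
its first vertex. -/
theorem exists_tail_right [Finite W] (hJ : J.IsTree) (hC : IsCrossEdge S a b α β)
    (hn : J.Adj n w) (hnl : ¬ IsLeaf J n) (hw : w ∉ α) (hy : y ∈ Side S n w) (hyn : y ∉ S.MV n)
    (hya : ¬ G.Adj a y) (hyt : Touches G L y) : ∃ z T, IsTail G a b (z :: T) 1 ∧ (∀ p ∈ z :: T, p ∈ Side S n w) ∧
      (∀ p ∈ z :: T, p ∉ S.MV n) ∧ Touches G L z ∧ ∀ p ∈ T, ¬ Touches G L p := by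
  have hA := hJ.isAcyclic
  obtain ⟨t, t', hB, hyE⟩ := exists_beyond hJ hn hy
  have htt := hB.adj.2
  have htl := hB.not_isLeaf hA S hnl
  have key : ∀ {Q : List V} {x : V}, IsExit S a b n w Q 1 → x ∈ Q → Touches G L x → x ∉ S.MV n →
      ∃ z T, IsTail G a b (z :: T) 1 ∧ (∀ p ∈ z :: T, p ∈ Side S n w) ∧
      (∀ p ∈ z :: T, p ∉ S.MV n) ∧ Touches G L z ∧ ∀ p ∈ T, ¬ Touches G L p := by
    intro Q x hQ hx hxt hxn
    obtain ⟨l, z, r, rfl, hz, hr, hv⟩ := hQ.exists_last hx hxt hxn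
    exact ⟨z, r, (hQ.isTail hC).suffix (by simp),
      fun p hp => hQ.side p (List.mem_append_right _ hp), hv, hz, hr⟩
  by_cases ht' : t' ∈ α
  · have htn : t ≠ n := fun e => by
      rcases hB.eq_or hA S with h | h
      · exact hw (h.2 ▸ ht')
      · exact h.1 e
    obtain ⟨s, hs, hst, hsB⟩ := hB.exists_back hA S htn
    obtain ⟨w', hw', hw't, hw's⟩ := exists_adj_ne_ne (hC.2.2.2.1 t) htt hs hst.symm
    have hw'α : w' ∉ α := fun h => hw't (hC.2.2.2.2.2.1 t w' t' h ht' hw' htt)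
    have hB' := hsB w' hw' hw's
    obtain ⟨p₀, hp₀, -⟩ := exists_mem_ME_inter (S := S) hw'
    obtain ⟨Q, hQ, -⟩ := exists_exit_right hA hC hw' htl hw'α hp₀
    have hv' : ∀ p ∈ Side S t w', p ∉ S.MV n := by
      rcases hB'.eq_or hA S with h | h
      · exact absurd h.1 htn
      · exact h.2
    have hvt : ∀ p ∈ Side S t t', p ∉ S.MV n := by
      rcases hB.eq_or hA S with h | h
      · exact absurd h.1 htn
      · exact h.2
    by_cases hQt : ∃ p ∈ Q, Touches G L p
    · obtain ⟨p, hp, hpt⟩ := hQt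
      obtain ⟨l, hE⟩ := hB'.exists_exit hA hC hnl hQ
      exact key hE (List.mem_append_right _ hp) hpt (hv' p (hQ.side p hp))
    · push Not at hQt
      obtain ⟨R, hR, hyR⟩ := exists_exit_of_leaf hC htt htl ht' hyE
      obtain ⟨l, z, r, rfl, hz, hl⟩ := EHF.exists_first (P := Touches G L) hyR hyt
      have hr : r ≠ [] := by
        rintro rfl
        have hlast := (hR.adj_left y hyR).not.1 hya
        rcases List.mem_append.1 hyR with h | h
        · exact hl y h hyt
        · rw [List.mem_singleton] at h
          subst h
          simp at hlast
      have hform : (l ++ [z]) ++ r = l ++ z :: r := by simp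
      have hsub : ∀ q ∈ (l ++ [z]).reverse, q ∈ l ++ z :: r := fun q hq => by
        rw [← hform]
        exact List.mem_append_left r (List.mem_reverse.1 hq)
      have hT := hR.isTail hC
      rw [← hform] at hT
      obtain ⟨p1, p2, p3⟩ := hT.init_part hr
      have := (hQ.isTail hC).append p1.reverse (fun q hq => p2 q (List.mem_reverse.1 hq))
        (fun q hq => p3 q (List.mem_reverse.1 hq)) (by
          intro p hp q hq
          rw [List.getLast?_reverse]
          have e : (l ++ [z]).head? = (l ++ z :: r).head? := by cases l <;> simp
          rw [e]
          exact hR.cross hA htt hw' hw't.symm hQ p (hsub p hp) q hq)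
      have e : (l ++ [z]).reverse ++ Q = z :: (l.reverse ++ Q) := by simp
      have hcase : ∀ p ∈ z :: (l.reverse ++ Q), p ∈ Side S t t' ∨ p ∈ Side S t w' := by
        intro p hp
        rw [← e] at hp
        rcases List.mem_append.1 hp with h | h
        · exact Or.inl (hR.side p (hsub p h))
        · exact Or.inr (hQ.side p h)
      refine ⟨z, l.reverse ++ Q, e ▸ this, fun p hp => ?_, fun p hp => ?_, hz, fun p hp => ?_⟩
      · exact (hcase p hp).elim (fun h => hB.side_subset hA h) fun h => hB'.side_subset hA h
      · exact (hcase p hp).elim (hvt p) (hv' p)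
      · rcases List.mem_append.1 hp with h | h
        · exact hl p (List.mem_reverse.1 h)
        · exact hQt p h
  · obtain ⟨Q, hQ, hyQ⟩ := exists_exit_right hA hC htt htl ht' hyE
    obtain ⟨l, hE⟩ := hB.exists_exit hA hC hnl hQ
    exact key hE (List.mem_append_right _ hyQ) hyt hyn

theorem IsLink.not_exit_deep_of_not_adj [Finite W] (hG : EvenHoleFree G) (hJ : J.IsTree)
    (hC : IsCrossEdge S a b α β) (hL : IsLink S a b L)
    (hu : J.Adj t u) (hd : J.Adj t d) (hw : J.Adj t w) (hud : u ≠ d) (huw : u ≠ w) (hdw : d ≠ w)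
    (huα : u ∈ α) (hR : IsExit S a b t u (l ++ [z]) 0) (hl : ∀ p ∈ l, ¬ Touches G L p)
    (hz : Touches G L z) (hQ : IsExit S a b t w Q 1)
    (hQt : (∀ p ∈ Q, ¬ Touches G L p) ∨
      ∃ m x, Q = m ++ [x] ∧ Touches G L x ∧ ∀ p ∈ m, ¬ Touches G L p)
    (hy : y ∈ Side S t d) (hyt : y ∉ S.MV t) (hya : ¬ G.Adj a y) : ¬ Touches G L y := by
  intro hyT
  have hA := hJ.isAcyclic
  have htl := not_isLeaf_of_ne hu hd hud
  have hdα : d ∉ α := fun h => hud (hC.2.2.2.2.2.1 t u d huα h hu hd)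
  obtain ⟨y', T, hT, hTs, hTv, hy'T, hTu⟩ := exists_tail_right hJ hC hd htl hdα hy hyt hya hyT
  have hzs := hR.side z (by simp)
  have hys := hTs y' (by simp)
  have key : ∀ L, IsLink S a b L → (∀ p ∈ l, ¬ Touches G L p) →
      ((∀ p ∈ Q, ¬ Touches G L p) ∨
        ∃ m x, Q = m ++ [x] ∧ Touches G L x ∧ ∀ p ∈ m, ¬ Touches G L p) →
      (∀ p ∈ T, ¬ Touches G L p) → AttHead G L z → AttHead G L.reverse y' → False := by
    intro L hL hl hQt hTu az ay
    rcases hQt with hQt | ⟨m, x, rfl, hx, -⟩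
    · exact hL.not_exit_exit_tail hG hA hC hu hd hw hud huw hdw hR hl az hQ hQt hT hTs hTv hTu ay
    · have hxs := hQ.side x (by simp)
      have ax := hL.attHead (side_subset_VM hxs) (side_subset_VM hys)
        (not_localPair_of_side hA hw hd hdw.symm hxs hys fun _ => hTv _ (by simp)) hx ay
      have h2 : ∀ p ∈ y' :: T, ∀ f ∈ L, G.Adj p f ↔ (y' :: T).head? = some p ∧
          L.getLast? = some f := fun p hp f hf => by
        have := ay.adj_iff (by simpa only [touches_reverse] using hTu) hT.induced.1 p hp f
          (by simpa using hf)
        rwa [List.head?_reverse] at this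
      have e1 := hL.odd hG hC.1 (T₁ := [z]) ((hR.isTail hC).suffix (by simp)) hT
        (by simpa using side_subset_VM hzs) (fun p hp => side_subset_VM (hTs p hp))
        (fun p hp q hq => by
          rw [List.mem_singleton] at hp
          subst hp
          have := side_cross hA hu hd hud hzs (hTs q hq)
          exact ⟨this.1, fun h => hTv q hq (this.2.1 h).2⟩)
        (az.adj_iff (by simp) (by simp)) h2
      have e2 := hL.odd hG hC.1 (T₁ := [x]) ((hQ.isTail hC).suffix (by simp)) hT
        (by simpa using side_subset_VM hxs) (fun p hp => side_subset_VM (hTs p hp))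
        (fun p hp q hq => by
          rw [List.mem_singleton] at hp
          subst hp
          have := side_cross hA hw hd hdw.symm hxs (hTs q hq)
          exact ⟨this.1, fun h => hTv q hq (this.2.1 h).2⟩)
        (ax.adj_iff (by simp) (by simp)) h2
      simp only [List.length_cons, List.length_nil] at e1 e2
      omega
  rcases hL.attHead_or (side_subset_VM hzs) (side_subset_VM hys)
    (not_localPair_of_side hA hu hd hud hzs hys fun _ => hTv _ (by simp)) hz hy'T
    with ⟨h, h'⟩ | ⟨h, h'⟩
  · exact key L hL hl hQt hTu h h'
  · exact key L.reverse hL.reverse (by simpa only [touches_reverse] using hl)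
      (by simpa only [touches_reverse] using hQt) (by simpa only [touches_reverse] using hTu) h
      (by rwa [List.reverse_reverse])

theorem IsLink.not_exit_exit_head (hG : EvenHoleFree G) (hJ : J.IsAcyclic)
    (hC : IsCrossEdge S a b α β) (hL : IsLink S a b L)
    (hu : J.Adj t u) (hd : J.Adj t d) (hud : u ≠ d)
    (hR : IsExit S a b t u (l ++ [z]) 0) (hl : ∀ p ∈ l, ¬ Touches G L p)
    (hz : Touches G L z) (hzt : z ∉ S.MV t)
    (hQ : IsExit S a b t d (x :: r) 1) (hr : ∀ p ∈ r, ¬ Touches G L p) : ¬ Touches G L x := by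
  intro hx
  have hzs := hR.side z (by simp)
  have hxs := hQ.side x (by simp)
  have key : ∀ L, IsLink S a b L → (∀ p ∈ l, ¬ Touches G L p) →
      (∀ p ∈ r, ¬ Touches G L p) → AttHead G L z → AttHead G L.reverse x → False := by
    intro L hL hl hr az ax
    have e1 := hL.odd hG hC.1 (T₁ := [z]) ((hR.isTail hC).suffix (by simp)) (hQ.isTail hC)
      (by simpa using side_subset_VM hzs) (fun p hp => side_subset_VM (hQ.side p hp))
      (fun p hp q hq => by
        rw [List.mem_singleton] at hp
        subst hp
        have := side_cross hJ hu hd hud hzs (hQ.side q hq)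
        exact ⟨this.1, fun h => hzt (this.2.1 h).1⟩)
      (az.adj_iff (by simp) (by simp)) (fun p hp f hf => by
        have := ax.adj_iff (by simpa only [touches_reverse] using hr) hQ.induced.1 p hp f
          (by simpa using hf)
        rwa [List.head?_reverse] at this)
    have e2 := hR.odd hG hJ hC hu hd hud hQ
    have hpos := List.length_pos_iff.2 hL.ne
    have hl' : l ≠ [] := by
      rintro rfl
      exact hzt ((hR.head z (by simp)).2 (by simp))
    have hpos' := List.length_pos_iff.2 hl'
    have e3 := hL.odd_of_prefixes hG hJ hu hd hud hR (s := []) hQ hl (by simp) az ax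
      (by simp only [List.length_nil]; omega)
    simp only [List.length_cons, List.length_nil, List.length_append] at e1 e2 e3
    omega
  rcases hL.attHead_or (side_subset_VM hzs) (side_subset_VM hxs)
    (not_localPair_of_side hJ hu hd hud hzs hxs fun h => absurd h hzt) hz hx
    with ⟨h, h'⟩ | ⟨h, h'⟩
  · exact key L hL hl hr h h'
  · exact key L.reverse hL.reverse (by simpa only [touches_reverse] using hl)
      (by simpa only [touches_reverse] using hr) h (by rwa [List.reverse_reverse])

theorem IsLink.not_exit_exit_last (hG : EvenHoleFree G) (hJ : J.IsAcyclic)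
    (hC : IsCrossEdge S a b α β) (hL : IsLink S a b L)
    (hu : J.Adj t u) (hd : J.Adj t d) (hud : u ≠ d)
    (hR : IsExit S a b t u (l ++ [z]) 0) (hl : ∀ p ∈ l, ¬ Touches G L p)
    (hz : Touches G L z)
    (hQ : IsExit S a b t d (r ++ [x]) 0) (hr : ∀ p ∈ r, ¬ Touches G L p)
    (hxt : x ∉ S.MV t) : ¬ Touches G L x := by
  intro hx
  have hzs := hR.side z (by simp)
  have hxs := hQ.side x (by simp)
  have key : ∀ L, IsLink S a b L → (∀ p ∈ l, ¬ Touches G L p) →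
      (∀ p ∈ r, ¬ Touches G L p) → AttHead G L z → AttHead G L.reverse x → False := by
    intro L hL hl hr az ax
    have e1 := hL.odd hG hC.1 (T₁ := [z]) (T₂ := [x]) ((hR.isTail hC).suffix (by simp))
      ((hQ.isTail hC).suffix (by simp))
      (by simpa using side_subset_VM hzs) (by simpa using side_subset_VM hxs)
      (fun p hp q hq => by
        rw [List.mem_singleton] at hp hq
        subst hp hq
        have := side_cross hJ hu hd hud hzs hxs
        exact ⟨this.1, fun h => hxt (this.2.1 h).2⟩)
      (az.adj_iff (by simp) (by simp)) (fun p hp f hf => by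
        have := ax.adj_iff (T := []) (by simp) (by simp) p hp f (by simpa using hf)
        rwa [List.head?_reverse] at this)
    have e2 := hR.odd hG hJ hC hu hd hud hQ
    have hpos := List.length_pos_iff.2 hL.ne
    have hr' : r ≠ [] := by
      rintro rfl
      exact hxt ((hQ.head x (by simp)).2 (by simp))
    have hpos' := List.length_pos_iff.2 hr'
    have e3 := hL.odd_of_prefixes hG hJ hu hd hud hR hQ hl hr az ax (by omega)
    simp only [List.length_cons, List.length_nil, List.length_append] at e1 e2 e3
    omega
  rcases hL.attHead_or (side_subset_VM hzs) (side_subset_VM hxs)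
    (not_localPair_of_side hJ hu hd hud hzs hxs fun _ => hxt) hz hx
    with ⟨h, h'⟩ | ⟨h, h'⟩
  · exact key L hL hl hr h h'
  · exact key L.reverse hL.reverse (by simpa only [touches_reverse] using hl)
      (by simpa only [touches_reverse] using hr) h (by rwa [List.reverse_reverse])

theorem isRungList_singleton (hx : x ∈ S.ME t d) (hxt : x ∈ S.MV t) (hxd : x ∈ S.MV d) :
    IsRungList S t d [x] :=
  ⟨by simp [InducedList], by simp, by simpa using hx, by simpa using hxt, by simpa using hxd⟩

/-- If an exit towards a neighbour of `a` touches the link only at its last vertex, then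
there is no deep touched vertex in another direction. -/
theorem IsLink.not_exit_deep [Finite W] (hG : EvenHoleFree G) (hJ : J.IsTree)
    (hC : IsCrossEdge S a b α β) (hL : IsLink S a b L)
    (hu : J.Adj t u) (hd : J.Adj t d) (hw : J.Adj t w) (hud : u ≠ d) (huw : u ≠ w) (hdw : d ≠ w)
    (huα : u ∈ α) (hR : IsExit S a b t u (l ++ [z]) 0) (hl : ∀ p ∈ l, ¬ Touches G L p)
    (hz : Touches G L z) (hQ : IsExit S a b t w Q 1)
    (hQt : (∀ p ∈ Q, ¬ Touches G L p) ∨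
      ∃ m x, Q = m ++ [x] ∧ Touches G L x ∧ ∀ p ∈ m, ¬ Touches G L p)
    (hy : y ∈ Side S t d) (hyt : y ∉ S.MV t) : ¬ Touches G L y := by
  intro hyT
  have hA := hJ.isAcyclic
  have htl := not_isLeaf_of_ne hu hd hud
  have haux : ∀ p ∈ Side S t d, p ∉ S.MV t → ¬ G.Adj a p → ¬ Touches G L p :=
    fun p hp hpt hpa => hL.not_exit_deep_of_not_adj hG hJ hC hu hd hw hud huw hdw huα hR hl hz hQ
      hQt hp hpt hpa
  have hya : G.Adj a y := by
    by_contra h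
    exact haux y hy hyt h hyT
  obtain ⟨n, n', hB, hyE⟩ := exists_beyond hJ hd hy
  have hnn := hB.adj.2
  have hnl := hB.not_isLeaf hA S htl
  have hn' : n' ∈ α := by
    rcases (hC.adj_left_iff hnn hyE).1 hya with h | h
    · exact absurd (hC.leaf_iff.2 (Or.inl h.1)) hnl
    · exact h.1
  have hnt : n ≠ t := by
    intro e
    rcases hB.eq_or hA S with h | h
    · exact hud (hC.2.2.2.2.2.1 t u d huα (h.2 ▸ hn') hu hd)
    · exact h.1 e
  obtain ⟨s, hs, hsn', hsB⟩ := hB.exists_back hA S hnt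
  obtain ⟨w', hw', hw'n', hw's⟩ := exists_adj_ne_ne (hC.2.2.2.1 n) hnn hs hsn'.symm
  have hw'α : w' ∉ α := fun h => hw'n' (hC.2.2.2.2.2.1 n w' n' h hn' hw' hnn)
  have hdeep : ∀ x, J.Adj n x → x ≠ s → ∀ p ∈ Side S n x, p ∈ Side S t d ∧ p ∉ S.MV t := by
    intro x hx hxs p hp
    refine ⟨(hsB x hx hxs).side_subset hA hp, ?_⟩
    rcases (hsB x hx hxs).eq_or hA S with h | h
    · exact absurd h.1 hnt
    · exact h.2 p hp
  obtain ⟨p₀, hp₀, -⟩ := exists_mem_ME_inter (S := S) hw'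
  obtain ⟨Q', hQ', -⟩ := exists_exit_right hA hC hw' hnl hw'α hp₀
  have hQ't : ∀ p ∈ Q', ¬ Touches G L p := fun p hp =>
    have h := hdeep w' hw' hw's p (hQ'.side p hp)
    haux p h.1 h.2 fun h => by simpa using (hQ'.adj_left p hp).1 h
  obtain ⟨R', hR', hyR'⟩ := exists_exit_of_leaf hC hnn hnl hn' hyE
  obtain ⟨l', rfl⟩ := List.getLast?_eq_some_iff.1 ((hR'.adj_left y hyR').1 hya).2
  have hl' : ∀ p ∈ l', ¬ Touches G L p := fun p hp =>
    have h := hdeep n' hnn hsn'.symm p (hR'.side p (by simp [hp]))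
    haux p h.1 h.2 fun h => by
      have e := ((hR'.adj_left p (by simp [hp])).1 h).2
      rw [List.getLast?_append_of_ne_nil _ (by simp)] at e
      exact (((inducedList_append _ _).1 hR'.induced).2.2 p hp p (List.mem_of_getLast? e)).1 rfl
  obtain ⟨P, hE⟩ := hB.exists_exit hA hC htl hR'
  rw [← List.append_assoc] at hE
  by_cases hPt : ∀ p ∈ P, ¬ Touches G L p
  · refine hL.not_exit_exit_last hG hA hC hu hd hud hR hl hz hE (fun p hp => ?_) hyt hyT
    exact (List.mem_append.1 hp).elim (hPt p) (hl' p)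
  · push Not at hPt
    obtain ⟨q, hqP, hqT⟩ := hPt
    have hqa : ¬ G.Adj a q := fun h => by
      have e := ((hE.adj_left q (by simp [hqP])).1 h).2
      rw [List.getLast?_append_of_ne_nil _ (by simp)] at e
      exact (((inducedList_append _ _).1 hE.induced).2.2 q (by simp [hqP]) q
        (List.mem_of_getLast? e)).1 rfl
    have hqs := hE.side q (by simp [hqP])
    have hqt : q ∈ S.MV t := by
      by_contra h
      exact haux q hqs h hqa hqT
    have haux' : ∀ p ∈ Side S n s, p ∉ S.MV n → ¬ G.Adj a p → ¬ Touches G L p :=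
      fun p hp hpt hpa => hL.not_exit_deep_of_not_adj hG hJ hC hnn hs hw' hsn'.symm hw'n'.symm
        hw's.symm hn' hR' hl' hyT hQ' (Or.inl hQ't) hp hpt hpa
    have hqn' : q ∈ Side S n s := by
      obtain ⟨x, hx, hqx⟩ := exists_mem_side hJ.connected (side_subset_VM hqs) n
      by_cases h : x = s
      · exact h ▸ hqx
      · exact absurd hqt (hdeep x hx h q hqx).2
    have hqn : q ∈ S.MV n := by
      by_contra h
      exact haux' q hqn' h hqa hqT
    have hqE := mem_ME_of_mem_side_of_mem_MV hA hd hqs hqt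
    obtain rfl : n = d := (eq_or_eq_of_mem_MV hd hqE hqn).resolve_left hnt
    obtain rfl : s = t := by
      by_contra h
      exact not_mem_side hA hs hd.symm h hqn' (ME_subset_side hd.symm (S.me_symm t n ▸ hqE))
    have h1 := (isRungList_singleton hqE hqt hqn).append_exit hA hC hd htl hw' hw's hQ'
    have h2 := (isRungList_singleton hqE hqt hqn).append_exit hA hC hd htl hnn hsn'.symm hR'
    by_cases hzt : z ∈ S.MV s
    · by_cases hyn : y ∈ S.MV n
      · have e1 := hR.induced.eq_singleton ((hR.head z (by simp)).1 hzt) (by simp)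
        have e2 := hR'.induced.eq_singleton ((hR'.head y hyR').1 hyn) (by simp)
        have := hR.odd hG hA hC hu hd hud h2
        rw [e1, e2] at this
        simp at this
      · have h3 := (isRungList_singleton (S.me_symm s n ▸ hqE) hqn hqt).append_exit hA hC hd.symm
          hnl hw hdw.symm hQ
        refine hL.not_exit_exit_head hG hA hC hnn hd.symm hsn'.symm hR' hl' hyT hyn h3
          (fun p hp => ?_) hqT
        exact haux' p (side_subset_side hA hd.symm hw hdw.symm (hQ.side p hp))
          (not_mem_MV_of_mem_side hA hd.symm hw hdw.symm (hQ.side p hp))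
          fun h => by simpa using (hQ.adj_left p hp).1 h
    · exact hL.not_exit_exit_head hG hA hC hu hd hud hR hl hz hzt h1 hQ't hqT

end Deep

section OneSide

variable {G : SimpleGraph V} {J : SimpleGraph W} {S : StripSystem G J} {a b : V}
  {α β : Set W} {u v w w₁ w₂ t t' : W} {x y z : V} {L Q : List V} {c : ℕ}

theorem IsExit.swap_sub (h : IsExit S a b v w Q c) : IsExit S b a v w Q (1 - c) := by
  have := h.lt
  refine ⟨by omega, h.induced, h.ne, h.side, h.head, fun q hq => ?_, fun q hq => ?_⟩
  · rw [h.adj_right q hq]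
    exact and_congr_left fun _ => by omega
  · rw [h.adj_left q hq]
    exact and_congr_left fun _ => by omega

theorem IsLink.swap (h : IsLink S a b L) : IsLink S b a L :=
  ⟨h.ne, h.induced, h.not_mem, h.adj_right, h.adj_left, h.pair⟩

theorem Beyond.mem_branch (hJ : J.IsAcyclic) (h : Beyond J v w t t') (ht : t ≠ v) :
    t ∈ Branch J v w := by
  induction h with
  | refl => exact absurd rfl ht
  | @step v w w' t t' h h' hne hb ih =>
    by_cases e : t = w
    · subst e
      exact self_mem_branch h
    · exact branch_subset hJ h h' hne (ih e)

/-- Every exit from `v` through `w` with a touched vertex outside `M_v` is touched only at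
its last vertex. -/
def OnlyLast (S : StripSystem G J) (a b : V) (L : List V) (v w : W) : Prop :=
  ∀ Q c, IsExit S a b v w Q c → (∃ p ∈ Q, Touches G L p ∧ p ∉ S.MV v) →
    ∃ l z, Q = l ++ [z] ∧ Touches G L z ∧ ∀ p ∈ l, ¬ Touches G L p

theorem OnlyLast.swap (h : OnlyLast S a b L v w) : OnlyLast S b a L v w :=
  fun Q _ hQ => h Q _ hQ.swap_sub

theorem IsLink.not_onlyLast [Finite W] (hG : EvenHoleFree G) (hJ : J.IsTree)
    (hC : IsCrossEdge S a b α β) (hL : IsLink S a b L)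
    (hw₁ : J.Adj v w₁) (hw₂ : J.Adj v w₂) (hne : w₁ ≠ w₂)
    (hx : x ∈ Side S v w₁) (hxv : x ∉ S.MV v) (hxt : Touches G L x)
    (hy : y ∈ Side S v w₂) (hyv : y ∉ S.MV v) (hyt : Touches G L y) :
    ¬ OnlyLast S a b L v w₁ := by
  intro hO
  have hA := hJ.isAcyclic
  have hv := not_isLeaf_of_ne hw₁ hw₂ hne
  have key : ∀ {a b α β}, IsCrossEdge S a b α β → IsLink S a b L → OnlyLast S a b L v w₁ →
      G.Adj a x → False := by
    intro a b α β hC hL hO hax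
    obtain ⟨t, t', hB, hxE⟩ := exists_beyond hJ hw₁ hx
    have htt := hB.adj.2
    have htl := hB.not_isLeaf hA S hv
    have ht' : t' ∈ α := by
      rcases (hC.adj_left_iff htt hxE).1 hax with h | h
      · exact absurd (hC.leaf_iff.2 (Or.inl h.1)) htl
      · exact h.1
    obtain ⟨R, hR, hxR⟩ := exists_exit_of_leaf hC htt htl ht' hxE
    obtain ⟨l, rfl⟩ := List.getLast?_eq_some_iff.1 ((hR.adj_left x hxR).1 hax).2
    obtain ⟨P, hE⟩ := hB.exists_exit hA hC hv hR
    obtain ⟨m, z, e, -, hm⟩ := hO _ _ hE ⟨x, by simp, hxt, hxv⟩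
    have hl : ∀ p ∈ l, ¬ Touches G L p := fun p hp => by
      rw [← List.append_assoc] at e
      have := congrArg List.dropLast e
      rw [List.dropLast_concat, List.dropLast_concat] at this
      exact hm p (this ▸ List.mem_append_right _ hp)
    by_cases htv : t = v
    · subst htv
      obtain rfl : t' = w₁ := by
        rcases hB.eq_or hA S with h | h
        · exact h.2
        · exact absurd rfl h.1
      obtain ⟨w₃, hw₃, h31, h32⟩ := exists_adj_ne_ne (hC.2.2.2.1 t) hw₁ hw₂ hne
      have hw₃α : w₃ ∉ α := fun h => h31 (hC.2.2.2.2.2.1 t w₃ t' h ht' hw₃ hw₁)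
      obtain ⟨p₀, hp₀, -⟩ := exists_mem_ME_inter (S := S) hw₃
      obtain ⟨Q, hQ, -⟩ := exists_exit_right hA hC hw₃ htl hw₃α hp₀
      refine hL.not_exit_deep hG hJ hC hw₁ hw₂ hw₃ hne h31.symm h32.symm ht' hR hl hxt hQ
        (Or.inl fun p hp => ?_) hy hyv hyt
      exact hL.not_three_sides hG hJ hC hw₁ hw₂ hw₃ hne h31.symm h32.symm hx hxv hxt hy hyv hyt
        (hQ.side p hp)
    · obtain ⟨s, hs, hst', hsB⟩ := hB.exists_back hA S htv
      obtain ⟨w', hw', hw't', hw's⟩ := exists_adj_ne_ne (hC.2.2.2.1 t) htt hs hst'.symm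
      have hw'α : w' ∉ α := fun h => hw't' (hC.2.2.2.2.2.1 t w' t' h ht' hw' htt)
      obtain ⟨p₀, hp₀, -⟩ := exists_mem_ME_inter (S := S) hw'
      obtain ⟨Q, hQ, -⟩ := exists_exit_right hA hC hw' htl hw'α hp₀
      have hys : y ∈ Side S t s := by
        obtain ⟨r, hr, hyr⟩ := exists_mem_side hJ.connected (side_subset_VM hy) t
        by_cases h : r = s
        · exact h ▸ hyr
        · exact absurd ((hsB r hr h).side_subset hA hyr) (not_mem_side hA hw₂ hw₁ hne.symm hy)
      have hyt' : y ∉ S.MV t := fun h => by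
        rcases eq_or_mem_branch_of_mem_MV hy h with h | h
        · exact htv h
        · exact hne (eq_of_mem_branch hA hw₁ hw₂ (hB.mem_branch hA htv) h)
      have hQ' : (∀ p ∈ Q, ¬ Touches G L p) ∨
          ∃ m x, Q = m ++ [x] ∧ Touches G L x ∧ ∀ p ∈ m, ¬ Touches G L p := by
        by_cases hQt : ∀ p ∈ Q, ¬ Touches G L p
        · exact Or.inl hQt
        · push Not at hQt
          obtain ⟨p, hp, hpt⟩ := hQt
          have hB' := hsB w' hw' hw's
          have hpv : p ∉ S.MV v := by
            rcases hB'.eq_or hA S with h | h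
            · exact absurd h.1 htv
            · exact h.2 p (hQ.side p hp)
          obtain ⟨P', hE'⟩ := hB'.exists_exit hA hC hv hQ
          obtain ⟨m, z, e, hz, hm⟩ := hO _ _ hE' ⟨p, List.mem_append_right _ hp, hpt, hpv⟩
          obtain ⟨k, z', rfl⟩ := (List.eq_nil_or_concat' Q).resolve_left hQ.ne
          rw [← List.append_assoc] at e
          have e1 := congrArg List.dropLast e
          have e2 := congrArg List.getLast? e
          rw [List.dropLast_concat, List.dropLast_concat] at e1
          simp only [List.getLast?_concat, Option.some.injEq] at e2
          exact Or.inr ⟨k, z', rfl, e2 ▸ hz, fun p hp => hm p (e1 ▸ List.mem_append_right _ hp)⟩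
      exact hL.not_exit_deep hG hJ hC htt hs hw' hst'.symm hw't'.symm hw's.symm ht' hR hl hxt hQ hQ'
        hys hyt' hyt
  obtain ⟨Q, c, hQ, hxQ⟩ := exists_exit hJ hC hw₁ hv hx
  obtain ⟨l, z, rfl, -, hl⟩ := hO Q c hQ ⟨x, hxQ, hxt, hxv⟩
  have hxz : x = z := by
    rcases List.mem_append.1 hxQ with h | h
    · exact absurd hxt (hl x h)
    · simpa using h
  subst hxz
  have hlast : (l ++ [x]).getLast? = some x := by simp
  by_cases hc : c = 0
  · exact key hC hL hO ((hQ.adj_left x hxQ).2 ⟨hc, hlast⟩)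
  · have := hQ.lt
    exact key hC.swap hL.swap hO.swap ((hQ.adj_right x hxQ).2 ⟨by omega, hlast⟩)

theorem exists_exit_of_not_onlyLast (h : ¬ OnlyLast S a b L v w) : ∃ l x r c,
    IsExit S a b v w (l ++ x :: r) c ∧ r ≠ [] ∧ (∀ z ∈ l, ¬ Touches G L z) ∧ Touches G L x ∧
      ∃ p ∈ l ++ x :: r, Touches G L p ∧ p ∉ S.MV v := by
  unfold OnlyLast at h
  push Not at h
  obtain ⟨Q, c, hQ, ⟨p, hp, hpt, hpv⟩, hno⟩ := h
  obtain ⟨l, x, r, rfl, hx, hl⟩ := EHF.exists_first (P := Touches G L) hp hpt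
  refine ⟨l, x, r, c, hQ, ?_, hl, hx, p, hp, hpt, hpv⟩
  rintro rfl
  obtain ⟨q, hq, hqt⟩ := hno l x rfl hx
  exact hl q hq hqt

/-- The touched vertices outside `M_v` lie in a single direction at `v`. -/
theorem IsLink.side_unique [Finite W] (hG : EvenHoleFree G) (hJ : J.IsTree)
    (hC : IsCrossEdge S a b α β) (hL : IsLink S a b L)
    (hw₁ : J.Adj v w₁) (hw₂ : J.Adj v w₂)
    (hx : x ∈ Side S v w₁) (hxv : x ∉ S.MV v) (hxt : Touches G L x)
    (hy : y ∈ Side S v w₂) (hyv : y ∉ S.MV v) (hyt : Touches G L y) : w₁ = w₂ := by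
  by_contra hne
  obtain ⟨l₁, x₁, r₁, c₁, h₁, hr₁, hl₁, hx₁, hp₁⟩ := exists_exit_of_not_onlyLast
    (hL.not_onlyLast hG hJ hC hw₁ hw₂ hne hx hxv hxt hy hyv hyt)
  obtain ⟨l₂, x₂, r₂, c₂, h₂, hr₂, hl₂, hx₂, hp₂⟩ := exists_exit_of_not_onlyLast
    (hL.not_onlyLast hG hJ hC hw₂ hw₁ (Ne.symm hne) hy hyv hyt hx hxv hxt)
  exact hL.not_two_exits hG hJ hC hw₁ hw₂ hne h₁ h₂ hr₁ hr₂ hl₁ hl₂ hx₁ hx₂ hp₁ hp₂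

/-- All touched vertices are near a single edge of `J`. -/
theorem IsLink.exists_edge [Finite W] (hG : EvenHoleFree G) (hJ : J.IsTree)
    (hC : IsCrossEdge S a b α β) (hL : IsLink S a b L) :
    ∃ u v, J.Adj u v ∧ ∀ p ∈ VM S, Touches G L p → p ∈ S.ME u v ∨ p ∈ S.MV u ∨ p ∈ S.MV v := by
  have hA := hJ.isAcyclic
  have : Nontrivial W := Finite.one_lt_card_iff_nontrivial.1 (by have := hC.2.2.2.2.1; omega)
  have hside : ∀ v, ∃ w, J.Adj v w ∧
      ∀ p ∈ VM S, Touches G L p → p ∈ S.MV v ∨ p ∈ Side S v w := by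
    intro v
    by_cases h : ∃ p ∈ VM S, Touches G L p ∧ p ∉ S.MV v
    · obtain ⟨p, hp, hpt, hpv⟩ := h
      obtain ⟨w, hw, hpw⟩ := exists_mem_side hJ.connected hp v
      refine ⟨w, hw, fun q hq hqt => or_iff_not_imp_left.2 fun hqv => ?_⟩
      obtain ⟨w', hw', hqw⟩ := exists_mem_side hJ.connected hq v
      obtain rfl := hL.side_unique hG hJ hC hw hw' hpw hpv hpt hqw hqv hqt
      exact hqw
    · push Not at h
      obtain ⟨z, hz⟩ := exists_ne v
      obtain ⟨w, hw, -⟩ := exists_mem_branch hJ.connected hz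
      exact ⟨w, hw, fun p hp hpt => Or.inl (h p hp hpt)⟩
  choose f hf hfX using hside
  obtain ⟨u, hu⟩ := Finite.exists_min fun v => (Branch J v (f v)).ncard
  have hfu : f (f u) = u := by
    by_contra h
    exact absurd (hu (f u)) (not_le.2 (branch_ncard_lt hA (hf u) (hf (f u)) h))
  refine ⟨u, f u, hf u, fun p hp hpt => ?_⟩
  rcases hfX u p hp hpt with h | h
  · exact Or.inr (Or.inl h)
  · rcases hfX (f u) p hp hpt with h' | h'
    · exact Or.inr (Or.inr h')
    · rw [hfu] at h'
      exact Or.inl (mem_ME_of_mem_side_swap hA (hf u) h h')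

theorem IsLink.touches_of_mem_MV [Finite W] (hG : EvenHoleFree G) (hJ : J.IsTree)
    (hC : IsCrossEdge S a b α β) (hL : IsLink S a b L) (huv : J.Adj u v)
    (hX : ∀ p ∈ VM S, Touches G L p → p ∈ S.ME u v ∨ p ∈ S.MV u ∨ p ∈ S.MV v)
    (hx : x ∈ VM S) (hxv : x ∉ S.MV v) (hxt : Touches G L x)
    (hy : y ∈ S.MV v) (hye : y ∉ S.ME u v) (hyt : Touches G L y)
    (hz : z ∈ S.MV v) (hze : z ∉ S.ME u v) : Touches G L z := by
  have hA := hJ.isAcyclic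
  have hxs : x ∈ Side S v u := by
    rcases hX x hx hxt with h | h | h
    · exact ME_subset_side huv.symm (S.me_symm u v ▸ h)
    · obtain ⟨r, hr, hxr⟩ := exists_mem_ME_of_mem_MV h
      by_cases hrv : r = v
      · exact ME_subset_side huv.symm (S.me_symm u v ▸ hrv ▸ hxr)
      · exact side_subset_side hA huv.symm hr hrv (ME_subset_side hr hxr)
    · exact absurd h hxv
  have hother : ∀ w, J.Adj v w → w ≠ u → ∀ p ∈ Side S v w, Touches G L p → p ∈ S.MV v := by
    intro w hw hwu p hp hpt
    rcases hX p (side_subset_VM hp) hpt with h | h | h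
    · exact absurd (ME_subset_side huv.symm (S.me_symm u v ▸ h)) (not_mem_side hA hw huv.symm hwu hp)
    · rcases eq_or_mem_branch_of_mem_MV hp h with h | h
      · exact absurd h huv.ne
      · exact absurd (eq_of_mem_branch hA hw huv.symm h (self_mem_branch huv.symm)) hwu
    · exact h
  have core : ∀ w w' y z, J.Adj v w → J.Adj v w' → w ≠ u → w' ≠ u → w ≠ w' → y ∈ S.ME v w →
      y ∈ S.MV v → Touches G L y → z ∈ S.ME v w' → z ∈ S.MV v → Touches G L z := by
    intro w w' y z hw hw' hwu hw'u hne hyE hy hyt hzE hz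
    by_contra hzt
    have hv := not_isLeaf_of_ne hw hw' hne
    have hunt : ∀ {a b Q c}, IsExit S a b v w' Q c → z ∈ Q → ∀ p ∈ Q, ¬ Touches G L p := by
      intro a b Q c hQ hzQ p hp hpt
      have e1 := (hQ.head p hp).1 (hother w' hw' hw'u p (hQ.side p hp) hpt)
      have e2 := (hQ.head z hzQ).1 hz
      rw [e1, Option.some.injEq] at e2
      exact hzt (e2 ▸ hpt)
    obtain ⟨Q₁, c₁, h₁, hx₁⟩ := exists_exit hJ hC huv.symm hv hxs
    obtain ⟨Q₂, c₂, h₂, hy₂⟩ := exists_exit hJ hC hw hv (ME_subset_side hw hyE)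
    obtain ⟨Q₃, c₃, h₃, hz₃⟩ := exists_exit hJ hC hw' hv (ME_subset_side hw' hzE)
    obtain ⟨l, x', r, rfl, hx't, hr, hrv⟩ := h₁.exists_last hx₁ hxt hxv
    obtain ⟨s, rfl⟩ := List.head?_eq_some_iff.1 ((h₂.head y hy₂).1 hy)
    have hs : ∀ p ∈ s, ¬ Touches G L p := fun p hp hpt => by
      have e1 := (h₂.head p (by simp [hp])).1
        (hother w hw hwu p (h₂.side p (by simp [hp])) hpt)
      rw [List.head?_cons, Option.some.injEq] at e1
      exact h₂.induced.1 (e1 ▸ hp)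
    by_cases hs0 : s = []
    · subst hs0
      have key : ∀ {a b α β}, IsCrossEdge S a b α β → IsLink S a b L →
          IsExit S a b v w [y] 0 → False := by
        intro a b α β hC hL hE
        have hwα : w ∈ α := by
          rcases (hC.adj_left_iff hw hyE).1 ((hE.adj_left y (by simp)).2 (by simp)) with h | h
          · exact absurd (hC.leaf_iff.2 (Or.inl h.1)) hv
          · exact h.1
        have hw'α : w' ∉ α := fun h => hne (hC.2.2.2.2.2.1 v w w' hwα h hw hw')
        obtain ⟨Q, hQ, hzQ⟩ := exists_exit_right hA hC hw' hv hw'α hzE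
        exact hL.not_exit_deep hG hJ hC (l := []) hw huv.symm hw' hwu hne hw'u.symm hwα hE (by simp)
          hyt hQ (Or.inl (hunt hQ hzQ)) hxs hxv hxt
      have := h₂.lt
      by_cases hc : c₂ = 0
      · exact key hC hL (hc ▸ h₂)
      · have := h₂.swap_sub
        exact key hC.swap hL.swap (by rwa [show 1 - c₂ = 0 by omega] at this)
    · have key : ∀ L, IsLink S a b L → (∀ p ∈ r, ¬ Touches G L p) → (∀ p ∈ s, ¬ Touches G L p) →
          (∀ p ∈ Q₃, ¬ Touches G L p) → AttHead G L x' → AttHead G L.reverse y → False := by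
        intro L hL hr hs hQ₃ ax ay
        have e1 := hL.even_suffix_suffix hG hA hC huv.symm hw hwu.symm h₁ (s := []) h₂ hr hs
          (fun p hp q hq h => absurd h (hrv p hp)) ax ay
        have e2 := hL.reverse.even_prefix_suffix hG hA hC hw huv.symm hw' hwu hne hw'u.symm
          (l := []) h₂ h₁ h₃ (by simp) (by simpa only [touches_reverse] using hr)
          (by simpa only [touches_reverse] using hQ₃) hs0 hrv ay (by rwa [List.reverse_reverse])
        simp only [List.length_nil, List.length_reverse] at e1 e2
        omega
      have hxs' := h₁.side x' (by simp)
      have hys' := h₂.side y (by simp)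
      rcases hL.attHead_or (side_subset_VM hxs') (side_subset_VM hys')
        (not_localPair_of_side hA huv.symm hw hwu.symm hxs' hys'
          fun h => absurd h (hrv _ (by simp))) hx't hyt with ⟨h, h'⟩ | ⟨h, h'⟩
      · exact key L hL hr hs (hunt h₃ hz₃) h h'
      · exact key L.reverse hL.reverse (by simpa only [touches_reverse] using hr)
          (by simpa only [touches_reverse] using hs)
          (by simpa only [touches_reverse] using hunt h₃ hz₃) h (by rwa [List.reverse_reverse])
  obtain ⟨w, hw, hyw⟩ := exists_mem_ME_of_mem_MV hy
  obtain ⟨w', hw', hzw⟩ := exists_mem_ME_of_mem_MV hz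
  have hwu : w ≠ u := fun h => hye (S.me_symm v u ▸ h ▸ hyw)
  have hw'u : w' ≠ u := fun h => hze (S.me_symm v u ▸ h ▸ hzw)
  by_cases hne : w = w'
  · subst hne
    obtain ⟨w₃, hw₃, h3u, h3w⟩ := exists_adj_ne_ne (hC.2.2.2.1 v) huv.symm hw hwu.symm
    obtain ⟨p, hpE, hpv⟩ := exists_mem_ME_inter (S := S) hw₃
    have hpt := core w w₃ y p hw hw₃ hwu h3u h3w.symm hyw hy hyt hpE hpv
    exact core w₃ w p z hw₃ hw h3u hwu h3w hpE hpv hpt hzw hz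
  · exact core w w' y z hw hw' hwu hw'u hne hyw hy hyt hzw hz

end OneSide

section Extension

variable {G : SimpleGraph V} {J : SimpleGraph W} {S : StripSystem G J} {a b : V}
  {α β : Set W} {u v : W}

theorem isStrip_of_lists {E P Q : Set V} (hP : (E ∩ P).Nonempty) (hQ : (E ∩ Q).Nonempty)
    (h : ∀ f ∈ E, ∃ R, InducedList G R ∧ f ∈ R ∧ (∀ q ∈ R, q ∈ E) ∧
      (∀ q ∈ R, q ∈ P ↔ R.head? = some q) ∧ (∀ q ∈ R, q ∈ Q ↔ R.getLast? = some q)) :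
    IsStrip G (E ∩ P) (E ∩ Q) (E \ (P ∪ Q)) := by
  refine ⟨hP, hQ, Set.disjoint_left.2 fun x hx hx' => hx'.2 (Or.inl hx.2),
    Set.disjoint_left.2 fun x hx hx' => hx'.2 (Or.inr hx.2), fun f hf => ?_⟩
  obtain ⟨R, hR, hfR, hE, h1, h2⟩ := h f (by
    rcases hf with (hf | hf) | hf
    exacts [hf.1, hf.1, hf.1])
  have hne : R ≠ [] := List.ne_nil_of_mem hfR
  have e1 := List.head?_eq_some_head hne
  have e2 := List.getLast?_eq_some_getLast hne
  obtain ⟨T, hT, hI, hs⟩ := hR.exists_walk e1 e2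
  have m1 := List.head_mem hne
  have m2 := List.getLast_mem hne
  refine ⟨_, _, T, ⟨hT, ⟨hE _ m1, (h1 _ m1).2 e1⟩, ⟨hE _ m2, (h2 _ m2).2 e2⟩, ?_, ?_, hI⟩,
    by rwa [hs]⟩
  · intro q hq hq1 hq2
    rw [hs] at hq
    refine ⟨hE q hq, ?_⟩
    rintro (h | h)
    · exact hq1 (Option.some.inj (((h1 q hq).1 h).symm.trans e1))
    · exact hq2 (Option.some.inj (((h2 q hq).1 h).symm.trans e2))
  · intro hne'
    exact ⟨fun h => hne' (Option.some.inj (((h2 _ m1).1 h.2).symm.trans e2)),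
      fun h => hne' (Option.some.inj (((h1 _ m2).1 h.2).symm.trans e1)).symm⟩

/-- A strip system can be enlarged by adding a set `F` to the strip of one edge `uv`. -/
theorem IsCrossEdge.exists_extension (hC : IsCrossEdge S a b α β) (huv : J.Adj u v)
    {F : Set V} {A : W → Set V} (hF : ∀ f ∈ F, f ∉ VM S) (ha : ∀ f ∈ F, f ≠ a ∧ ¬ G.Adj a f)
    (hb : ∀ f ∈ F, f ≠ b ∧ ¬ G.Adj b f) (hAF : ∀ x, A x ⊆ F)
    (hA : ∀ x, ∀ f ∈ A x, (x = u ∨ x = v) ∧ ¬ IsLeaf J x)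
    (hadj : ∀ f ∈ F, ∀ q ∈ VM S, q ∉ S.ME u v → (G.Adj f q ↔ ∃ x, f ∈ A x ∧ q ∈ S.MV x))
    (hR : ∀ f ∈ F, ∃ R, InducedList G R ∧ f ∈ R ∧ (∀ q ∈ R, q ∈ S.ME u v ∨ q ∈ F) ∧
      (∀ q ∈ R, (q ∈ S.MV u ∨ q ∈ A u) ↔ R.head? = some q) ∧
      (∀ q ∈ R, (q ∈ S.MV v ∨ q ∈ A v) ↔ R.getLast? = some q)) :
    ∃ S' : StripSystem G J, IsCrossEdge S' a b α β ∧ VM S' = VM S ∪ F := by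
  have hFV : ∀ f ∈ F, ∀ x, f ∉ S.MV x := fun f hf x h => hF f hf (mem_VM_of_mem_MV h)
  have hFE : ∀ f ∈ F, ∀ x y, J.Adj x y → f ∉ S.ME x y :=
    fun f hf x y h h' => hF f hf (mem_VM.2 ⟨x, y, h, h'⟩)
  have hVA : ∀ p ∈ VM S, ∀ x, p ∉ A x := fun p hp x h => hF p (hAF x h) hp
  let ME : W → W → Set V := fun x y => S.ME x y ∪ {f | f ∈ F ∧ s(x, y) = s(u, v)}
  let MV : W → Set V := fun x => S.MV x ∪ A x
  have hMV : ∀ p ∈ VM S, ∀ x, p ∈ MV x ↔ p ∈ S.MV x := fun p hp x => by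
    simp [MV, hVA p hp x]
  have hMVF : ∀ p ∈ F, ∀ x, p ∈ MV x ↔ p ∈ A x := fun p hp x => by
    simp [MV, hFV p hp x]
  have me_symm : ∀ x y, ME x y = ME y x := fun x y => by
    simp only [ME, S.me_symm x y, Sym2.eq_swap (a := x)]
  have hAe : ∀ x y, s(x, y) = s(u, v) → ∀ f t, f ∈ A t → t = x ∨ t = y := by
    intro x y e f t hf
    have : t ∈ s(u, v) := Sym2.mem_iff.2 (hA t f hf).1
    rwa [← e, Sym2.mem_iff] at this
  have hEin : ∀ x y, J.Adj x y → (S.ME x y ∩ S.MV x).Nonempty := fun x y h => by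
    obtain ⟨p, hp⟩ := exists_mem_ME_inter (S := S) h
    exact ⟨p, hp⟩
  have key : ∀ x y w, J.Adj x y → J.Adj x w → y ≠ w → s(x, y) = s(u, v) → ∀ p ∈ F,
      ∀ q ∈ S.ME x w, (G.Adj p q ↔ p ∈ MV x ∧ q ∈ MV x) := by
    intro x y w h h' hne e p hp q hq
    have hqV := mem_VM.2 ⟨x, w, h', hq⟩
    rw [hadj p hp q hqV, hMVF p hp, hMV q hqV]
    · constructor
      · rintro ⟨t, ht, hqt⟩
        rcases hAe x y e p t ht with rfl | rfl
        · exact ⟨ht, hqt⟩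
        · rcases eq_or_eq_of_mem_MV h' hq hqt with rfl | rfl
          · exact absurd h (J.loopless.irrefl _)
          · exact absurd rfl hne
      · exact fun h => ⟨x, h⟩
    · intro hq'
      have := edge_eq_of_mem_ME h' huv hq hq'
      rw [← e] at this
      exact hne (Sym2.congr_right.1 this).symm
  have keyfar : ∀ x y w z, J.Adj x y → J.Adj w z → x ≠ w → x ≠ z → y ≠ w → y ≠ z →
      s(x, y) = s(u, v) → ∀ p ∈ F, ∀ q ∈ S.ME w z, ¬ G.Adj p q := by
    intro x y w z h h' h1 h2 h3 h4 e p hp q hq hpq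
    have hqV := mem_VM.2 ⟨w, z, h', hq⟩
    rw [hadj p hp q hqV] at hpq
    · obtain ⟨t, ht, hqt⟩ := hpq
      have e1 := hAe x y e p t ht
      have e2 := eq_or_eq_of_mem_MV h' hq hqt
      grind
    · intro hq'
      have := edge_eq_of_mem_ME h' huv hq hq'
      rw [← e, Sym2.eq_iff] at this
      grind
  have lists : ∀ f ∈ ME u v, ∃ R, InducedList G R ∧ f ∈ R ∧ (∀ q ∈ R, q ∈ ME u v) ∧
      (∀ q ∈ R, q ∈ MV u ↔ R.head? = some q) ∧ (∀ q ∈ R, q ∈ MV v ↔ R.getLast? = some q) := by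
    rintro f (hf | ⟨hf, -⟩)
    · obtain ⟨R, hR', hfR⟩ := exists_rungList huv hf
      have hV : ∀ q ∈ R, q ∈ VM S := fun q hq => mem_VM.2 ⟨u, v, huv, hR'.mem q hq⟩
      exact ⟨R, hR'.induced, hfR, fun q hq => Or.inl (hR'.mem q hq),
        fun q hq => (hMV q (hV q hq) u).trans (hR'.head q hq),
        fun q hq => (hMV q (hV q hq) v).trans (hR'.last q hq)⟩
    · obtain ⟨R, h1, h2, h3, h4, h5⟩ := hR f hf
      exact ⟨R, h1, h2, fun q hq => (h3 q hq).imp id fun h => ⟨h, rfl⟩, h4, h5⟩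
  have sub : ∀ x y, S.ME x y ⊆ ME x y := fun x y => Set.subset_union_left
  have ne : ∀ x y, J.Adj x y → (ME x y ∩ MV x).Nonempty := fun x y h => by
    obtain ⟨p, hp, hp'⟩ := hEin x y h
    exact ⟨p, sub _ _ hp, Or.inl hp'⟩
  have strip : ∀ x y, J.Adj x y →
      IsStrip G (ME x y ∩ MV x) (ME x y ∩ MV y) (ME x y \ (MV x ∪ MV y)) := by
    intro x y h
    have ney : (ME x y ∩ MV y).Nonempty := by rw [me_symm]; exact ne y x h.symm
    by_cases e : s(x, y) = s(u, v)
    · refine isStrip_of_lists (ne x y h) ney ?_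
      rcases Sym2.eq_iff.1 e with ⟨rfl, rfl⟩ | ⟨rfl, rfl⟩
      · exact lists
      · intro f hf
        rw [me_symm] at hf ⊢
        obtain ⟨R, h1, h2, h3, h4, h5⟩ := lists f hf
        exact ⟨R.reverse, h1.reverse, by simpa using h2, by simpa using h3,
          by simpa using h5, by simpa using h4⟩
    · have hE : ME x y = S.ME x y :=
        Set.ext fun p => ⟨fun h => h.elim id fun h => absurd h.2 e, Or.inl⟩
      have hi : ∀ t, S.ME x y ∩ MV t = S.ME x y ∩ S.MV t := fun t => by
        ext p
        exact and_congr_right fun hp => hMV p (mem_VM.2 ⟨x, y, h, hp⟩) t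
      have hd : S.ME x y \ (MV x ∪ MV y) = S.ME x y \ (S.MV x ∪ S.MV y) := by
        ext p
        refine and_congr_right fun hp => not_congr ?_
        have := hMV p (mem_VM.2 ⟨x, y, h, hp⟩)
        exact or_congr (this x) (this y)
      rw [hE, hi, hi, hd]
      exact S.strip x y h
  let S' : StripSystem G J :=
    { ME := ME
      MV := MV
      me_symm := me_symm
      me_disj := by
        intro x y w z h h' hne
        rw [Set.disjoint_left]
        rintro p (hp | ⟨hp, e⟩) (hq | ⟨hq, e'⟩)
        · exact Set.disjoint_left.1 (S.me_disj x y w z h h' hne) hp hq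
        · exact hFE p hq x y h hp
        · exact hFE p hp w z h' hq
        · exact hne (e.trans e'.symm)
      mv_sub := by
        rintro x p (hp | hp)
        · obtain ⟨y, h, hp⟩ := exists_mem_ME_of_mem_MV hp
          exact Set.mem_iUnion₂.2 ⟨y, h, Or.inl hp⟩
        · rcases (hA x p hp).1 with rfl | rfl
          · exact Set.mem_iUnion₂.2 ⟨v, huv, Or.inr ⟨hAF _ hp, rfl⟩⟩
          · exact Set.mem_iUnion₂.2 ⟨u, huv.symm, Or.inr ⟨hAF _ hp, Sym2.eq_swap⟩⟩
      strip := strip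
      far := by
        rintro x y w z h h' h1 h2 h3 h4 p (hp | ⟨hp, e⟩) q (hq | ⟨hq, e'⟩)
        · exact S.far x y w z h h' h1 h2 h3 h4 p hp q hq
        · exact fun hpq => keyfar w z x y h' h h1.symm h3.symm h2.symm h4.symm e' q hq p hp
            hpq.symm
        · exact keyfar x y w z h h' h1 h2 h3 h4 e p hp q hq
        · rw [← e', Sym2.eq_iff] at e
          grind
      near := by
        rintro x y w h h' hne p (hp | ⟨hp, e⟩) q (hq | ⟨hq, e'⟩)
        · rw [hMV p (mem_VM.2 ⟨x, y, h, hp⟩), hMV q (mem_VM.2 ⟨x, w, h', hq⟩)]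
          exact S.near x y w h h' hne p hp q hq
        · rw [G.adj_comm, key x w y h' h hne.symm e' q hq p hp, and_comm]
        · exact key x y w h h' hne e p hp q hq
        · exact absurd (Sym2.congr_right.1 (e.trans e'.symm)) hne }
  have hVM : VM S' = VM S ∪ F := by
    ext p
    constructor
    · intro hp
      obtain ⟨x, y, h, hp | hp⟩ := mem_VM.1 hp
      exacts [Or.inl (mem_VM.2 ⟨x, y, h, hp⟩), Or.inr hp.1]
    · rintro (hp | hp)
      · obtain ⟨x, y, h, hp⟩ := mem_VM.1 hp
        exact mem_VM.2 ⟨x, y, h, Or.inl hp⟩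
      · exact mem_VM.2 ⟨u, v, huv, Or.inr ⟨hp, rfl⟩⟩
  have hleaf : ∀ p ∈ F, ∀ x, IsLeaf J x → p ∉ MV x := fun p hp x hx h =>
    (hA x p ((hMVF p hp x).1 h)).2 hx
  refine ⟨S', ⟨hC.1, hC.2.1, hC.2.2.1, hC.2.2.2.1, hC.2.2.2.2.1, hC.2.2.2.2.2.1,
    hC.2.2.2.2.2.2.1, ?_, ?_, ?_⟩, hVM⟩
  · intro x y h
    have := hC.2.2.2.2.2.2.2.1 x y h
    exact ⟨fun h' => h'.elim this.1 fun h' => (ha a h'.1).1 rfl,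
      fun h' => h'.elim this.2 fun h' => (hb b h'.1).1 rfl⟩
  · intro p hp
    rcases hVM ▸ hp with hp | hp
    · rw [hC.2.2.2.2.2.2.2.2.1 p hp]
      exact exists_congr fun x => and_congr_right fun _ => (hMV p hp x).symm
    · exact iff_of_false (ha p hp).2 fun ⟨x, hx, h⟩ => hleaf p hp x (hC.leaf_iff.2 (Or.inl hx)) h
  · intro p hp
    rcases hVM ▸ hp with hp | hp
    · rw [hC.2.2.2.2.2.2.2.2.2 p hp]
      exact exists_congr fun x => and_congr_right fun _ => (hMV p hp x).symm
    · exact iff_of_false (hb p hp).2 fun ⟨x, hx, h⟩ => hleaf p hp x (hC.leaf_iff.2 (Or.inr hx)) h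

end Extension

section Enlarge

variable {G : SimpleGraph V} {J : SimpleGraph W} {S : StripSystem G J} {a b : V}
  {α β : Set W} {u v : W} {x y p q : V} {L : List V}

theorem not_mem_MV_of_not_mem_ME (h : J.Adj u v) (hv : p ∈ S.MV v) (he : p ∉ S.ME u v) :
    p ∉ S.MV u := by
  intro hu
  obtain ⟨w, hw, hp⟩ := exists_mem_ME_of_mem_MV hv
  rcases eq_or_eq_of_mem_MV hw hp hu with rfl | rfl
  · exact J.loopless.irrefl _ h
  · exact he (S.me_symm v u ▸ hp)

theorem exists_adj_of_not_mem_ME (hv : p ∈ S.MV v) (he : p ∉ S.ME u v) :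
    ∃ w, J.Adj v w ∧ w ≠ u ∧ p ∈ S.ME v w := by
  obtain ⟨w, hw, hp⟩ := exists_mem_ME_of_mem_MV hv
  refine ⟨w, hw, ?_, hp⟩
  rintro rfl
  exact he (S.me_symm v w ▸ hp)

theorem not_localPair_of_not_mem_ME (hJ : J.IsAcyclic) (h : J.Adj u v) (hx : x ∈ Side S v u)
    (hxv : x ∉ S.MV v) (hy : y ∈ S.MV v) (hye : y ∉ S.ME u v) : ¬ LocalPair S x y := by
  obtain ⟨w, hw, hwu, hp⟩ := exists_adj_of_not_mem_ME hy hye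
  exact not_localPair_of_side hJ h.symm hw hwu.symm hx (ME_subset_side hw hp)
    fun h => absurd h hxv

theorem IsLink.exists_larger_of_attached [Finite W] (hG : EvenHoleFree G) (hJ : J.IsTree)
    (hC : IsCrossEdge S a b α β) (hL : IsLink S a b L) (huv : J.Adj u v)
    (hX : ∀ p ∈ VM S, Touches G L p → p ∈ S.ME u v ∨ p ∈ S.MV u ∨ p ∈ S.MV v)
    (hx : x ∈ S.MV u) (hxe : x ∉ S.ME u v) (hxt : Touches G L x)
    (hy : y ∈ S.MV v) (hye : y ∉ S.ME u v) (hyt : Touches G L y) :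
    ∃ S' : StripSystem G J, IsCrossEdge S' a b α β ∧ VM S' = VM S ∪ {f | f ∈ L} := by
  have hA := hJ.isAcyclic
  have hn : ∀ x ∈ S.MV u, x ∉ S.ME u v → ∀ y ∈ S.MV v, y ∉ S.ME u v → ¬ LocalPair S x y := by
    intro x hx hxe y hy hye
    refine not_localPair_of_not_mem_ME hA huv ?_
      (not_mem_MV_of_not_mem_ME huv.symm hx (by rwa [S.me_symm])) hy hye
    obtain ⟨w, hw, hwv, hp⟩ := exists_adj_of_not_mem_ME hx (by rwa [S.me_symm])
    exact side_subset_side hA huv.symm hw hwv (ME_subset_side hw hp)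
  have ht : ∀ z ∈ S.MV v, z ∉ S.ME u v → Touches G L z := fun z hz hze =>
    hL.touches_of_mem_MV hG hJ hC huv hX (mem_VM_of_mem_MV hx)
      (not_mem_MV_of_not_mem_ME huv.symm hx (by rwa [S.me_symm])) hxt hy hye hyt hz hze
  have hs : ∀ z ∈ S.MV u, z ∉ S.ME u v → Touches G L z := fun z hz hze =>
    hL.touches_of_mem_MV hG hJ hC huv.symm
      (fun p hp hpt => by rw [S.me_symm]; have := hX p hp hpt; tauto) (mem_VM_of_mem_MV hy)
      (not_mem_MV_of_not_mem_ME huv hy hye) hyt hx (by rwa [S.me_symm]) hxt hz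
      (by rwa [S.me_symm])
  suffices key : ∀ L : List V, IsLink S a b L →
      (∀ p ∈ VM S, Touches G L p → p ∈ S.ME u v ∨ p ∈ S.MV u ∨ p ∈ S.MV v) →
      (∀ z ∈ S.MV u, z ∉ S.ME u v → Touches G L z) →
      (∀ z ∈ S.MV v, z ∉ S.ME u v → Touches G L z) →
      AttHead G L x → AttHead G L.reverse y →
      ∃ S' : StripSystem G J, IsCrossEdge S' a b α β ∧ VM S' = VM S ∪ {f | f ∈ L} by
    rcases hL.attHead_or (mem_VM_of_mem_MV hx) (mem_VM_of_mem_MV hy) (hn x hx hxe y hy hye)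
      hxt hyt with ⟨h, h'⟩ | ⟨h, h'⟩
    · exact key L hL hX hs ht h h'
    · simpa using key L.reverse hL.reverse (by simpa only [touches_reverse] using hX)
        (by simpa only [touches_reverse] using hs) (by simpa only [touches_reverse] using ht) h
        (by rwa [List.reverse_reverse])
  clear hX hs ht hxt hyt hL
  intro L hL hX hs ht h h'
  have hu : ∀ z ∈ S.MV u, z ∉ S.ME u v → AttHead G L z := fun z hz hze =>
    hL.attHead (mem_VM_of_mem_MV hz) (mem_VM_of_mem_MV hy) (hn z hz hze y hy hye)
      (hs z hz hze) h'
  have hv : ∀ z ∈ S.MV v, z ∉ S.ME u v → AttHead G L.reverse z := fun z hz hze =>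
    hL.reverse.attHead (mem_VM_of_mem_MV hz) (mem_VM_of_mem_MV hx)
      (fun h => hn x hx hxe z hz hze h.symm) (touches_reverse.2 (ht z hz hze))
      (by rwa [List.reverse_reverse])
  have hAm : ∀ f t, (t = u ∧ L.head? = some f) ∨ (t = v ∧ L.getLast? = some f) → f ∈ L := by
    rintro f t (⟨-, h⟩ | ⟨-, h⟩)
    exacts [List.mem_of_head? h, List.mem_of_getLast? h]
  have huv' := huv.ne
  refine hC.exists_extension huv (F := {f | f ∈ L})
    (A := fun t => {f | (t = u ∧ L.head? = some f) ∨ (t = v ∧ L.getLast? = some f)})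
    hL.not_mem hL.adj_left hL.adj_right (fun t f hf => hAm f t hf) ?_ ?_ ?_
  · rintro t f (⟨rfl, -⟩ | ⟨rfl, -⟩)
    · obtain ⟨w, hw, hwv, -⟩ := exists_adj_of_not_mem_ME hx (by rwa [S.me_symm])
      exact ⟨Or.inl rfl, not_isLeaf_of_ne hw huv hwv⟩
    · obtain ⟨w, hw, hwv, -⟩ := exists_adj_of_not_mem_ME hy hye
      exact ⟨Or.inr rfl, not_isLeaf_of_ne hw huv.symm hwv⟩
  · intro f hf q hq hqe
    constructor
    · intro hfq
      rcases hX q hq ⟨f, hf, hfq.symm⟩ with h1 | h1 | h1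
      · exact absurd h1 hqe
      · exact ⟨u, Or.inl ⟨rfl, (hu q h1 hqe f hf).1 hfq.symm⟩, h1⟩
      · exact ⟨v, Or.inr ⟨rfl, by simpa using (hv q h1 hqe f (by simpa using hf)).1 hfq.symm⟩, h1⟩
    · rintro ⟨t, ⟨rfl, h1⟩ | ⟨rfl, h1⟩, h2⟩
      · exact ((hu q h2 hqe f hf).2 h1).symm
      · exact ((hv q h2 hqe f (by simpa using hf)).2 (by simpa using h1)).symm
  · intro f hf
    refine ⟨L, hL.induced, hf, fun q hq => Or.inr hq, fun q hq => ?_, fun q hq => ?_⟩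
    · have : q ∉ S.MV u := fun h => hL.not_mem q hq (mem_VM_of_mem_MV h)
      simp [this, huv']
    · have : q ∉ S.MV v := fun h => hL.not_mem q hq (mem_VM_of_mem_MV h)
      simp [this, huv'.symm]

theorem IsLink.exists_larger_of_not_attached [Finite W] (hG : EvenHoleFree G) (hJ : J.IsTree)
    (hC : IsCrossEdge S a b α β) (hL : IsLink S a b L) (huv : J.Adj u v)
    (hX : ∀ p ∈ VM S, Touches G L p → p ∈ S.ME u v ∨ p ∈ S.MV v)
    (hx : x ∈ VM S) (hxv : x ∉ S.MV v) (hxt : Touches G L x)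
    (hy : y ∈ S.MV v) (hye : y ∉ S.ME u v) (hyt : Touches G L y) :
    ∃ S' : StripSystem G J, IsCrossEdge S' a b α β ∧ VM S' = VM S ∪ {f | f ∈ L} := by
  have hA := hJ.isAcyclic
  have hxe : x ∈ S.ME u v := (hX x hx hxt).resolve_right hxv
  have hn : ∀ x ∈ S.ME u v, x ∉ S.MV v → ∀ y ∈ S.MV v, y ∉ S.ME u v → ¬ LocalPair S x y :=
    fun x hx hxv y hy hye => not_localPair_of_not_mem_ME hA huv
      (ME_subset_side huv.symm (S.me_symm u v ▸ hx)) hxv hy hye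
  have ht : ∀ z ∈ S.MV v, z ∉ S.ME u v → Touches G L z := fun z hz hze =>
    hL.touches_of_mem_MV hG hJ hC huv (fun p hp hpt => (hX p hp hpt).imp_right Or.inr) hx hxv hxt
      hy hye hyt hz hze
  suffices key : ∀ L : List V, IsLink S a b L →
      (∀ p ∈ VM S, Touches G L p → p ∈ S.ME u v ∨ p ∈ S.MV v) →
      (∀ z ∈ S.MV v, z ∉ S.ME u v → Touches G L z) →
      AttHead G L x → AttHead G L.reverse y →
      ∃ S' : StripSystem G J, IsCrossEdge S' a b α β ∧ VM S' = VM S ∪ {f | f ∈ L} by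
    rcases hL.attHead_or hx (mem_VM_of_mem_MV hy) (hn x hxe hxv y hy hye)
      hxt hyt with ⟨h, h'⟩ | ⟨h, h'⟩
    · exact key L hL hX ht h h'
    · simpa using key L.reverse hL.reverse (by simpa only [touches_reverse] using hX)
        (by simpa only [touches_reverse] using ht) h (by rwa [List.reverse_reverse])
  clear hX ht hxt hyt hL
  intro L hL hX ht h h'
  have hv : ∀ z ∈ S.MV v, z ∉ S.ME u v → AttHead G L.reverse z := fun z hz hze =>
    hL.reverse.attHead (mem_VM_of_mem_MV hz) hx
      (fun h => hn x hxe hxv z hz hze h.symm) (touches_reverse.2 (ht z hz hze))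
      (by rwa [List.reverse_reverse])
  have huv' := huv.ne
  obtain ⟨R, hR, hxR⟩ := exists_rungList huv hxe
  obtain ⟨l₁, p, l₂, rfl, ⟨hpt, hpv⟩, hl₁⟩ :=
    EHF.exists_first (P := fun z => Touches G L z ∧ z ∉ S.MV v) hxR ⟨h.touches hL.ne, hxv⟩
  have hpe : p ∈ S.ME u v := hR.mem p (by simp)
  have hp := hL.attHead (mem_VM.2 ⟨u, v, huv, hpe⟩) (mem_VM_of_mem_MV hy)
    (hn p hpe hpv y hy hye) hpt h'
  have hI := hR.induced
  have hl₁v : ∀ q ∈ l₁, q ∉ S.MV v := by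
    intro q hq hqv
    have := (hR.last q (by simp [hq])).1 hqv
    rw [List.getLast?_append_of_ne_nil _ (by simp)] at this
    exact ((((inducedList_append _ _).1 hI).2.2 q hq q (List.mem_of_getLast? this)).1) rfl
  have hl₁t : ∀ q ∈ l₁, ¬ Touches G L q := fun q hq hqt => hl₁ q hq ⟨hqt, hl₁v q hq⟩
  rw [List.append_cons] at hI
  have hI' := ((inducedList_append _ _).1 hI).1
  have hVL : ∀ q ∈ l₁ ++ [p], q ∈ S.ME u v ∧ q ∉ L ∧ q ∉ S.MV v := by
    intro q hq
    have hqe : q ∈ S.ME u v := hR.mem q (by simp at hq ⊢; tauto)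
    refine ⟨hqe, fun h => hL.not_mem q h (mem_VM.2 ⟨u, v, huv, hqe⟩), ?_⟩
    rcases List.mem_append.1 hq with hq | hq
    · exact hl₁v q hq
    · rwa [List.mem_singleton.1 hq]
  refine hC.exists_extension huv (F := {f | f ∈ L})
    (A := fun t => {f | t = v ∧ L.getLast? = some f})
    hL.not_mem hL.adj_left hL.adj_right (fun t f hf => List.mem_of_getLast? hf.2) ?_ ?_ ?_
  · rintro t f ⟨rfl, -⟩
    obtain ⟨w, hw, hwv, -⟩ := exists_adj_of_not_mem_ME hy hye
    exact ⟨Or.inr rfl, not_isLeaf_of_ne hw huv.symm hwv⟩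
  · intro f hf q hq hqe
    constructor
    · intro hfq
      have h1 := (hX q hq ⟨f, hf, hfq.symm⟩).resolve_left hqe
      exact ⟨v, ⟨rfl, by simpa using (hv q h1 hqe f (by simpa using hf)).1 hfq.symm⟩, h1⟩
    · rintro ⟨t, ⟨rfl, h1⟩, h2⟩
      exact ((hv q h2 hqe f (by simpa using hf)).2 (by simpa using h1)).symm
  · intro f hf
    refine ⟨l₁ ++ [p] ++ L, ?_, List.mem_append_right _ hf, ?_, ?_, ?_⟩
    · refine (inducedList_append _ _).2 ⟨hI', hL.induced, fun q hq g hg => ⟨?_, ?_⟩⟩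
      · rintro rfl
        exact (hVL q hq).2.1 hg
      · rw [List.getLast?_concat]
        rcases List.mem_append.1 hq with hq' | hq'
        · refine iff_of_false (fun h => hl₁t q hq' ⟨g, hg, h⟩) fun h => ?_
          rw [← Option.some.inj h.1] at hq'
          exact hl₁t p hq' hpt
        · rw [List.mem_singleton.1 hq', hp g hg]
          simp
    · intro q hq
      exact (List.mem_append.1 hq).imp (fun h => (hVL q h).1) id
    · intro q hq
      have e : (l₁ ++ [p] ++ L).head? = (l₁ ++ p :: l₂).head? := by cases l₁ <;> rfl
      rw [e]
      rcases List.mem_append.1 hq with hq | hq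
      · rw [← hR.head q (by simp at hq ⊢; tauto)]
        simp [huv']
      · refine iff_of_false ?_ fun h => ?_
        · rintro (h | h)
          · exact hL.not_mem q hq (mem_VM_of_mem_MV h)
          · exact huv' h.1
        · exact hL.not_mem q hq (mem_VM.2 ⟨u, v, huv, hR.mem q (List.mem_of_head? h)⟩)
    · intro q hq
      rw [List.getLast?_append_of_ne_nil _ hL.ne]
      rcases List.mem_append.1 hq with hq | hq
      · refine iff_of_false ?_ fun h => (hVL q hq).2.1 (List.mem_of_getLast? h)
        rintro (h | h)
        · exact (hVL q hq).2.2 h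
        · exact (hVL q hq).2.1 (List.mem_of_getLast? h.2)
      · have : q ∉ S.MV v := fun h => hL.not_mem q hq (mem_VM_of_mem_MV h)
        simp [this]

theorem IsLink.exists_larger [Finite W] (hG : EvenHoleFree G) (hJ : J.IsTree)
    (hC : IsCrossEdge S a b α β) (hL : IsLink S a b L)
    (hx : x ∈ VM S) (hy : y ∈ VM S) (hn : ¬ LocalPair S x y)
    (hxt : Touches G L x) (hyt : Touches G L y) :
    ∃ S' : StripSystem G J, IsCrossEdge S' a b α β ∧ VM S' = VM S ∪ {f | f ∈ L} := by
  obtain ⟨u, v, huv, hX⟩ := hL.exists_edge hG hJ hC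
  have hz : ∀ t, ∃ z ∈ VM S, z ∉ S.MV t ∧ Touches G L z := by
    intro t
    by_contra! h
    refine hn (Or.inr ⟨t, ?_, ?_⟩) <;> by_contra h'
    exacts [h x hx h' hxt, h y hy h' hyt]
  by_cases hv : ∃ p ∈ S.MV v, p ∉ S.ME u v ∧ Touches G L p
  · obtain ⟨p, hp, hpe, hpt⟩ := hv
    by_cases hu : ∃ q ∈ S.MV u, q ∉ S.ME u v ∧ Touches G L q
    · obtain ⟨q, hq, hqe, hqt⟩ := hu
      exact hL.exists_larger_of_attached hG hJ hC huv hX hq hqe hqt hp hpe hpt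
    · obtain ⟨z, hz, hzv, hzt⟩ := hz v
      refine hL.exists_larger_of_not_attached hG hJ hC huv (fun r hr hrt => ?_) hz hzv hzt hp hpe hpt
      by_contra h
      rcases hX r hr hrt with h' | h' | h'
      exacts [h (Or.inl h'), hu ⟨r, h', fun h'' => h (Or.inl h''), hrt⟩, h (Or.inr h')]
  · by_cases hu : ∃ q ∈ S.MV u, q ∉ S.ME u v ∧ Touches G L q
    · obtain ⟨q, hq, hqe, hqt⟩ := hu
      obtain ⟨z, hz, hzv, hzt⟩ := hz u
      refine hL.exists_larger_of_not_attached hG hJ hC huv.symm (fun r hr hrt => ?_) hz hzv hzt hq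
        (by rwa [S.me_symm]) hqt
      rw [S.me_symm]
      by_contra h
      rcases hX r hr hrt with h' | h' | h'
      exacts [h (Or.inl h'), h (Or.inr h'), hv ⟨r, h', fun h'' => h (Or.inl h''), hrt⟩]
    · have : ∀ r ∈ VM S, Touches G L r → r ∈ S.ME u v := by
        intro r hr hrt
        by_contra h
        rcases hX r hr hrt with h' | h' | h'
        exacts [h h', hu ⟨r, h', h, hrt⟩, hv ⟨r, h', h, hrt⟩]
      exact absurd (Or.inl ⟨u, v, huv, this x hx hxt, this y hy hyt⟩) hn

end Enlarge

section Main

variable {G : SimpleGraph V} {J : SimpleGraph W} {S : StripSystem G J} {a b : V}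
  {α β : Set W} {x y : V} {F : Set V}

theorem exists_inducedList (P : G.Walk x y) : ∃ L, InducedList G L ∧ L.head? = some x ∧
    L.getLast? = some y ∧ ∀ f ∈ L, f ∈ P.support := by
  induction P with
  | @nil x => exact ⟨[x], by simp [InducedList]⟩
  | @cons x z y h P ih =>
    obtain ⟨L, hI, hh, hl, hs⟩ := ih
    by_cases hx : x ∈ L
    · obtain ⟨l₁, l₂, rfl⟩ := List.mem_iff_append.1 hx
      refine ⟨x :: l₂, ((inducedList_append _ _).1 hI).2.1, rfl, ?_, ?_⟩
      · rwa [List.getLast?_append_of_ne_nil _ (by simp)] at hl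
      · intro f hf
        simp [hs f (List.mem_append_right _ hf)]
    · obtain ⟨l₁, w, l₂, rfl, hw, hl₂⟩ :=
        EHF.exists_last (P := fun f => G.Adj x f) (List.mem_of_head? hh) h
      have hI' := ((inducedList_append _ _).1 hI).2.1
      refine ⟨x :: w :: l₂, ⟨fun h => hx (List.mem_append_right _ h), ?_, hI'⟩, rfl, ?_, ?_⟩
      · intro f hf
        rcases List.mem_cons.1 hf with rfl | hf'
        · simp [hw]
        · refine iff_of_false (hl₂ f hf') fun h => ?_
          rw [← Option.some.inj h] at hf'
          exact hl₂ w hf' hw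
      · rw [List.getLast?_append_of_ne_nil _ (by simp)] at hl
        rwa [List.getLast?_cons_cons]
      · intro f hf
        rcases List.mem_cons.1 hf with rfl | hf
        · simp
        · simp [hs f (List.mem_append_right _ hf)]

theorem exists_isLink (hF : ConnectedSubset G F) (hV : ∀ f ∈ F, f ∉ VM S)
    (ha : ∀ f ∈ F, f ≠ a ∧ ¬ G.Adj a f) (hb : ∀ f ∈ F, f ≠ b ∧ ¬ G.Adj b f)
    (hx : x ∈ Att G (VM S) F) (hy : y ∈ Att G (VM S) F) (hn : ¬ LocalPair S x y) :
    ∃ L x y, IsLink S a b L ∧ x ∈ VM S ∧ y ∈ VM S ∧ ¬ LocalPair S x y ∧ Touches G L x ∧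
      Touches G L y := by
  let P : List V → Prop := fun L => InducedList G L ∧ (∀ f ∈ L, f ∈ F) ∧
    ∃ x ∈ VM S, ∃ y ∈ VM S, ¬ LocalPair S x y ∧ ∃ f f', L.head? = some f ∧
      L.getLast? = some f' ∧ G.Adj x f ∧ G.Adj y f'
  have hP : ∃ L, P L := by
    obtain ⟨hxV, f, hf, hxf⟩ := hx
    obtain ⟨hyV, g, hg, hyg⟩ := hy
    obtain ⟨T, hT⟩ := hF.2 f hf g hg
    obtain ⟨L, hI, hh, hl, hs⟩ := exists_inducedList T
    exact ⟨L, hI, fun f hf => hT f (hs f hf), x, hxV, y, hyV, hn, f, g, hh, hl, hxf, hyg⟩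
  obtain ⟨L, ⟨hI, hLF, x, hxV, y, hyV, hn, f, g, hh, hl, hxf, hyg⟩, hmin⟩ :=
    (measure List.length).wf.has_min {L | P L} hP
  have hmin : ∀ L', P L' → L.length ≤ L'.length := fun L' h => not_lt.1 (hmin L' h)
  have key : ∀ x ∈ VM S, ∀ y ∈ VM S, ¬ LocalPair S x y → ∀ f f' l₁ l₂, L = l₁ ++ f :: l₂ →
      f' ∈ f :: l₂ → G.Adj x f → G.Adj y f' → L.head? = some f ∧ L.getLast? = some f' := by
    intro x hx y hy hn f f' l₁ l₂ e hf' hxf hyf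
    obtain ⟨m, t, e'⟩ := List.mem_iff_append.1 hf'
    rw [e', List.append_cons m] at e
    have hI' := hI
    rw [e] at hI'
    have hhead : (m ++ [f']).head? = some f := by
      cases m with
      | nil => simp only [List.nil_append, List.cons.injEq] at e'; simp [e'.1]
      | cons c m => simp only [List.cons_append, List.cons.injEq] at e'; simp [e'.1]
    have := hmin (m ++ [f'])
      ⟨((inducedList_append _ _).1 ((inducedList_append _ _).1 hI').2.1).1,
        fun q hq => hLF q (by rw [e]; simp only [List.mem_append] at hq ⊢; tauto),
        x, hx, y, hy, hn, f, f', hhead, by simp, hxf, hyf⟩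
    rw [e] at this
    simp only [List.length_append] at this
    have h1 : l₁ = [] := List.length_eq_zero_iff.1 (by omega)
    have h2 : t = [] := List.length_eq_zero_iff.1 (by omega)
    subst h1 h2
    rw [e]
    simpa using hhead
  refine ⟨L, x, y, ⟨?_, hI, fun f hf => hV f (hLF f hf), fun f hf => ha f (hLF f hf),
    fun f hf => hb f (hLF f hf), ?_⟩, hxV, hyV, hn, ⟨f, List.mem_of_head? hh, hxf⟩,
    ⟨g, List.mem_of_getLast? hl, hyg⟩⟩
  · rintro rfl
    simp at hh
  · intro x hx y hy hn f hf f' hf' hxf hyf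
    obtain ⟨l₁, l₂, e⟩ := List.mem_iff_append.1 hf
    by_cases h : f' ∈ f :: l₂
    · exact Or.inl (key x hx y hy hn f f' l₁ l₂ e h hxf hyf)
    · have h' : f' ∈ l₁ := by
        rw [e] at hf'
        exact (List.mem_append.1 hf').resolve_right h
      obtain ⟨s, t, rfl⟩ := List.mem_iff_append.1 h'
      exact Or.inr (key y hy x hx (fun h => hn h.symm) f' f s (t ++ f :: l₂) (by simpa using e)
        (by simp) hyf hxf).symm

end Main

theorem statement_7 {V W : Type*} [Fintype V] [Fintype W] (G : SimpleGraph V)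
    (hG : EvenHoleFree G) (J : SimpleGraph W) (hJ : J.IsTree)
    (S : StripSystem G J) (a b : V) (α β : Set W)
    (hopt : OptimalFor S a b α β)
    (Z : Set V) (hZ : Z = {z : V | G.Adj a z ∧ G.Adj b z})
    (F : Set V) (hF : ConnectedSubset G F) (hFd : Disjoint F (Z ∪ VM S))
    (hna : ∀ x ∈ F, ¬ G.Adj a x) (hnb : ∀ x ∈ F, ¬ G.Adj b x) :
    IsLocal S a b α β (Att G (VM S) F) := by
  by_contra hloc
  have hC := hopt.2.2.1
  have hV : ∀ f ∈ F, f ∉ VM S := fun f hf h => Set.disjoint_left.1 hFd hf (Or.inr h)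
  obtain ⟨x, hx, y, hy, hn⟩ := exists_not_localPair hJ (S := S) (X := Att G (VM S) F)
    (fun p hp => hp.1) (fun u v h h' => hloc (Or.inl ⟨u, v, h, h'⟩))
    fun u h => hloc (Or.inr (Or.inl ⟨u, h⟩))
  obtain ⟨L, x, y, hL, hx, hy, hn, hxt, hyt⟩ := exists_isLink (a := a) (b := b) hF hV
    (fun f hf => ⟨fun h => hnb f hf (h ▸ hC.1.symm), hna f hf⟩)
    (fun f hf => ⟨fun h => hna f hf (h ▸ hC.1), hnb f hf⟩) hx hy hn
  obtain ⟨S', hS', e⟩ := hL.exists_larger hG hJ hC hx hy hn hxt hyt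
  have h := hopt.2.2.2 S' α β hS' (e ▸ Set.subset_union_left)
  obtain ⟨f, hf⟩ := List.exists_mem_of_ne_nil L hL.ne
  exact hL.not_mem f hf (h ▸ e ▸ Or.inr hf)

end EHF
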